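/- arXiv:math/0402172 — 8 statements merged into one kernel-verified Lean document; each statement's English description precedes it below -/
import Mathlib

section
/- Let E : K → H be a bounded linear operator between complex Hilbert spaces, and for δ > 0 let F_δ := (E*E + δI)^{-1}E*. Then lim_{δ→0+} E F_δ f = f (in the norm of H) for every f ∈ H if and only if the range of E is dense in H. -/
open scoped Topology

/-- A solution `u` of the normal equation `(E*E + δI) u = E* f` minimizes the Tikhonov functional
`v ↦ ‖f - E v‖ ^ 2 + δ * ‖v‖ ^ 2`. -/
theorem tikhonov_le_of_normal_equation
    {K H : Type*} [NormedAddCommGroup K] [InnerProductSpace ℂ K] [CompleteSpace K]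
    [NormedAddCommGroup H] [InnerProductSpace ℂ H] [CompleteSpace H]
    (E : K →L[ℂ] H) {δ : ℝ} (hδ : 0 ≤ δ) {f : H} {u : K}
    (hu : (E.adjoint ∘L E + (δ : ℂ) • (1 : K →L[ℂ] K)) u = E.adjoint f) (v : K) :
    ‖f - E u‖ ^ 2 + δ * ‖u‖ ^ 2 ≤ ‖f - E v‖ ^ 2 + δ * ‖v‖ ^ 2 := by
  have hres : E.adjoint (f - E u) = (δ : ℂ) • u := by
    rw [map_sub, ← hu]
    simp
  have hinner : RCLike.re (inner ℂ (f - E u) (E (v - u)))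
      = δ * RCLike.re (inner ℂ u (v - u)) := by
    rw [← ContinuousLinearMap.adjoint_inner_left, hres, inner_smul_left, Complex.conj_ofReal]
    exact Complex.re_ofReal_mul δ _
  have hH := norm_sub_sq (𝕜 := ℂ) (f - E u) (E (v - u))
  have hK := norm_add_sq (𝕜 := ℂ) u (v - u)
  have hdiff : f - E u - E (v - u) = f - E v := by
    rw [map_sub]
    abel
  rw [hdiff, hinner] at hH
  rw [add_sub_cancel] at hK
  rw [hH, hK]
  nlinarith [sq_nonneg ‖E (v - u)‖, mul_nonneg hδ (sq_nonneg ‖v - u‖)]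

/-- Proposition 4 (second part): with `F δ = (E*E + δI)⁻¹ E*`, one has
`E (F δ f) → f` as `δ → 0+` for every `f` if and only if `E` has dense range. -/
theorem regularized_inverse_convergence_iff_denseRange
    {K H : Type*} [NormedAddCommGroup K] [InnerProductSpace ℂ K] [CompleteSpace K]
    [NormedAddCommGroup H] [InnerProductSpace ℂ H] [CompleteSpace H]
    (E : K →L[ℂ] H) (F : ℝ → (H →L[ℂ] K))
    (hF : ∀ δ : ℝ, 0 < δ → ∀ f : H,
      (E.adjoint ∘L E + (δ : ℂ) • (1 : K →L[ℂ] K)) (F δ f) = E.adjoint f) :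
    (∀ f : H, Filter.Tendsto (fun δ : ℝ => E (F δ f)) (𝓝[>] 0) (𝓝 f)) ↔
      DenseRange E := by
  constructor
  · intro h f
    exact mem_closure_of_tendsto (h f) (Filter.Eventually.of_forall fun δ => ⟨F δ f, rfl⟩)
  · intro hE f
    rw [Metric.tendsto_nhds]
    intro ε hε
    obtain ⟨v, hv⟩ := hE.exists_dist_lt f hε
    rw [dist_eq_norm] at hv
    have hlim : Filter.Tendsto (fun δ : ℝ => ‖f - E v‖ ^ 2 + δ * ‖v‖ ^ 2) (𝓝[>] 0)
        (𝓝 (‖f - E v‖ ^ 2 + 0 * ‖v‖ ^ 2)) :=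
      ((by fun_prop : Continuous fun δ : ℝ => ‖f - E v‖ ^ 2 + δ * ‖v‖ ^ 2).tendsto 0).mono_left
        nhdsWithin_le_nhds
    have hlt : ‖f - E v‖ ^ 2 + 0 * ‖v‖ ^ 2 < ε ^ 2 := by
      rw [zero_mul, add_zero]
      gcongr
    filter_upwards [hlim.eventually_lt_const hlt, self_mem_nhdsWithin] with δ hδε hδ
    have hδ₀ : 0 < δ := hδ
    have hmin := tikhonov_le_of_normal_equation E hδ₀.le (hF δ hδ₀ f) v
    rw [dist_comm, dist_eq_norm]
    refine lt_of_pow_lt_pow_left₀ 2 hε.le ?_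
    linarith [mul_nonneg hδ₀.le (sq_nonneg ‖F δ f‖)]
end

section
/- Let (Ω, μ) be a σ-finite measure space, let σ : Ω → ℂ be measurable, and let A be a closed linear operator in a complex Hilbert space H. Suppose e : Ω → H is strongly measurable with e_ω ∈ Dom(A) and ‖e_ω‖ = 1 for almost every ω, that ω ↦ A e_ω is strongly measurable, and that ‖A e_ω − σ(ω) e_ω‖ ≤ ε′ for almost every ω. Define E : L¹(Ω, μ) → H by Eφ = ∫_Ω φ(ω) e_ω dμ(ω) (Bochner integral). Then E is bounded with ‖E‖ ≤ 1, and for every φ ∈ L¹(Ω, μ) with σφ ∈ L¹(Ω, μ) one has Eφ ∈ Dom(A) and ‖A(Eφ) − E(σ·φ)‖ ≤ ε′ ‖φ‖₁. -/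
open MeasureTheory
open scoped ENNReal

/-- The integral of an integrable function with values a.e. in a closed submodule lies in that
submodule. -/
theorem Submodule.integral_mem_of_isClosed {𝕜 F Ω : Type*} [RCLike 𝕜] [NormedAddCommGroup F]
    [NormedSpace ℝ F] [NormedSpace 𝕜 F] [CompleteSpace F] [MeasurableSpace Ω]
    {μ : Measure Ω} (S : Submodule 𝕜 F) (hS : IsClosed (S : Set F)) {f : Ω → F}
    (hf : Integrable f μ) (hfS : ∀ᵐ ω ∂μ, f ω ∈ S) : ∫ ω, f ω ∂μ ∈ S := by
  have : IsClosed (S : Set F) := hS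
  let _ : NormedSpace ℝ (F ⧸ S) := NormedSpace.restrictScalars ℝ 𝕜 (F ⧸ S)
  rw [← Submodule.Quotient.mk_eq_zero]
  have hzero : ∫ ω, S.mkQL (f ω) ∂μ = 0 := integral_eq_zero_of_ae <| by
    filter_upwards [hfS] with ω hω
    exact (Submodule.Quotient.mk_eq_zero S).2 hω
  rw [← hzero, S.mkQL.integral_comp_comm hf]
  rfl

/-- Theorem 6 of the paper: from a measurable family of unit pseudo-eigenvectors
`e_ω ∈ Dom A` with `‖A e_ω - σ(ω) e_ω‖ ≤ ε'` a.e., the operator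
`E φ = ∫ φ(ω) e_ω dμ(ω)` on `L¹` is bounded with norm at most `1` and satisfies
`‖A (E φ) - E (Λ φ)‖ ≤ ε' ‖φ‖₁` on the maximal domain of `Λ`. -/
theorem pseudoeigenvector_family_gives_intertwiner
    {H : Type*} [NormedAddCommGroup H] [InnerProductSpace ℂ H] [CompleteSpace H]
    {Ω : Type*} [MeasurableSpace Ω] (μ : Measure Ω) [SigmaFinite μ]
    (σ : Ω → ℂ) (hσ : Measurable σ)
    (A : H →ₗ.[ℂ] H) (hclosed : IsClosed (A.graph : Set (H × H)))
    (e : Ω → H) (he_meas : AEStronglyMeasurable e μ)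
    (he_norm : ∀ᵐ ω ∂μ, ‖e ω‖ = 1)
    (Ae : Ω → H) (hAe_meas : AEStronglyMeasurable Ae μ)
    (hAe : ∀ᵐ ω ∂μ, ∃ h : e ω ∈ A.domain, A ⟨e ω, h⟩ = Ae ω)
    (ε' : ℝ)
    (hest : ∀ᵐ ω ∂μ, ‖Ae ω - σ ω • e ω‖ ≤ ε') :
    (∀ φ : Ω → ℂ, Integrable φ μ →
      ‖∫ ω, φ ω • e ω ∂μ‖ ≤ ∫ ω, ‖φ ω‖ ∂μ) ∧
    (∀ φ : Ω → ℂ, Integrable φ μ → Integrable (fun ω => σ ω * φ ω) μ →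
      ∃ h : (∫ ω, φ ω • e ω ∂μ) ∈ A.domain,
        ‖A ⟨∫ ω, φ ω • e ω ∂μ, h⟩ - ∫ ω, (σ ω * φ ω) • e ω ∂μ‖
          ≤ ε' * ∫ ω, ‖φ ω‖ ∂μ) := by
  have integrable_smul_e {ψ : Ω → ℂ} (hψ : Integrable ψ μ) :
      Integrable (fun ω => ψ ω • e ω) μ := by
    refine hψ.mono (hψ.aestronglyMeasurable.smul he_meas) ?_
    filter_upwards [he_norm] with ω hω
    rw [norm_smul, hω, mul_one]
  refine ⟨fun φ hφ => ?_, fun φ hφ hσφ => ?_⟩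
  · refine norm_integral_le_of_norm_le hφ.norm ?_
    filter_upwards [he_norm] with ω hω
    rw [norm_smul, hω, mul_one]
  · have hbound : ∀ᵐ ω ∂μ, ‖φ ω • Ae ω - (σ ω * φ ω) • e ω‖ ≤ ε' * ‖φ ω‖ := by
      filter_upwards [hest] with ω hω
      rw [mul_comm (σ ω), mul_smul, ← smul_sub, norm_smul, mul_comm]
      gcongr
    have hσφe := integrable_smul_e hσφ
    have hφAe : Integrable (fun ω => φ ω • Ae ω) μ := by
      have hdiff : Integrable (fun ω => φ ω • Ae ω - (σ ω * φ ω) • e ω) μ :=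
        (hφ.norm.const_mul ε').mono'
          ((hφ.aestronglyMeasurable.smul hAe_meas).sub hσφe.aestronglyMeasurable) hbound
      exact (hdiff.add hσφe).congr (ae_of_all _ fun ω => sub_add_cancel _ _)
    have hgraph : (∫ ω, φ ω • e ω ∂μ, ∫ ω, φ ω • Ae ω ∂μ) ∈ A.graph := by
      rw [← integral_pair (integrable_smul_e hφ) hφAe]
      refine A.graph.integral_mem_of_isClosed hclosed
        ((integrable_smul_e hφ).prodMk hφAe) ?_
      filter_upwards [hAe] with ω ⟨hdom, hval⟩
      rw [← hval]
      exact A.graph.smul_mem (φ ω) (A.mem_graph ⟨e ω, hdom⟩)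
    obtain ⟨⟨x, hx⟩, rfl, hAx⟩ := (LinearPMap.mem_graph_iff A).1 hgraph
    refine ⟨hx, ?_⟩
    rw [hAx, ← integral_sub hφAe hσφe, ← integral_const_mul]
    exact norm_integral_le_of_norm_le (hφ.norm.const_mul ε') hbound
end

section
/- Let B be a Banach space, H a Hilbert space, and A a closed linear operator with domain Dom(A) ⊆ B and range in H. Let c > 0, and suppose f_n ∈ Dom(A), f_n → f in B, g_n → g in H, and ‖A f_n − g_n‖ ≤ c for all n. Then f ∈ Dom(A) and ‖A f − g‖ ≤ c. -/
/-- Weak compactness of closed balls in a Hilbert space, along ultrafilters. -/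
theorem exists_weak_limit_of_norm_le
    {H ι : Type*} [NormedAddCommGroup H] [InnerProductSpace ℝ H] [CompleteSpace H]
    (U : Ultrafilter ι) {w : ι → H} {c : ℝ} (hw : ∀ i, ‖w i‖ ≤ c) :
    ∃ x : H, ‖x‖ ≤ c ∧
      ∀ φ : StrongDual ℝ H, Filter.Tendsto (fun i => φ (w i)) U (nhds (φ x)) := by
  let T : ι → WeakDual ℝ H := fun i =>
    StrongDual.toWeakDual (InnerProductSpace.toDual ℝ H (w i))
  obtain ⟨ψ, hψ, hlim⟩ :=
    (WeakDual.isCompact_closedBall (𝕜 := ℝ) (0 : StrongDual ℝ H) c).ultrafilter_le_nhds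
      (U.map T) (by
        rw [Filter.le_principal_iff]
        refine Filter.mem_map.2 (Filter.Eventually.of_forall fun i => ?_)
        simpa [T] using hw i)
  refine ⟨(InnerProductSpace.toDual ℝ H).symm (WeakDual.toStrongDual ψ), ?_, fun φ => ?_⟩
  · simpa using hψ
  · obtain ⟨v, rfl⟩ := (InnerProductSpace.toDual ℝ H).surjective φ
    have h : Filter.Tendsto (fun i => T i v) U (nhds (ψ v)) :=
      ((WeakDual.eval_continuous v).tendsto ψ).comp hlim
    rw [InnerProductSpace.toDual_apply_apply, real_inner_comm,
      InnerProductSpace.toDual_symm_apply]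
    refine h.congr fun i => ?_
    simp [T, real_inner_comm]

/-- A closed convex set contains the weak limits of its elements. -/
theorem mem_of_weak_limit {E ι : Type*} [NormedAddCommGroup E] [NormedSpace ℝ E]
    {s : Set E} (hs : Convex ℝ s) (hs' : IsClosed s) {l : Filter ι} [l.NeBot]
    {u : ι → E} {x : E} (hu : ∀ i, u i ∈ s)
    (hlim : ∀ φ : StrongDual ℝ E, Filter.Tendsto (fun i => φ (u i)) l (nhds (φ x))) :
    x ∈ s := by
  by_contra hx
  obtain ⟨φ, r, hr, hsr⟩ := geometric_hahn_banach_point_closed hs hs' hx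
  exact hr.not_ge (ge_of_tendsto' (hlim φ) fun i => (hsr _ (hu i)).le)

/-- Lemma 7 of the paper: if `A` is a closed operator from a Banach space `B` to a
Hilbert space `H`, `f_n ∈ Dom A`, `f_n → f`, `g_n → g` and `‖A f_n - g_n‖ ≤ c`, then
`f ∈ Dom A` and `‖A f - g‖ ≤ c`. -/
theorem closed_operator_limit_bound
    {B : Type*} [NormedAddCommGroup B] [NormedSpace ℝ B] [CompleteSpace B]
    {H : Type*} [NormedAddCommGroup H] [InnerProductSpace ℝ H] [CompleteSpace H]
    (A : B →ₗ.[ℝ] H) (hclosed : IsClosed (A.graph : Set (B × H)))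
    (c : ℝ) (hc : 0 < c)
    (fn : ℕ → A.domain) (f : B) (gn : ℕ → H) (g : H)
    (hf : Filter.Tendsto (fun n => (fn n : B)) Filter.atTop (nhds f))
    (hg : Filter.Tendsto gn Filter.atTop (nhds g))
    (hbound : ∀ n, ‖A (fn n) - gn n‖ ≤ c) :
    ∃ hf' : f ∈ A.domain, ‖A ⟨f, hf'⟩ - g‖ ≤ c := by
  let U : Ultrafilter ℕ := Ultrafilter.of Filter.atTop
  have hU : (U : Filter ℕ) ≤ Filter.atTop := Ultrafilter.of_le _
  obtain ⟨w, hwc, hw⟩ := exists_weak_limit_of_norm_le U hbound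
  have hmem : (f, w + g) ∈ (A.graph : Set (B × H)) := by
    refine mem_of_weak_limit (l := (U : Filter ℕ)) A.graph.convex hclosed
      (fun n => A.mem_graph (fn n)) fun φ => ?_
    have hsplit (x : B) (y : H) : φ (x, y) =
        φ.comp (ContinuousLinearMap.inl ℝ B H) x + φ.comp (ContinuousLinearMap.inr ℝ B H) y := by
      simp [← map_add]
    simp only [hsplit]
    refine (((ContinuousLinearMap.continuous _).tendsto f).comp (hf.mono_left hU)).add ?_
    rw [map_add]
    refine ((hw _).add
      (((ContinuousLinearMap.continuous _).tendsto g).comp (hg.mono_left hU))).congr fun n => ?_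
    rw [Function.comp_apply, ← map_add, sub_add_cancel]
  obtain ⟨y, hy, hAy⟩ := A.mem_graph_iff.1 hmem
  obtain rfl : (y : B) = f := hy
  refine ⟨y.2, ?_⟩
  have hA : A ⟨y, y.2⟩ = w + g := hAy
  rwa [hA, add_sub_cancel_right]
end

section
/- For each h ∈ [0,1] and x ∈ ℝ^N, let a^{jk}_h(x) ∈ ℂ (1 ≤ j,k ≤ N), b^j_h(x) ∈ ℂ (1 ≤ j ≤ N) and c_h(x) ∈ ℂ be coefficients that are locally Lipschitz continuous jointly in (x,h) ∈ ℝ^N × [0,1]. For h ∈ (0,1] let L_h act on smooth compactly supported f : ℝ^N → ℂ by (L_h f)(x) = −h² a^{jk}_h(x) ∂_j∂_k f(x) − i h b^j_h(x) ∂_j f(x) + c_h(x) f(x) (summation over repeated indices), and let σ(u,ξ) = a^{jk}_0(u) ξ_j ξ_k + b^j_0(u) ξ_j + c_0(u). Then for every u ∈ ℝ^N and ξ ∈ ℝ^N there exist a constant c > 0, a constant C > 0, and for each h ∈ (0,1] a function f_h ∈ C_c^∞(ℝ^N) such that ‖f_h‖_{L²} = c, ‖x^j f_h − u^j f_h‖_{L²}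 ≤ C h^{1/2}, ‖−ih ∂_j f_h − ξ_j f_h‖_{L²} ≤ C h^{1/2}, and ‖L_h f_h − σ(u,ξ) f_h‖_{L²} ≤ C h^{1/2}, for all h ∈ (0,1] and all 1 ≤ j ≤ N. -/
open MeasureTheory
open scoped ENNReal NNReal

namespace WavePacket

open Filter

variable {N : ℕ}

/-- The partial derivative in the `j`-th coordinate direction. -/
noncomputable def partialDeriv (j : Fin N) (g : EuclideanSpace ℝ (Fin N) → ℂ)
    (y : EuclideanSpace ℝ (Fin N)) : ℂ :=
  fderiv ℝ g y (EuclideanSpace.single j 1)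

/-- The profile `g` transplanted to the phase-space point `(u, ξ)` at length scale `s`, with
semiclassical parameter `h = s ^ 2`, normalized so as to preserve the `L²` norm. -/
noncomputable def packet (u : EuclideanSpace ℝ (Fin N)) (ξ : Fin N → ℝ) (s : ℝ)
    (g : EuclideanSpace ℝ (Fin N) → ℂ) (x : EuclideanSpace ℝ (Fin N)) : ℂ :=
  (Real.sqrt (s ^ N))⁻¹ * Complex.exp (Complex.I * (∑ j, ξ j * x j : ℝ) / (s : ℂ) ^ 2) *
    g (s⁻¹ • (x - u))

/-- The operator on profiles conjugate to `-i h ∂_j` under `packet`. -/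
noncomputable def momentum (ξ : Fin N → ℝ) (s : ℝ) (j : Fin N)
    (g : EuclideanSpace ℝ (Fin N) → ℂ) (y : EuclideanSpace ℝ (Fin N)) : ℂ :=
  ξ j * g y - Complex.I * s * partialDeriv j g y

lemma contDiff_partialDeriv (j : Fin N) {g : EuclideanSpace ℝ (Fin N) → ℂ}
    (hg : ContDiff ℝ (⊤ : ℕ∞) g) : ContDiff ℝ (⊤ : ℕ∞) (partialDeriv j g) :=
  (hg.fderiv_right (m := (⊤ : ℕ∞)) (by simp)).clm_apply contDiff_const

lemma contDiff_momentum (ξ : Fin N → ℝ) (s : ℝ) (j : Fin N)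
    {g : EuclideanSpace ℝ (Fin N) → ℂ}
    (hg : ContDiff ℝ (⊤ : ℕ∞) g) : ContDiff ℝ (⊤ : ℕ∞) (momentum ξ s j g) :=
  (contDiff_const.mul hg).sub (contDiff_const.mul (contDiff_partialDeriv j hg))

lemma tsupport_partialDeriv_subset (j : Fin N) (g : EuclideanSpace ℝ (Fin N) → ℂ) :
    tsupport (partialDeriv j g) ⊆ tsupport g :=
  tsupport_fderiv_apply_subset ℝ _

lemma contDiff_packet (u : EuclideanSpace ℝ (Fin N)) (ξ : Fin N → ℝ) (s : ℝ)
    {g : EuclideanSpace ℝ (Fin N) → ℂ} (hg : ContDiff ℝ (⊤ : ℕ∞) g) :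
    ContDiff ℝ (⊤ : ℕ∞) (packet u ξ s g) := by
  have hsum : ContDiff ℝ (⊤ : ℕ∞)
      (fun x : EuclideanSpace ℝ (Fin N) => ∑ j, ξ j * x j) := by
    fun_prop
  have hphase : ContDiff ℝ (⊤ : ℕ∞)
      (fun x : EuclideanSpace ℝ (Fin N) => ((∑ j, ξ j * x j : ℝ) : ℂ)) :=
    Complex.ofRealCLM.contDiff.comp hsum
  refine (contDiff_const.mul (ContDiff.cexp ?_)).mul (hg.comp (by fun_prop))
  exact (contDiff_const.mul hphase).div_const _

lemma hasCompactSupport_packet (u : EuclideanSpace ℝ (Fin N)) (ξ : Fin N → ℝ) {s : ℝ}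
    (hs : 0 < s) {g : EuclideanSpace ℝ (Fin N) → ℂ} (hg : HasCompactSupport g) :
    HasCompactSupport (packet u ξ s g) := by
  exact HasCompactSupport.mul_left (HasCompactSupport.comp_homeomorph hg
    ((Homeomorph.subRight u).trans (Homeomorph.smulOfNeZero s⁻¹ (inv_ne_zero hs.ne'))))

lemma norm_packet (u : EuclideanSpace ℝ (Fin N)) (ξ : Fin N → ℝ) (s : ℝ)
    (g : EuclideanSpace ℝ (Fin N) → ℂ) (x : EuclideanSpace ℝ (Fin N)) :
    ‖packet u ξ s g x‖ = (Real.sqrt (s ^ N))⁻¹ * ‖g (s⁻¹ • (x - u))‖ := by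
  have : Complex.I * ((∑ j, ξ j * x j : ℝ) : ℂ) / (s : ℂ) ^ 2
      = (((∑ j, ξ j * x j) / s ^ 2 : ℝ) : ℂ) * Complex.I := by
    push_cast; ring
  rw [packet, this, norm_mul, norm_mul, Complex.norm_exp_ofReal_mul_I, mul_one,
    Complex.norm_real, Real.norm_of_nonneg (by positivity)]

/-- Passing from a profile to its packet preserves the `L²` norm. -/
lemma eLpNorm_packet (u : EuclideanSpace ℝ (Fin N)) (ξ : Fin N → ℝ) {s : ℝ} (hs : 0 < s)
    {g : EuclideanSpace ℝ (Fin N) → ℂ} (hg : AEStronglyMeasurable g volume) :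
    eLpNorm (packet u ξ s g) 2 volume = eLpNorm g 2 volume := by
  have hmap : Measure.map (fun x : EuclideanSpace ℝ (Fin N) => s⁻¹ • (x - u)) volume
      = ENNReal.ofReal (s ^ N) • volume := by
    have := Measure.map_addHaar_smul (volume : Measure (EuclideanSpace ℝ (Fin N)))
      (inv_ne_zero hs.ne')
    rw [show (fun x : EuclideanSpace ℝ (Fin N) => s⁻¹ • (x - u))
        = (fun x => s⁻¹ • x) ∘ (fun x => x - u) from rfl,
      ← Measure.map_map (by fun_prop) (by fun_prop),
      (measurePreserving_sub_right volume u).map_eq]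
    refine this.trans ?_
    rw [finrank_euclideanSpace_fin, inv_pow, inv_inv, abs_of_pos (by positivity)]
  have hsq : (0 : ℝ) < Real.sqrt (s ^ N) := by positivity
  calc eLpNorm (packet u ξ s g) 2 volume
      = eLpNorm ((Real.sqrt (s ^ N))⁻¹ •
          (g ∘ fun x : EuclideanSpace ℝ (Fin N) => s⁻¹ • (x - u))) 2 volume := by
        refine eLpNorm_congr_norm_ae (ae_of_all _ fun x => ?_)
        rw [norm_packet, Pi.smul_apply, norm_smul, Function.comp_apply,
          Real.norm_of_nonneg (by positivity)]
    _ = ENNReal.ofReal (Real.sqrt (s ^ N))⁻¹ *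
          eLpNorm g 2 (ENNReal.ofReal (s ^ N) • volume) := by
        rw [eLpNorm_const_smul, ← hmap, eLpNorm_map_measure _ (by fun_prop),
          Real.enorm_of_nonneg (by positivity)]
        rw [hmap]
        exact hg.smul_measure _
    _ = eLpNorm g 2 volume := by
        rw [eLpNorm_smul_measure_of_ne_top (by simp), smul_eq_mul, ← mul_assoc]
        have : ENNReal.ofReal (s ^ N) ^ (1 / (2 : ℝ≥0∞)).toReal
            = ENNReal.ofReal (Real.sqrt (s ^ N)) := by
          rw [ENNReal.ofReal_rpow_of_pos (by positivity), Real.sqrt_eq_rpow]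
          simp
        rw [this, ← ENNReal.ofReal_mul (by positivity), inv_mul_cancel₀ hsq.ne']
        simp

lemma partialDeriv_packet (u : EuclideanSpace ℝ (Fin N)) (ξ : Fin N → ℝ) {s : ℝ} (hs : 0 < s)
    {g : EuclideanSpace ℝ (Fin N) → ℂ} (hg : ContDiff ℝ (⊤ : ℕ∞) g) (j : Fin N) :
    partialDeriv j (packet u ξ s g)
      = fun x => Complex.I / (s : ℂ) ^ 2 * packet u ξ s (momentum ξ s j g) x := by
  funext x
  have hs' : (s : ℂ) ≠ 0 := by exact_mod_cast hs.ne'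
  have hphase : HasFDerivAt (fun x : EuclideanSpace ℝ (Fin N) => (∑ j, ξ j * x j : ℝ))
      (∑ j, ξ j • (EuclideanSpace.proj j : EuclideanSpace ℝ (Fin N) →L[ℝ] ℝ)) x := by
    refine HasFDerivAt.fun_sum fun i _ => ?_
    exact (EuclideanSpace.proj (𝕜 := ℝ) i).hasFDerivAt.const_mul (ξ i)
  have hexp := (((Complex.ofRealCLM.hasFDerivAt.comp x hphase).const_mul
    (Complex.I / (s : ℂ) ^ 2)).cexp).const_mul (((Real.sqrt (s ^ N))⁻¹ : ℝ) : ℂ)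
  have hin : HasFDerivAt (fun x : EuclideanSpace ℝ (Fin N) => s⁻¹ • (x - u))
      (s⁻¹ • ContinuousLinearMap.id ℝ _) x :=
    ((hasFDerivAt_id x).sub_const u).const_smul s⁻¹
  have hgd : HasFDerivAt g (fderiv ℝ g (s⁻¹ • (x - u))) (s⁻¹ • (x - u)) :=
    ((hg.differentiable (by simp)) _).hasFDerivAt
  have key := hexp.mul (hgd.comp x hin)
  have hfderiv := (key.congr_of_eventuallyEq (f₁ := packet u ξ s g)
    (Eventually.of_forall fun z => by simp [packet, mul_div_right_comm])).fderiv
  rw [partialDeriv, hfderiv]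
  simp [packet, momentum, partialDeriv, mul_div_right_comm]
  field_simp
  linear_combination (s : ℂ) * fderiv ℝ g ((1 / s) • (x - u)) (EuclideanSpace.single j 1) *
    Complex.I_sq

lemma momentum_momentum (ξ : Fin N → ℝ) (s : ℝ) (j k : Fin N)
    {g : EuclideanSpace ℝ (Fin N) → ℂ} (hg : ContDiff ℝ (⊤ : ℕ∞) g)
    (y : EuclideanSpace ℝ (Fin N)) :
    momentum ξ s j (momentum ξ s k g) y = ξ j * ξ k * g y
      + s * (-Complex.I * (ξ j * partialDeriv k g y + ξ k * partialDeriv j g y)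
        - s * partialDeriv j (partialDeriv k g) y) := by
  have hd : HasFDerivAt g (fderiv ℝ g y) y := (hg.differentiable (by simp) y).hasFDerivAt
  have hd' : HasFDerivAt (partialDeriv k g) (fderiv ℝ (partialDeriv k g) y) y :=
    ((contDiff_partialDeriv k hg).differentiable (by simp) y).hasFDerivAt
  have key : partialDeriv j (momentum ξ s k g) y
      = ξ k * partialDeriv j g y - Complex.I * s * partialDeriv j (partialDeriv k g) y := by
    have hm : HasFDerivAt (momentum ξ s k g) _ y :=
      (hd.const_mul (ξ k : ℂ)).sub (hd'.const_mul (Complex.I * s))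
    rw [partialDeriv, hm.fderiv]
    simp [partialDeriv]
  rw [momentum, key, momentum]
  linear_combination (s : ℂ) ^ 2 * partialDeriv j (partialDeriv k g) y * Complex.I_sq

/-- The family of profiles `F s` vanishes off the closed unit ball and is `O(s ^ n)` uniformly
on it, for `s ∈ (0, 1]`. -/
def IsLocalizedBigO (n : ℕ) (F : ℝ → EuclideanSpace ℝ (Fin N) → ℂ) : Prop :=
  ∃ M : ℝ, ∀ s ∈ Set.Ioc (0 : ℝ) 1, ∀ y,
    ‖F s y‖ ≤ M * s ^ n * (Metric.closedBall 0 1).indicator 1 y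

namespace IsLocalizedBigO

variable {n : ℕ} {F G : ℝ → EuclideanSpace ℝ (Fin N) → ℂ}

lemma add (hF : IsLocalizedBigO n F) (hG : IsLocalizedBigO n G) :
    IsLocalizedBigO n (fun s y => F s y + G s y) := by
  obtain ⟨M, hM⟩ := hF
  obtain ⟨M', hM'⟩ := hG
  refine ⟨M + M', fun s hs y => (norm_add_le _ _).trans ?_⟩
  rw [add_mul, add_mul]
  exact add_le_add (hM s hs y) (hM' s hs y)

lemma sum {ι : Type*} (t : Finset ι) {F : ι → ℝ → EuclideanSpace ℝ (Fin N) → ℂ}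
    (hF : ∀ i, IsLocalizedBigO n (F i)) : IsLocalizedBigO n (fun s y => ∑ i ∈ t, F i s y) := by
  choose M hM using hF
  refine ⟨∑ i ∈ t, M i, fun s hs y => (norm_sum_le _ _).trans ?_⟩
  rw [Finset.sum_mul, Finset.sum_mul]
  exact Finset.sum_le_sum fun i _ => hM i s hs y

/-- Multiplication by a factor that is `O(s ^ m)` on the unit ball. -/
lemma bounded_mul (hF : IsLocalizedBigO n F) {m : ℕ} {K : ℝ}
    (hG : ∀ s ∈ Set.Ioc (0 : ℝ) 1, ∀ y ∈ Metric.closedBall 0 1, ‖G s y‖ ≤ K * s ^ m) :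
    IsLocalizedBigO (n + m) (fun s y => G s y * F s y) := by
  obtain ⟨M, hM⟩ := hF
  refine ⟨K * M, fun s hs y => ?_⟩
  have hFy := hM s hs y
  rw [norm_mul]
  by_cases hy : y ∈ Metric.closedBall 0 1
  · rw [Set.indicator_of_mem hy, Pi.one_apply, mul_one] at hFy ⊢
    have hGy := hG s hs y hy
    calc ‖G s y‖ * ‖F s y‖ ≤ (K * s ^ m) * (M * s ^ n) :=
          mul_le_mul hGy hFy (norm_nonneg _) ((norm_nonneg _).trans hGy)
      _ = K * M * s ^ (n + m) := by ring
  · rw [Set.indicator_of_notMem hy, mul_zero] at hFy ⊢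
    rw [le_antisymm hFy (norm_nonneg _), mul_zero]

lemma const_mul (hF : IsLocalizedBigO n F) (z : ℂ) :
    IsLocalizedBigO n (fun s y => z * F s y) :=
  hF.bounded_mul (m := 0) (G := fun _ _ => z) (K := ‖z‖) (by simp)

lemma scale_mul (hF : IsLocalizedBigO n F) :
    IsLocalizedBigO (n + 1) (fun s y => (s : ℂ) * F s y) :=
  hF.bounded_mul (G := fun s _ => (s : ℂ)) (K := 1) fun s hs y _ => by
    simp [abs_of_pos hs.1]

lemma mono (hF : IsLocalizedBigO n F) {m : ℕ} (hmn : m ≤ n) : IsLocalizedBigO m F := by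
  obtain ⟨M, hM⟩ := hF
  refine ⟨|M|, fun s hs y => (hM s hs y).trans ?_⟩
  have hpow : s ^ n ≤ s ^ m := pow_le_pow_of_le_one hs.1.le hs.2 hmn
  have hχ : (0 : ℝ) ≤ (Metric.closedBall 0 1).indicator 1 y :=
    Set.indicator_nonneg (fun _ _ => zero_le_one) y
  have := hs.1.le
  gcongr
  exact le_abs_self M

lemma of_tsupport_subset {g : EuclideanSpace ℝ (Fin N) → ℂ} (hg : Continuous g)
    (hsupp : tsupport g ⊆ Metric.closedBall 0 1) : IsLocalizedBigO 0 (fun _ => g) := by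
  obtain ⟨M, hM⟩ :=
    (isCompact_closedBall (0 : EuclideanSpace ℝ (Fin N)) 1).exists_bound_of_continuousOn
      hg.continuousOn
  refine ⟨M, fun s _ y => ?_⟩
  by_cases hy : y ∈ Metric.closedBall 0 1
  · simpa [Set.indicator_of_mem hy] using hM y hy
  · simp [Set.indicator_of_notMem hy, image_eq_zero_of_notMem_tsupport (fun h => hy (hsupp h))]

/-- Freezing a Lipschitz coefficient at the point `u` and at `h = 0` costs `O(s)`. -/
lemma coeff_mul_sub {α : ℝ → EuclideanSpace ℝ (Fin N) → ℂ} {u : EuclideanSpace ℝ (Fin N)}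
    {L : ℝ≥0} (hα : LipschitzOnWith L (fun p : EuclideanSpace ℝ (Fin N) × ℝ => α p.2 p.1)
      (Metric.closedBall u 1 ×ˢ Set.Icc 0 1))
    (hG : IsLocalizedBigO 0 G) (hFG : IsLocalizedBigO 1 (fun s y => F s y - G s y)) :
    IsLocalizedBigO 1
      (fun s y => α (s ^ 2) (u + s • y) * F s y - α 0 u * G s y) := by
  have hF : IsLocalizedBigO 0 F := by
    simpa using hG.add (hFG.mono zero_le_one)
  have hbound : ∀ s ∈ Set.Ioc (0 : ℝ) 1, ∀ y ∈ Metric.closedBall (0 : EuclideanSpace ℝ (Fin N)) 1,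
      ‖α (s ^ 2) (u + s • y) - α 0 u‖ ≤ (L : ℝ) * s ^ 1 := by
    intro s hs y hy
    have hy' : ‖y‖ ≤ 1 := by simpa using hy
    have hsy : s * ‖y‖ ≤ s := mul_le_of_le_one_right hs.1.le hy'
    have hs2 : s ^ 2 ≤ s := by nlinarith [hs.1, hs.2]
    have hdist := hα.dist_le_mul (u + s • y, s ^ 2)
      ⟨by simpa [norm_smul, abs_of_pos hs.1] using hsy.trans hs.2,
        by positivity, hs2.trans hs.2⟩ (u, 0) ⟨by simp, by simp⟩
    rw [dist_eq_norm] at hdist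
    refine hdist.trans (mul_le_mul_of_nonneg_left ?_ L.coe_nonneg)
    rw [Prod.dist_eq, pow_one]
    refine max_le ?_ ?_
    · simpa [norm_smul, abs_of_pos hs.1] using hsy
    · simpa using hs2
  have := (hF.bounded_mul (m := 1) (G := fun s y => α (s ^ 2) (u + s • y) - α 0 u) hbound).add
    (hFG.const_mul (α 0 u))
  convert this using 3
  ring

/-- The packets of an `O(s)` family of profiles are `O(s)` in `L²`. -/
lemma eventually_eLpNorm_packet_le (hF : IsLocalizedBigO 1 F)
    (u : EuclideanSpace ℝ (Fin N)) (ξ : Fin N → ℝ) :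
    ∀ᶠ C : ℝ in atTop, ∀ s ∈ Set.Ioc (0 : ℝ) 1,
      eLpNorm (packet u ξ s (F s)) 2 volume ≤ ENNReal.ofReal (C * s) := by
  obtain ⟨M, hM⟩ := hF
  set χ : EuclideanSpace ℝ (Fin N) → ℂ := (Metric.closedBall 0 1).indicator 1 with hχ
  have hmem : MemLp χ 2 volume :=
    memLp_indicator_const 2 measurableSet_closedBall 1
      (Or.inr (isCompact_closedBall _ _).measure_lt_top.ne)
  have hnorm : ∀ y, ‖χ y‖ = (Metric.closedBall (0 : EuclideanSpace ℝ (Fin N)) 1).indicator 1 y := by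
    intro y
    by_cases hy : y ∈ Metric.closedBall 0 1
    · simp [hχ, Set.indicator_of_mem hy]
    · simp [hχ, Set.indicator_of_notMem hy]
  filter_upwards [eventually_ge_atTop (M * (eLpNorm χ 2 volume).toReal)] with C hC s hs
  calc eLpNorm (packet u ξ s (F s)) 2 volume
      ≤ ENNReal.ofReal (M * s) * eLpNorm (packet u ξ s χ) 2 volume := by
        refine eLpNorm_le_mul_eLpNorm_of_ae_le_mul (ae_of_all _ fun x => ?_) 2
        rw [norm_packet, norm_packet, hnorm, mul_left_comm]
        have := hM s hs (s⁻¹ • (x - u))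
        rw [pow_one] at this
        gcongr
    _ = ENNReal.ofReal (M * (eLpNorm χ 2 volume).toReal * s) := by
        rw [eLpNorm_packet u ξ hs.1 hmem.1, mul_right_comm M,
          ENNReal.ofReal_mul' ENNReal.toReal_nonneg, ENNReal.ofReal_toReal hmem.2.ne]
    _ ≤ ENNReal.ofReal (C * s) :=
        ENNReal.ofReal_le_ofReal (mul_le_mul_of_nonneg_right hC hs.1.le)

end IsLocalizedBigO

/-- A smooth profile supported in the closed unit ball that does not vanish at the origin. -/
lemma exists_profile (N : ℕ) : ∃ φ : EuclideanSpace ℝ (Fin N) → ℂ,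
    ContDiff ℝ (⊤ : ℕ∞) φ ∧ tsupport φ ⊆ Metric.closedBall 0 1 ∧ φ 0 ≠ 0 := by
  let ψ : ContDiffBump (0 : EuclideanSpace ℝ (Fin N)) := ⟨1 / 2, 1, by norm_num, by norm_num⟩
  refine ⟨fun x => (ψ x : ℂ), Complex.ofRealCLM.contDiff.comp ψ.contDiff, ?_, ?_⟩
  · exact (tsupport_comp_subset (g := ((↑) : ℝ → ℂ)) Complex.ofReal_zero ψ).trans
      ψ.tsupport_eq.subset
  · simp [ψ.one_of_mem_closedBall (Metric.mem_closedBall_self ψ.rIn_pos.le)]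

end WavePacket

open WavePacket in
/-- Theorem 2 ("semiclassical spectrum") of the paper, for second order semiclassical
differential operators on ℝ^N with locally Lipschitz coefficients: at every phase-space
point `(u,ξ)` there are normalized localized approximate eigenfunctions with `O(h^{1/2})`
errors for position, momentum and the operator itself. -/
theorem interior_pseudoeigenfunctions_lipschitz (N : ℕ)
    (a : Fin N → Fin N → ℝ → EuclideanSpace ℝ (Fin N) → ℂ)
    (b : Fin N → ℝ → EuclideanSpace ℝ (Fin N) → ℂ)
    (c : ℝ → EuclideanSpace ℝ (Fin N) → ℂ)
    (ha : ∀ j k, ∀ K : Set (EuclideanSpace ℝ (Fin N)), IsCompact K →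
      ∃ L : ℝ≥0, LipschitzOnWith L
        (fun p : EuclideanSpace ℝ (Fin N) × ℝ => a j k p.2 p.1) (K ×ˢ Set.Icc 0 1))
    (hb : ∀ j, ∀ K : Set (EuclideanSpace ℝ (Fin N)), IsCompact K →
      ∃ L : ℝ≥0, LipschitzOnWith L
        (fun p : EuclideanSpace ℝ (Fin N) × ℝ => b j p.2 p.1) (K ×ˢ Set.Icc 0 1))
    (hc : ∀ K : Set (EuclideanSpace ℝ (Fin N)), IsCompact K →
      ∃ L : ℝ≥0, LipschitzOnWith L
        (fun p : EuclideanSpace ℝ (Fin N) × ℝ => c p.2 p.1) (K ×ˢ Set.Icc 0 1))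
    (u : EuclideanSpace ℝ (Fin N)) (ξ : Fin N → ℝ) :
    ∃ c₀ > (0:ℝ), ∃ C > (0:ℝ), ∃ f : ℝ → EuclideanSpace ℝ (Fin N) → ℂ,
      ∀ h ∈ Set.Ioc (0:ℝ) 1,
        ContDiff ℝ (⊤ : ℕ∞) (f h) ∧ HasCompactSupport (f h) ∧
        eLpNorm (f h) 2 volume = ENNReal.ofReal c₀ ∧
        (∀ j : Fin N, eLpNorm (fun x => (x j : ℂ) * f h x - (u j : ℂ) * f h x) 2 volume
          ≤ ENNReal.ofReal (C * h ^ ((1:ℝ)/2))) ∧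
        (∀ j : Fin N, eLpNorm (fun x =>
            -Complex.I * (h : ℂ) * fderiv ℝ (f h) x (EuclideanSpace.single j 1)
              - (ξ j : ℂ) * f h x) 2 volume
          ≤ ENNReal.ofReal (C * h ^ ((1:ℝ)/2))) ∧
        eLpNorm (fun x =>
            (-(h:ℂ)^2 * ∑ j, ∑ k, a j k h x *
                fderiv ℝ (fun y => fderiv ℝ (f h) y (EuclideanSpace.single k 1)) x
                  (EuclideanSpace.single j 1)
              - Complex.I * (h:ℂ) * ∑ j, b j h x *
                fderiv ℝ (f h) x (EuclideanSpace.single j 1)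
              + c h x * f h x)
            - ((∑ j, ∑ k, a j k 0 u * (ξ j : ℂ) * (ξ k : ℂ))
                + (∑ j, b j 0 u * (ξ j : ℂ)) + c 0 u) * f h x) 2 volume
          ≤ ENNReal.ofReal (C * h ^ ((1:ℝ)/2)) := by
  obtain ⟨φ, hφ, hsupp, hφ0⟩ := exists_profile N
  have hcpt : HasCompactSupport φ :=
    (isCompact_closedBall _ _).of_isClosed_subset (isClosed_tsupport φ) hsupp
  have hmem : MemLp φ 2 volume := hφ.continuous.memLp_of_hasCompactSupport hcpt
  have hpos : 0 < (eLpNorm φ 2 volume).toReal := by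
    refine ENNReal.toReal_pos (fun h0 => hφ0 ?_) hmem.2.ne
    rw [eLpNorm_eq_zero_iff hmem.1 (by simp)] at h0
    exact congrFun ((hφ.continuous.ae_eq_iff_eq volume continuous_const).1 h0) 0
  have hO : IsLocalizedBigO 0 (fun _ => φ) := .of_tsupport_subset hφ.continuous hsupp
  have hO₁ (j : Fin N) : IsLocalizedBigO 0 (fun _ => partialDeriv j φ) :=
    .of_tsupport_subset (contDiff_partialDeriv j hφ).continuous
      ((tsupport_partialDeriv_subset j φ).trans hsupp)
  have hO₂ (j k : Fin N) : IsLocalizedBigO 0 (fun _ => partialDeriv j (partialDeriv k φ)) :=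
    .of_tsupport_subset (contDiff_partialDeriv j (contDiff_partialDeriv k hφ)).continuous
      ((tsupport_partialDeriv_subset j _).trans ((tsupport_partialDeriv_subset k φ).trans hsupp))
  have hposition (j : Fin N) : IsLocalizedBigO 1 (fun s y => (s : ℂ) * ((y j : ℂ) * φ y)) := by
    refine (hO.bounded_mul (m := 0) (K := 1) (G := fun _ y => (y j : ℂ)) ?_).scale_mul
    intro s _ y hy
    have := (PiLp.norm_apply_le y j).trans (mem_closedBall_zero_iff.1 hy)
    simpa using this
  have hmomentum (j : Fin N) :
      IsLocalizedBigO 1 (fun s y => momentum ξ s j φ y - (ξ j : ℂ) * φ y) := by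
    convert ((hO₁ j).const_mul (-Complex.I)).scale_mul using 3
    rw [momentum]
    ring
  have hmomentum₂ (j k : Fin N) : IsLocalizedBigO 1
      (fun s y => momentum ξ s j (momentum ξ s k φ) y - (ξ j : ℂ) * ξ k * φ y) := by
    convert (((((hO₁ k).const_mul (ξ j)).add ((hO₁ j).const_mul (ξ k))).const_mul
      (-Complex.I)).add (((hO₂ j k).scale_mul.const_mul (-1)).mono zero_le_one)).scale_mul using 3
    rw [momentum_momentum ξ _ j k hφ]
    ring
  have hK := isCompact_closedBall u 1
  have hoperator : IsLocalizedBigO 1 (fun s y =>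
      (∑ j, ∑ k, (a j k (s ^ 2) (u + s • y) * momentum ξ s j (momentum ξ s k φ) y
          - a j k 0 u * (ξ j * ξ k * φ y)))
        + (∑ j, (b j (s ^ 2) (u + s • y) * momentum ξ s j φ y - b j 0 u * (ξ j * φ y)))
        + (c (s ^ 2) (u + s • y) * φ y - c 0 u * φ y)) := by
    refine ((IsLocalizedBigO.sum _ fun j => .sum _ fun k => ?_).add (.sum _ fun j => ?_)).add ?_
    · obtain ⟨L, hL⟩ := ha j k _ hK
      exact .coeff_mul_sub hL (hO.const_mul _) (hmomentum₂ j k)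
    · obtain ⟨L, hL⟩ := hb j _ hK
      exact .coeff_mul_sub hL (hO.const_mul _) (hmomentum j)
    · obtain ⟨L, hL⟩ := hc _ hK
      exact .coeff_mul_sub hL hO ⟨0, by simp⟩
  obtain ⟨C, hC, hCposition, hCmomentum, hCoperator⟩ := ((Filter.eventually_gt_atTop (0 : ℝ)).and
    ((Filter.eventually_all.2 fun j => (hposition j).eventually_eLpNorm_packet_le u ξ).and
      ((Filter.eventually_all.2 fun j => (hmomentum j).eventually_eLpNorm_packet_le u ξ).and
        (hoperator.eventually_eLpNorm_packet_le u ξ)))).exists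
  refine ⟨_, hpos, C, hC, fun h => packet u ξ (Real.sqrt h) φ, fun h hh => ?_⟩
  obtain ⟨s, hs, rfl⟩ : ∃ s ∈ Set.Ioc (0 : ℝ) 1, s ^ 2 = h :=
    ⟨Real.sqrt h, ⟨Real.sqrt_pos.2 hh.1, Real.sqrt_le_one.2 hh.2⟩, Real.sq_sqrt hh.1.le⟩
  have hs0 : (s : ℂ) ≠ 0 := by exact_mod_cast hs.1.ne'
  rw [← Real.sqrt_eq_rpow]
  simp only [Real.sqrt_sq hs.1.le]
  have hderiv (j : Fin N) (x : EuclideanSpace ℝ (Fin N)) :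
      fderiv ℝ (packet u ξ s φ) x (EuclideanSpace.single j 1)
        = Complex.I / (s : ℂ) ^ 2 * packet u ξ s (momentum ξ s j φ) x :=
    congrFun (partialDeriv_packet u ξ hs.1 hφ j) x
  have hderiv₂ (j k : Fin N) (x : EuclideanSpace ℝ (Fin N)) :
      fderiv ℝ (fun y => fderiv ℝ (packet u ξ s φ) y (EuclideanSpace.single k 1)) x
          (EuclideanSpace.single j 1)
        = -1 / (s : ℂ) ^ 4 * packet u ξ s (momentum ξ s j (momentum ξ s k φ)) x := by
    have hmk := contDiff_momentum ξ s k hφ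
    simp only [hderiv]
    rw [fderiv_const_mul ((contDiff_packet u ξ s hmk).differentiable (by simp) x)]
    have hj := congrFun (partialDeriv_packet u ξ hs.1 hmk j) x
    rw [partialDeriv] at hj
    rw [smul_apply, hj, smul_eq_mul]
    field_simp
    rw [Complex.I_sq, neg_one_mul]
  have hpoint (x : EuclideanSpace ℝ (Fin N)) : u + s • s⁻¹ • (x - u) = x := by
    rw [smul_inv_smul₀ hs.1.ne', add_sub_cancel]
  refine ⟨contDiff_packet u ξ s hφ, hasCompactSupport_packet u ξ hs.1 hcpt, ?_, fun j => ?_,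
    fun j => ?_, ?_⟩
  · rw [eLpNorm_packet u ξ hs.1 hmem.1, ENNReal.ofReal_toReal hmem.2.ne]
  · convert hCposition j s hs using 2
    funext x
    simp [packet]
    field_simp
  · convert hCmomentum j s hs using 2
    funext x
    rw [hderiv]
    simp only [packet]
    generalize (((Real.sqrt (s ^ N))⁻¹ : ℝ) : ℂ) * Complex.exp _ = p
    have hI : -Complex.I * ((s ^ 2 : ℝ) : ℂ) * (Complex.I / (s : ℂ) ^ 2) = 1 := by
      push_cast
      field_simp
      simp
    linear_combination p * momentum ξ s j φ (s⁻¹ • (x - u)) * hI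
  · convert hCoperator s hs using 2
    funext x
    simp only [hderiv₂]
    simp only [hderiv, packet, hpoint]
    generalize (((Real.sqrt (s ^ N))⁻¹ : ℝ) : ℂ) * Complex.exp _ = p
    simp only [Finset.sum_sub_distrib, mul_add, add_mul, mul_sub, Finset.mul_sum, Finset.sum_mul]
    have hsecond : ∀ j k, -((s ^ 2 : ℝ) : ℂ) ^ 2 * (a j k (s ^ 2) x *
        (-1 / (s : ℂ) ^ 4 * (p * momentum ξ s j (momentum ξ s k φ) (s⁻¹ • (x - u)))))
        = p * (a j k (s ^ 2) x * momentum ξ s j (momentum ξ s k φ) (s⁻¹ • (x - u))) := by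
      intro j k
      push_cast
      field_simp
    have hfirst : ∀ j, Complex.I * ((s ^ 2 : ℝ) : ℂ) * (b j (s ^ 2) x *
        (Complex.I / (s : ℂ) ^ 2 * (p * momentum ξ s j φ (s⁻¹ • (x - u)))))
        = -(p * (b j (s ^ 2) x * momentum ξ s j φ (s⁻¹ • (x - u)))) := by
      intro j
      push_cast
      field_simp
      simp
    have hcomm : ∀ z w : ℂ, z * (p * w) = p * (z * w) := fun z w => by ring
    simp only [hsecond, hfirst, Finset.sum_neg_distrib]
    simp only [hcomm, mul_assoc]
    ring
end

section
/- Let δ > 0, let F : [−δ, δ] → ℝ be a positive continuous function, let G : [−δ, δ] → ℂ be continuous, and let β be a non-negative integer. Then lim_{h→0+} h^{−(2β+1)/2} ∫_{−δ}^{δ} s^{2β} G(s) exp(−s² F(s)/h) ds = G(0) Γ((2β+1)/2) / F(0)^{(2β+1)/2}. -/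
open MeasureTheory
open scoped Topology

/-- Even moments of a centered Gaussian, in terms of the Gamma function. -/
theorem integral_pow_two_mul_mul_exp_neg_mul_sq (β : ℕ) {b : ℝ} (hb : 0 < b) :
    ∫ t : ℝ, t ^ (2 * β) * Real.exp (-b * t ^ 2) =
      Real.Gamma ((2 * (β : ℝ) + 1) / 2) / b ^ ((2 * (β : ℝ) + 1) / 2) := by
  have hβ : (-1 : ℝ) < 2 * (β : ℝ) := by
    have : (0 : ℝ) ≤ β := β.cast_nonneg
    linarith
  have habs := integral_comp_abs (f := fun t : ℝ => t ^ (2 * β) * Real.exp (-b * t ^ 2))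
  simp only [pow_mul, sq_abs] at habs
  simp only [pow_mul]
  rw [habs]
  have hIoi := integral_rpow_mul_exp_neg_mul_rpow (p := 2) two_pos hβ hb
  have hcongr : ∫ t in Set.Ioi (0 : ℝ), (t ^ 2) ^ β * Real.exp (-b * t ^ 2) =
      ∫ t in Set.Ioi (0 : ℝ), t ^ (2 * (β : ℝ)) * Real.exp (-b * t ^ (2 : ℝ)) := by
    refine setIntegral_congr_fun measurableSet_Ioi fun t _ => ?_
    have hpow : t ^ (2 * (β : ℝ)) = (t ^ 2) ^ β := by
      rw [← pow_mul, ← Real.rpow_natCast t (2 * β)]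
      push_cast
      rfl
    simp only [hpow, Real.rpow_two]
  rw [hcongr, hIoi, neg_div, Real.rpow_neg hb.le]
  ring

theorem integrable_pow_two_mul_mul_exp_neg_mul_sq (β : ℕ) {b : ℝ} (hb : 0 < b) :
    Integrable fun t : ℝ => t ^ (2 * β) * Real.exp (-b * t ^ 2) := by
  have hβ : (-1 : ℝ) < ((2 * β : ℕ) : ℝ) :=
    lt_of_lt_of_le (by norm_num) (Nat.cast_nonneg _)
  simpa only [Real.rpow_natCast] using integrable_rpow_mul_exp_neg_mul_sq hb hβ

/-- The substitution `s = √h t` in the Laplace integral. -/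
theorem rpow_smul_setIntegral_laplace_eq (S : Set ℝ) (hS : MeasurableSet S)
    (F : ℝ → ℝ) (G : ℝ → ℂ) (β : ℕ) {h : ℝ} (hh : 0 < h) :
    (h ^ (-((2 * (β : ℝ) + 1) / 2))) •
        ∫ s in S, (s ^ (2 * β) * Real.exp (-(s ^ 2 * F s) / h)) • G s =
      ∫ t : ℝ, S.indicator
        (fun s => ((s / √h) ^ (2 * β) * Real.exp (-(F s) * (s / √h) ^ 2)) • G s) (√h * t) := by
  have hr : 0 < √h := Real.sqrt_pos.2 hh
  have hpow : h ^ (-((2 * (β : ℝ) + 1) / 2)) = (√h)⁻¹ * (√h ^ (2 * β))⁻¹ := by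
    rw [Real.rpow_neg hh.le, ← mul_inv, ← pow_succ', ← Real.rpow_natCast,
      Real.sqrt_eq_rpow, ← Real.rpow_mul hh.le]
    congr 2
    push_cast
    ring
  rw [Measure.integral_comp_mul_left, integral_indicator hS, abs_of_pos (inv_pos.2 hr), hpow,
    mul_smul, ← integral_smul]
  congr 1
  refine setIntegral_congr_fun hS fun s _ => ?_
  simp only [smul_smul, div_pow, Real.sq_sqrt hh.le]
  rw [show -(s ^ 2 * F s) / h = -F s * (s ^ 2 / h) by ring]
  congr 1
  ring

/-- Lemma (Laplace's method, interior version): for positive continuous `F`, continuous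
`G` and a non-negative integer `β`,
`∫_{-δ}^{δ} s^{2β} G(s) exp(-s² F(s)/h) ds ∼ G(0) Γ((2β+1)/2) F(0)^{-(2β+1)/2} h^{(2β+1)/2}`
as `h → 0+`. -/
theorem laplace_method_interior (δ : ℝ) (hδ : 0 < δ)
    (F : ℝ → ℝ) (hFcont : ContinuousOn F (Set.Icc (-δ) δ))
    (hFpos : ∀ s ∈ Set.Icc (-δ) δ, 0 < F s)
    (G : ℝ → ℂ) (hGcont : ContinuousOn G (Set.Icc (-δ) δ))
    (β : ℕ) :
    Filter.Tendsto
      (fun h : ℝ => (h ^ (-((2 * (β:ℝ) + 1) / 2))) •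
        ∫ s in Set.Icc (-δ) δ,
          (s ^ (2 * β) * Real.exp (-(s ^ 2 * F s) / h)) • G s)
      (𝓝[>] 0)
      (𝓝 ((Real.Gamma ((2 * (β:ℝ) + 1) / 2) / F 0 ^ ((2 * (β:ℝ) + 1) / 2)) • G 0)) := by
  have h0 : (0 : ℝ) ∈ Set.Icc (-δ) δ := ⟨by linarith, hδ.le⟩
  have hnhds : Set.Icc (-δ) δ ∈ 𝓝 (0 : ℝ) := Icc_mem_nhds (by linarith) hδ
  obtain ⟨c, hc, hcmin⟩ := isCompact_Icc.exists_isMinOn ⟨0, h0⟩ hFcont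
  obtain ⟨M, hM⟩ := isCompact_Icc.exists_bound_of_continuousOn hGcont
  have hM0 : 0 ≤ M := (norm_nonneg _).trans (hM 0 h0)
  rw [← integral_pow_two_mul_mul_exp_neg_mul_sq β (hFpos 0 h0), ← integral_smul_const]
  refine Filter.Tendsto.congr' (f₁ := fun h : ℝ => ∫ t : ℝ, (Set.Icc (-δ) δ).indicator
    (fun s => ((s / √h) ^ (2 * β) * Real.exp (-(F s) * (s / √h) ^ 2)) • G s) (√h * t)) ?_ ?_
  · filter_upwards [self_mem_nhdsWithin] with h hh
    exact (rpow_smul_setIntegral_laplace_eq _ measurableSet_Icc F G β hh).symm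
  refine tendsto_integral_filter_of_dominated_convergence
    (fun t => (t ^ (2 * β) * Real.exp (-(F c) * t ^ 2)) * M) ?_ ?_
    ((integrable_pow_two_mul_mul_exp_neg_mul_sq β (hFpos c hc)).mul_const M) ?_
  · filter_upwards [self_mem_nhdsWithin] with h hh
    have hr : √h ≠ 0 := (Real.sqrt_pos.2 hh).ne'
    have hmeas : AEStronglyMeasurable ((Set.Icc (-δ) δ).indicator
        (fun s => ((s / √h) ^ (2 * β) * Real.exp (-(F s) * (s / √h) ^ 2)) • G s)) volume := by
      rw [aestronglyMeasurable_indicator_iff measurableSet_Icc]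
      exact ContinuousOn.aestronglyMeasurable (by fun_prop) measurableSet_Icc
    exact hmeas.comp_quasiMeasurePreserving (Measure.quasiMeasurePreserving_smul volume hr)
  · filter_upwards [self_mem_nhdsWithin] with h hh
    refine .of_forall fun t => ?_
    have hr : √h ≠ 0 := (Real.sqrt_pos.2 hh).ne'
    have heven : 0 ≤ t ^ (2 * β) := (even_two_mul β).pow_nonneg t
    by_cases ht : √h * t ∈ Set.Icc (-δ) δ
    · rw [Set.indicator_of_mem ht, mul_div_cancel_left₀ t hr, norm_smul,
        Real.norm_of_nonneg (by positivity)]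
      have hFt : F c ≤ F (√h * t) := hcmin ht
      have hGt := hM _ ht
      gcongr
    · rw [Set.indicator_of_notMem ht, norm_zero]
      positivity
  · refine .of_forall fun t => ?_
    have hlim : Filter.Tendsto (fun h : ℝ => √h * t) (𝓝[>] 0) (𝓝 0) := by
      have hcont : Continuous fun h : ℝ => √h * t := by fun_prop
      simpa using (hcont.tendsto 0).mono_left nhdsWithin_le_nhds
    have hF : Filter.Tendsto (fun h : ℝ => F (√h * t)) (𝓝[>] 0) (𝓝 (F 0)) :=
      (hFcont.continuousAt hnhds).tendsto.comp hlim
    have hG : Filter.Tendsto (fun h : ℝ => G (√h * t)) (𝓝[>] 0) (𝓝 (G 0)) :=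
      (hGcont.continuousAt hnhds).tendsto.comp hlim
    refine Filter.Tendsto.congr' ?_
      ((((hF.neg.mul_const (t ^ 2)).rexp).const_mul (t ^ (2 * β))).smul hG)
    filter_upwards [self_mem_nhdsWithin, hlim.eventually_mem hnhds] with h hh ht
    rw [Set.indicator_of_mem ht, mul_div_cancel_left₀ t (Real.sqrt_pos.2 hh).ne']
end

section
/- Let a, b, c : ℝ → ℂ be C^∞ with a(x) ≠ 0 for all x ∈ ℝ, let (L_h f)(x) = −h² a(x) f″(x) − i h b(x) f′(x) + c(x) f(x), and let σ(u,ξ) = a(u)ξ² + b(u)ξ + c(u). Suppose (u,ξ) ∈ ℝ² satisfies the Poisson-bracket condition {Re σ, Im σ}(u,ξ) > 0, where {f,g} = (∂f/∂u)(∂g/∂ξ) − (∂f/∂ξ)(∂g/∂u). Then for every positive integer n there exist constants c > 0 and C > 0 and, for each h ∈ (0,1], a function f_h ∈ C_c^∞(ℝ), such that lim_{h→0+} ‖f_h‖ = c, and for all h ∈ (0,1]: ‖x f_h − u f_h‖ ≤ C h^{1/2}, ‖−ih f_h′ − ξ f_h‖ ≤ C h^{1/2}, and ‖L_h f_h − σ(u,ξ)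 f_h‖ ≤ C h^{n+2}. -/
open MeasureTheory
open scoped Topology ENNReal

/-- A function that is smooth near `u` agrees near `u` with a globally smooth function. -/
theorem exists_contDiff_eventuallyEq {g : ℝ → ℂ} {u : ℝ}
    (hg : ∀ᶠ x in 𝓝 u, ContDiffAt ℝ (⊤ : ℕ∞) g x) :
    ∃ G : ℝ → ℂ, ContDiff ℝ (⊤ : ℕ∞) G ∧ G =ᶠ[𝓝 u] g := by
  obtain ⟨ε, hε, hball⟩ := Metric.eventually_nhds_iff_ball.mp hg
  let χ : ContDiffBump u := ⟨ε / 4, ε / 2, by positivity, by linarith⟩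
  refine ⟨fun x => (χ x : ℂ) * g x, contDiff_iff_contDiffAt.mpr fun x => ?_, ?_⟩
  · by_cases hx : x ∈ Metric.ball u ε
    · exact (Complex.ofRealCLM.contDiff.contDiffAt.comp x χ.contDiffAt).mul (hball x hx)
    · have hx' : x ∉ tsupport χ := by
        rw [χ.tsupport_eq]
        simp only [Metric.mem_ball, Metric.mem_closedBall, not_lt, not_le, χ] at hx ⊢
        linarith
      refine (contDiffAt_const (c := (0 : ℂ))).congr_of_eventuallyEq ?_
      filter_upwards [notMem_tsupport_iff_eventuallyEq.mp hx'] with y hy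
      simp [hy]
  · filter_upwards [χ.eventuallyEq_one] with x hx
    simp [hx]

/-- Families of functions that are polynomial in the parameter `h` with smooth coefficients. -/
inductive PolynomialFamily : (ℝ → ℝ → ℂ) → Prop
  | zero : PolynomialFamily (fun _ _ => 0)
  | step (g : ℝ → ℂ) (G : ℝ → ℝ → ℂ) (hg : ContDiff ℝ (⊤ : ℕ∞) g) (hG : PolynomialFamily G) :
      PolynomialFamily (fun h x => g x + h * G h x)

namespace PolynomialFamily

theorem const {g : ℝ → ℂ} (hg : ContDiff ℝ (⊤ : ℕ∞) g) : PolynomialFamily (fun _ x => g x) := by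
  simpa using step g _ hg zero

theorem param_mul {G : ℝ → ℝ → ℂ} (hG : PolynomialFamily G) :
    PolynomialFamily (fun h x => h * G h x) := by
  simpa using step (fun _ => 0) G contDiff_const hG

theorem param_pow_mul {G : ℝ → ℝ → ℂ} (hG : PolynomialFamily G) (N : ℕ) :
    PolynomialFamily (fun h x => (h : ℂ) ^ N * G h x) := by
  induction N with
  | zero => simpa using hG
  | succ N ih => simpa only [pow_succ', mul_assoc] using ih.param_mul

theorem add {G K : ℝ → ℝ → ℂ} (hG : PolynomialFamily G) (hK : PolynomialFamily K) :
    PolynomialFamily (fun h x => G h x + K h x) := by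
  induction hG generalizing K with
  | zero => simpa using hK
  | step g G hg hG ih =>
    cases hK with
    | zero => simpa using step g G hg hG
    | step k K hk hK =>
      convert step (fun x => g x + k x) _ (hg.add hk) (ih hK) using 3
      ring

theorem smooth_mul {g : ℝ → ℂ} {K : ℝ → ℝ → ℂ} (hg : ContDiff ℝ (⊤ : ℕ∞) g)
    (hK : PolynomialFamily K) : PolynomialFamily (fun h x => g x * K h x) := by
  induction hK with
  | zero => simpa using zero
  | step k K hk hK ih =>
    convert step (fun x => g x * k x) _ (hg.mul hk) ih using 3
    ring

theorem exists_eq_add {G : ℝ → ℝ → ℂ} (hG : PolynomialFamily G) :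
    ∃ (g : ℝ → ℂ) (K : ℝ → ℝ → ℂ), ContDiff ℝ (⊤ : ℕ∞) g ∧ PolynomialFamily K ∧
      ∀ h x, G h x = g x + h * K h x := by
  cases hG with
  | zero => exact ⟨fun _ => 0, fun _ _ => 0, contDiff_const, zero, by simp⟩
  | step g K hg hK => exact ⟨g, K, hg, hK, fun _ _ => rfl⟩

theorem contDiff {G : ℝ → ℝ → ℂ} (hG : PolynomialFamily G) (h : ℝ) :
    ContDiff ℝ (⊤ : ℕ∞) (G h) := by
  induction hG with
  | zero => exact contDiff_const
  | step g K hg hK ih => exact hg.add (contDiff_const.mul ih)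

theorem continuous {G : ℝ → ℝ → ℂ} (hG : PolynomialFamily G) :
    Continuous (Function.uncurry G) := by
  induction hG with
  | zero => exact continuous_const
  | step g K hg hK ih =>
    exact (hg.continuous.comp continuous_snd).add
      ((Complex.continuous_ofReal.comp continuous_fst).mul ih)

end PolynomialFamily

/-- The characteristic equation has a smooth solution near a point where `∂σ/∂ξ ≠ 0`. -/
theorem exists_smooth_root {a b c : ℝ → ℂ} (ha : ContDiff ℝ (⊤ : ℕ∞) a)
    (hb : ContDiff ℝ (⊤ : ℕ∞) b) (hc : ContDiff ℝ (⊤ : ℕ∞) c) (hell : ∀ x, a x ≠ 0)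
    {u : ℝ} {ξ : ℂ} (hq : 2 * a u * ξ + b u ≠ 0) :
    ∃ φ ρ : ℝ → ℂ, ContDiff ℝ (⊤ : ℕ∞) φ ∧ ContDiff ℝ (⊤ : ℕ∞) ρ ∧ φ u = ξ ∧
      (∀ᶠ x in 𝓝 u, a x * φ x ^ 2 + b x * φ x + c x = a u * ξ ^ 2 + b u * ξ + c u) ∧
      ∀ᶠ x in 𝓝 u, (2 * a x * φ x + b x) * ρ x = 1 := by
  set z := a u * ξ ^ 2 + b u * ξ + c u with hz
  set q := 2 * a u * ξ + b u with hqdef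
  let D : ℝ → ℂ := fun x => (b x ^ 2 - 4 * a x * (c x - z)) / q ^ 2
  have hD : ContDiff ℝ (⊤ : ℕ∞) D :=
    ((hb.pow 2).sub ((contDiff_const.mul ha).mul (hc.sub contDiff_const))).div_const _
  have hDu : D u = 1 := by
    simp only [D]
    rw [div_eq_one_iff_eq (pow_ne_zero 2 hq), hz, hqdef]
    ring
  have hslit : ∀ᶠ x in 𝓝 u, D x ∈ Complex.slitPlane :=
    hD.continuous.continuousAt.eventually_mem
      (Complex.isOpen_slitPlane.mem_nhds (by simp [hDu]))
  have hlog : ∀ k : ℂ, ∀ᶠ x in 𝓝 u,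
      ContDiffAt ℝ (⊤ : ℕ∞) (fun x => Complex.exp (k * Complex.log (D x))) x := fun k => by
    filter_upwards [hslit] with x hx
    exact (contDiffAt_const.mul
      (((Complex.contDiffAt_log hx).restrict_scalars ℝ).comp x hD.contDiffAt)).cexp
  obtain ⟨s, hs, hs'⟩ := exists_contDiff_eventuallyEq (hlog (1 / 2))
  obtain ⟨r, hr, hr'⟩ := exists_contDiff_eventuallyEq (hlog (-1 / 2))
  have hinv : ContDiff ℝ (⊤ : ℕ∞) (fun x => (2 * a x)⁻¹) :=
    (contDiff_const.mul ha).inv fun x => mul_ne_zero two_ne_zero (hell x)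
  refine ⟨fun x => (-b x + q * s x) * (2 * a x)⁻¹, fun x => r x / q,
    (hb.neg.add (contDiff_const.mul hs)).mul hinv, hr.div_const q, ?_, ?_, ?_⟩
  · have : s u = 1 := by rw [hs'.eq_of_nhds]; simp [hDu]
    have := hell u
    simp only [*]
    field_simp
    ring
  · filter_upwards [hslit, hs'] with x hx hsx
    have hsq : s x ^ 2 = D x := by
      rw [hsx, ← Complex.exp_nat_mul]
      convert Complex.exp_log (Complex.slitPlane_ne_zero hx) using 2
      push_cast
      ring
    have hsq' : q ^ 2 * s x ^ 2 = b x ^ 2 - 4 * a x * (c x - z) := by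
      rw [hsq]; simp only [D]; field_simp
    have := hell x
    field_simp
    linear_combination hsq'
  · filter_upwards [hs', hr'] with x hsx hrx
    have h1 : s x * r x = 1 := by
      rw [hsx, hrx, ← Complex.exp_add]
      convert Complex.exp_zero using 2
      ring
    have := hell x
    field_simp
    linear_combination q * h1

/-- The Riccati equation for the logarithmic derivative of a formal pseudo-eigenfunction can be
solved near `u` up to an error of arbitrarily high order in `h`. -/
theorem exists_riccati_solution {a b c φ ρ : ℝ → ℂ} (ha : ContDiff ℝ (⊤ : ℕ∞) a)
    (hφ : ContDiff ℝ (⊤ : ℕ∞) φ) (hρ : ContDiff ℝ (⊤ : ℕ∞) ρ) {u : ℝ} {z : ℂ}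
    (hroot : ∀ᶠ x in 𝓝 u, a x * φ x ^ 2 + b x * φ x + c x = z)
    (hinv : ∀ᶠ x in 𝓝 u, (2 * a x * φ x + b x) * ρ x = 1) (N : ℕ) :
    ∃ Ψ R : ℝ → ℝ → ℂ, PolynomialFamily Ψ ∧ PolynomialFamily R ∧
      ∀ᶠ x in 𝓝 u, ∀ h : ℝ, a x * (φ x + h * Ψ h x) ^ 2
        - Complex.I * h * a x * (deriv φ x + h * deriv (Ψ h) x)
        + b x * (φ x + h * Ψ h x) + c x - z = (h : ℂ) ^ (N + 1) * R h x := by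
  have hderiv : ∀ {g : ℝ → ℂ}, ContDiff ℝ (⊤ : ℕ∞) g → ContDiff ℝ (⊤ : ℕ∞) (deriv g) :=
    fun hg => (contDiff_infty_iff_deriv.mp hg).2
  induction N with
  | zero =>
    refine ⟨fun _ _ => 0, fun _ x => -Complex.I * a x * deriv φ x, .zero,
      .const ((contDiff_const.mul ha).mul (hderiv hφ)), ?_⟩
    filter_upwards [hroot] with x hx h
    simp only [deriv_const]
    linear_combination hx
  | succ N ih =>
    obtain ⟨Ψ, R, hΨ, hR, hN⟩ := ih
    obtain ⟨r, R', hr, hR', hRr⟩ := hR.exists_eq_add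
    let g : ℝ → ℂ := fun x => -(r x * ρ x)
    have hg : ContDiff ℝ (⊤ : ℕ∞) g := (hr.mul hρ).neg
    refine ⟨fun h x => Ψ h x + (h : ℂ) ^ N * g x,
      fun h x => (R' h x + (2 * a x * g x) * Ψ h x) + ((h : ℂ) ^ N * (a x * g x ^ 2)
        + -Complex.I * a x * deriv g x),
      hΨ.add ((PolynomialFamily.const hg).param_pow_mul N),
      (hR'.add (.smooth_mul ((contDiff_const.mul ha).mul hg) hΨ)).add
        (((PolynomialFamily.const (ha.mul (hg.pow 2))).param_pow_mul N).add
          (.const ((contDiff_const.mul ha).mul (hderiv hg)))), ?_⟩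
    filter_upwards [hN, hinv] with x hx hρx h
    have hd : deriv (fun x => Ψ h x + (h : ℂ) ^ N * g x) x
        = deriv (Ψ h) x + (h : ℂ) ^ N * deriv g x := by
      have h1 : DifferentiableAt ℝ (Ψ h) x := (hΨ.contDiff h).differentiable (by simp) x
      have h2 : DifferentiableAt ℝ g x := hg.differentiable (by simp) x
      exact (h1.hasDerivAt.add (h2.hasDerivAt.const_mul _)).deriv
    have hgx : (2 * a x * φ x + b x) * g x = -r x := by
      simp only [g]; linear_combination -r x * hρx
    rw [hd]
    have := hx h
    rw [hRr] at this
    linear_combination this + (h : ℂ) ^ (N + 1) * hgx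

theorem tendsto_div_sq_of_hasDerivAt {m m' : ℝ → ℝ} {u β : ℝ} (hm : ∀ x, HasDerivAt m (m' x) x)
    (hu : m u = 0) (hu' : m' u = 0) (hβ : HasDerivAt m' β u) :
    Filter.Tendsto (fun x => m x / (x - u) ^ 2) (𝓝[≠] u) (𝓝 (β / 2)) := by
  have hsq : ∀ x : ℝ, HasDerivAt (fun x => (x - u) ^ 2) (2 * (x - u)) x := fun x => by
    simpa using ((hasDerivAt_id x).sub_const u).fun_pow 2
  refine HasDerivAt.lhopital_zero_nhdsNE (Filter.Eventually.of_forall hm)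
    (Filter.Eventually.of_forall hsq) ?_ ?_ ?_ ?_
  · filter_upwards [self_mem_nhdsWithin] with x hx
    exact mul_ne_zero two_ne_zero (sub_ne_zero.mpr hx)
  · simpa [hu] using ((hm u).continuousAt.tendsto).mono_left nhdsWithin_le_nhds
  · simpa using ((hsq u).continuousAt.tendsto).mono_left nhdsWithin_le_nhds
  · refine ((hasDerivAt_iff_tendsto_slope.mp hβ).div_const 2).congr fun x => ?_
    rw [slope_def_field, hu', sub_zero, div_div, mul_comm]

theorem eLpNorm_two_eq_ofReal_sqrt {E : Type*} [NormedAddCommGroup E] {F : ℝ → E}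
    (hF : MemLp F 2 volume) :
    eLpNorm F 2 volume = ENNReal.ofReal (√(∫ x, ‖F x‖ ^ 2)) := by
  rw [hF.eLpNorm_eq_integral_rpow_norm (by simp) (by simp), Real.sqrt_eq_rpow]
  simp

theorem sq_rescaled_gaussian {B κ h x u : ℝ} (hh : 0 < h) :
    (B * h ^ (-(1 / 4) : ℝ) * Real.exp (-κ * (x - u) ^ 2 / h)) ^ 2
      = B ^ 2 * (√h)⁻¹ * Real.exp (-(2 * κ / h) * (x - u) ^ 2) := by
  rw [mul_pow, mul_pow, ← Real.exp_nat_mul, ← Real.rpow_natCast (h ^ _), ← Real.rpow_mul hh.le,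
    Real.sqrt_eq_rpow, ← Real.rpow_neg hh.le]
  congr 2
  · norm_num
  · push_cast; ring

theorem memLp_rescaled_gaussian {κ h : ℝ} (hκ : 0 < κ) (hh : 0 < h) (B u : ℝ) :
    MemLp (fun x : ℝ => B * h ^ (-(1 / 4) : ℝ) * Real.exp (-κ * (x - u) ^ 2 / h)) 2 volume := by
  refine (memLp_two_iff_integrable_sq (by fun_prop)).mpr ?_
  simp only [sq_rescaled_gaussian hh]
  exact ((integrable_exp_neg_mul_sq (by positivity)).comp_sub_right u).const_mul _

theorem eLpNorm_rescaled_gaussian {κ h B : ℝ} (hκ : 0 < κ) (hh : 0 < h) (hB : 0 ≤ B) (u : ℝ) :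
    eLpNorm (fun x : ℝ => B * h ^ (-(1 / 4) : ℝ) * Real.exp (-κ * (x - u) ^ 2 / h)) 2 volume
      = ENNReal.ofReal (B * √√(Real.pi / (2 * κ))) := by
  rw [eLpNorm_two_eq_ofReal_sqrt (memLp_rescaled_gaussian hκ hh B u)]
  simp only [Real.norm_eq_abs, sq_abs, sq_rescaled_gaussian hh]
  rw [integral_const_mul, integral_sub_right_eq_self
    (fun x => Real.exp (-(2 * κ / h) * x ^ 2)) u, integral_gaussian]
  have : Real.pi / (2 * κ / h) = h * (Real.pi / (2 * κ)) := by field_simp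
  rw [this, Real.sqrt_mul hh.le, mul_assoc, inv_mul_cancel_left₀ (by positivity),
    Real.sqrt_mul (by positivity), Real.sqrt_sq hB]

theorem eLpNorm_le_of_norm_le_rescaled_gaussian {F : ℝ → ℂ} {κ h B u : ℝ} (hκ : 0 < κ)
    (hh : 0 < h) (hB : 0 ≤ B)
    (hF : ∀ x, ‖F x‖ ≤ B * h ^ (-(1 / 4) : ℝ) * Real.exp (-κ * (x - u) ^ 2 / h)) :
    eLpNorm F 2 volume ≤ ENNReal.ofReal (B * √√(Real.pi / (2 * κ))) :=
  (eLpNorm_mono_real hF).trans_eq (eLpNorm_rescaled_gaussian hκ hh hB u)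

/-- The `L²` norms of a family concentrating in a Gaussian profile at `u` on the scale `√h`
converge to the norm of the profile. -/
theorem tendsto_eLpNorm_of_rescaled {F : ℝ → ℝ → ℂ} {κ β B u : ℝ} (hκ : 0 < κ)
    (hcont : ∀ h ∈ Set.Ioc (0 : ℝ) 1, Continuous (F h))
    (hF : ∀ h ∈ Set.Ioc (0 : ℝ) 1, ∀ x,
      ‖F h x‖ ≤ B * h ^ (-(1 / 4) : ℝ) * Real.exp (-κ * (x - u) ^ 2 / h))
    (hlim : ∀ y : ℝ, Filter.Tendsto (fun h : ℝ => h ^ (1 / 4 : ℝ) * ‖F h (u + √h * y)‖)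
      (𝓝[>] 0) (𝓝 (Real.exp (-(β / 2) * y ^ 2)))) :
    Filter.Tendsto (fun h => (eLpNorm (F h) 2 volume).toReal) (𝓝[>] 0)
      (𝓝 √√(Real.pi / β)) := by
  have hIoc : ∀ᶠ h in 𝓝[>] (0 : ℝ), h ∈ Set.Ioc (0 : ℝ) 1 := Ioc_mem_nhdsGT one_pos
  have key : ∀ h ∈ Set.Ioc (0 : ℝ) 1, (eLpNorm (F h) 2 volume).toReal
      = √(∫ y : ℝ, (h ^ (1 / 4 : ℝ) * ‖F h (u + √h * y)‖) ^ 2) := fun h hh => by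
    have hs : 0 < √h := Real.sqrt_pos.mpr hh.1
    rw [eLpNorm_two_eq_ofReal_sqrt ((memLp_rescaled_gaussian hκ hh.1 B u).mono'
      (hcont h hh).aestronglyMeasurable (Filter.Eventually.of_forall (hF h hh))),
      ENNReal.toReal_ofReal (Real.sqrt_nonneg _)]
    have hpow : (h ^ (1 / 4 : ℝ)) ^ 2 = √h := by
      rw [← Real.rpow_natCast, ← Real.rpow_mul hh.1.le, Real.sqrt_eq_rpow]; norm_num
    simp only [mul_pow, hpow]
    rw [integral_const_mul, Measure.integral_comp_mul_left (fun y => ‖F h (u + y)‖ ^ 2),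
      integral_add_left_eq_self (fun y => ‖F h y‖ ^ 2), abs_of_pos (inv_pos.mpr hs), smul_eq_mul,
      mul_inv_cancel_left₀ hs.ne']
  have hint : ∫ y : ℝ, Real.exp (-(β / 2) * y ^ 2) ^ 2 = √(Real.pi / β) := by
    rw [← integral_gaussian]
    congr 1 with y
    rw [← Real.exp_nat_mul]
    congr 1
    push_cast; ring
  rw [← hint]
  refine Filter.Tendsto.congr' (hIoc.mono fun h hh => (key h hh).symm) ?_
  refine (Real.continuous_sqrt.tendsto _).comp ?_
  refine tendsto_integral_filter_of_dominated_convergence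
    (fun y => B ^ 2 * Real.exp (-(2 * κ) * y ^ 2)) ?_ ?_
    ((integrable_exp_neg_mul_sq (by positivity)).const_mul _)
    (Filter.Eventually.of_forall fun y => (hlim y).pow 2)
  · filter_upwards [hIoc] with h hh
    have := hcont h hh
    exact Continuous.aestronglyMeasurable (by fun_prop)
  · filter_upwards [hIoc] with h hh
    refine Filter.Eventually.of_forall fun y => ?_
    have hb : h ^ (1 / 4 : ℝ) * ‖F h (u + √h * y)‖ ≤ B * Real.exp (-κ * y ^ 2) := by
      have h4 : 0 < h ^ (1 / 4 : ℝ) := Real.rpow_pos_of_pos hh.1 _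
      refine (mul_le_mul_of_nonneg_left (hF h hh _) h4.le).trans_eq ?_
      have : -κ * (u + √h * y - u) ^ 2 / h = -κ * y ^ 2 := by
        rw [add_sub_cancel_left, mul_pow, Real.sq_sqrt hh.1.le]
        have := hh.1.ne'
        field_simp
      rw [this, Real.rpow_neg hh.1.le]
      field_simp
    rw [Real.norm_of_nonneg (by positivity)]
    refine (pow_le_pow_left₀ (mul_nonneg (Real.rpow_nonneg hh.1.le _) (norm_nonneg _)) hb
      2).trans_eq ?_
    rw [mul_pow, ← Real.exp_nat_mul]
    congr 2
    push_cast; ring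

theorem pow_mul_exp_neg_sq_le {κ y : ℝ} (hκ : 0 < κ) (hy : 0 ≤ y) (M : ℕ) :
    y ^ M * Real.exp (-κ * y ^ 2) ≤
      (M.factorial * Real.exp (1 / (2 * κ))) * Real.exp (-(κ / 2) * y ^ 2) := by
  have h1 : y ^ M ≤ M.factorial * Real.exp y := by
    have := Real.pow_div_factorial_le_exp y hy M
    rwa [div_le_iff₀' (by positivity)] at this
  have h2 : y + -κ * y ^ 2 ≤ 1 / (2 * κ) + -(κ / 2) * y ^ 2 := by
    have : 1 / (2 * κ) + -(κ / 2) * y ^ 2 - (y + -κ * y ^ 2) = (κ * y - 1) ^ 2 / (2 * κ) := by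
      field_simp; ring
    have : 0 ≤ (κ * y - 1) ^ 2 / (2 * κ) := by positivity
    linarith
  calc y ^ M * Real.exp (-κ * y ^ 2) ≤ (M.factorial * Real.exp y) * Real.exp (-κ * y ^ 2) := by
        gcongr
    _ = M.factorial * Real.exp (y + -κ * y ^ 2) := by rw [Real.exp_add]; ring
    _ ≤ M.factorial * Real.exp (1 / (2 * κ) + -(κ / 2) * y ^ 2) := by gcongr
    _ = _ := by rw [Real.exp_add]; ring

/-- A factor `|x - u| ^ M` in front of a Gaussian of width `√h` gains `h ^ (M / 2)` in norm. -/
theorem exists_eLpNorm_le_of_norm_le_weighted_gaussian {κ : ℝ} (hκ : 0 < κ) (u : ℝ) (M : ℕ)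
    {α γ : ℝ} (hα : 0 ≤ α) (hγ : 0 ≤ γ) :
    ∃ C > 0, ∀ h : ℝ, 0 < h → ∀ F : ℝ → ℂ,
      (∀ x, ‖F x‖ ≤ (α * |x - u| ^ M + γ * √h ^ M) *
        (h ^ (-(1 / 4) : ℝ) * Real.exp (-κ * (x - u) ^ 2 / h))) →
      eLpNorm F 2 volume ≤ ENNReal.ofReal (C * √h ^ M) := by
  set A : ℝ := M.factorial * Real.exp (1 / (2 * κ)) with hA
  have hA0 : 0 < A := by positivity
  refine ⟨(α * A + γ) * √√(Real.pi / (2 * (κ / 2))) + 1, by positivity, fun h hh F hF => ?_⟩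
  have hs : 0 < √h := Real.sqrt_pos.mpr hh
  have hg : 0 < h ^ (-(1 / 4) : ℝ) := Real.rpow_pos_of_pos hh _
  refine (eLpNorm_le_of_norm_le_rescaled_gaussian (κ := κ / 2) (B := (α * A + γ) * √h ^ M)
    (u := u) (by positivity) hh (by positivity) fun x => (hF x).trans ?_).trans
    (ENNReal.ofReal_le_ofReal ?_)
  · set y := |x - u| / √h with hy
    have hy0 : 0 ≤ y := by positivity
    have hxy : |x - u| = √h * y := by rw [hy]; field_simp
    have hysq : (x - u) ^ 2 / h = y ^ 2 := by
      rw [hy, div_pow, sq_abs, Real.sq_sqrt hh.le]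
    rw [mul_div_assoc, mul_div_assoc, hysq, hxy, mul_pow]
    have h1 := pow_mul_exp_neg_sq_le hκ hy0 M
    rw [← hA] at h1
    have h2 : Real.exp (-κ * y ^ 2) ≤ Real.exp (-(κ / 2) * y ^ 2) := by
      apply Real.exp_le_exp.mpr; nlinarith [sq_nonneg y]
    calc _ = √h ^ M * h ^ (-(1 / 4) : ℝ) * (α * (y ^ M * Real.exp (-κ * y ^ 2))
            + γ * Real.exp (-κ * y ^ 2)) := by ring
      _ ≤ √h ^ M * h ^ (-(1 / 4) : ℝ) * (α * (A * Real.exp (-(κ / 2) * y ^ 2))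
            + γ * Real.exp (-(κ / 2) * y ^ 2)) := by gcongr
      _ = _ := by ring
  · have : 0 < √h ^ M := by positivity
    linarith

theorem deriv_const_mul_mul_cexp {X X' θ θ' : ℝ → ℂ} (hX : ∀ x, HasDerivAt X (X' x) x)
    (hθ : ∀ x, HasDerivAt θ (θ' x) x) (g : ℂ) :
    deriv (fun x => g * (X x * Complex.exp (θ x)))
      = fun x => g * ((X' x + X x * θ' x) * Complex.exp (θ x)) := by
  funext x
  refine (((hX x).mul (hθ x).cexp).const_mul g).deriv.trans ?_
  ring

theorem exists_norm_le_of_continuous_uncurry {W : ℝ → ℝ → ℂ}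
    (hW : Continuous (Function.uncurry W)) (u δ : ℝ) :
    ∃ B > 0, ∀ h ∈ Set.Ioc (0 : ℝ) 1, ∀ x ∈ Metric.closedBall u δ, ‖W h x‖ ≤ B := by
  obtain ⟨B, hB⟩ := (isCompact_Icc.prod (isCompact_closedBall u δ)).exists_bound_of_continuousOn
    (f := Function.uncurry W) (s := Set.Icc (0 : ℝ) 1 ×ˢ Metric.closedBall u δ) hW.continuousOn
  exact ⟨max B 1, by positivity, fun h hh x hx =>
    (hB (h, x) ⟨⟨hh.1.le, hh.2⟩, hx⟩).trans (le_max_left _ _)⟩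

theorem exists_norm_sub_le_mul_abs {φ : ℝ → ℂ} (hφ : ContDiff ℝ (⊤ : ℕ∞) φ) (u δ : ℝ) :
    ∃ B > 0, ∀ x ∈ Metric.closedBall u δ, ‖φ x - φ u‖ ≤ B * |x - u| := by
  have hd : Continuous (dslope φ u) := continuous_iff_continuousAt.mpr fun x => by
    rcases eq_or_ne x u with rfl | hx
    · exact continuousAt_dslope_same.mpr (hφ.differentiable (by simp) x)
    · exact (continuousAt_dslope_of_ne hx).mpr hφ.continuous.continuousAt
  obtain ⟨B, hB0, hB⟩ := exists_norm_le_of_continuous_uncurry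
    (W := fun _ x => dslope φ u x) (hd.comp continuous_snd) u δ
  refine ⟨B, hB0, fun x hx => ?_⟩
  rw [← sub_smul_dslope, norm_smul, mul_comm, Real.norm_eq_abs]
  exact mul_le_mul_of_nonneg_right (hB 1 ⟨one_pos, le_rfl⟩ x hx) (abs_nonneg _)

/-- The positive Poisson bracket makes the imaginary part of the phase strictly convex at `u`. -/
theorem im_deriv_root_pos {a b c φ : ℝ → ℂ} (ha : ContDiff ℝ (⊤ : ℕ∞) a)
    (hb : ContDiff ℝ (⊤ : ℕ∞) b) (hc : ContDiff ℝ (⊤ : ℕ∞) c) (hφ : ContDiff ℝ (⊤ : ℕ∞) φ)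
    {u : ℝ} {z : ℂ} (hroot : ∀ᶠ x in 𝓝 u, a x * φ x ^ 2 + b x * φ x + c x = z)
    (hbracket :
      0 < (deriv a u * φ u ^ 2 + deriv b u * φ u + deriv c u).re * (2 * a u * φ u + b u).im
          - (2 * a u * φ u + b u).re * (deriv a u * φ u ^ 2 + deriv b u * φ u + deriv c u).im) :
    0 < (deriv φ u).im := by
  have hd : ∀ {g : ℝ → ℂ}, ContDiff ℝ (⊤ : ℕ∞) g → HasDerivAt g (deriv g u) u :=
    fun hg => (hg.differentiable (by simp) u).hasDerivAt
  have h1 := (((hd ha).mul ((hd hφ).fun_pow 2)).add ((hd hb).mul (hd hφ))).add (hd hc)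
  have h2 := h1.unique ((hasDerivAt_const u z).congr_of_eventuallyEq hroot)
  set μ := deriv φ u
  set q := 2 * a u * φ u + b u with hq
  have hp : deriv a u * φ u ^ 2 + deriv b u * φ u + deriv c u = -(q * μ) := by
    rw [hq]; push_cast at h2; linear_combination h2
  rw [hp] at hbracket
  simp only [Complex.neg_re, Complex.neg_im, Complex.mul_re, Complex.mul_im] at hbracket
  have : 0 < (q.re ^ 2 + q.im ^ 2) * μ.im := by linarith
  exact pos_of_mul_pos_right this (by positivity)

theorem contDiff_primitive {φ : ℝ → ℂ} (hφ : ContDiff ℝ (⊤ : ℕ∞) φ) (u : ℝ) :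
    ContDiff ℝ (⊤ : ℕ∞) (fun x => ∫ t in u..x, φ t) := by
  have hd : ∀ x, HasDerivAt (fun x => ∫ t in u..x, φ t) (φ x) x := fun x =>
    hφ.continuous.integral_hasStrictDerivAt u x |>.hasDerivAt
  refine contDiff_infty_iff_deriv.mpr ⟨fun x => (hd x).differentiableAt, ?_⟩
  rwa [funext fun x => (hd x).deriv]

/-- Theorem 7 (interior pseudo-eigenfunctions with smooth coefficients): if
`{Re σ, Im σ}(u,ξ) > 0` then for every `n` there are compactly supported smooth
functions `f_h` with `‖f_h‖ → c > 0`, position and momentum localized at `(u,ξ)` to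
order `h^{1/2}`, and `‖L_h f_h - σ(u,ξ) f_h‖ = O(h^{n+2})`. -/
theorem interior_pseudoeigenfunctions_smooth
    (a b c : ℝ → ℂ) (ha : ContDiff ℝ (⊤ : ℕ∞) a) (hb : ContDiff ℝ (⊤ : ℕ∞) b) (hc : ContDiff ℝ (⊤ : ℕ∞) c)
    (hell : ∀ x : ℝ, a x ≠ 0)
    (u ξ : ℝ)
    (hbracket :
      0 < (deriv a u * (ξ:ℂ)^2 + deriv b u * (ξ:ℂ) + deriv c u).re
            * (2 * a u * (ξ:ℂ) + b u).im
          - (2 * a u * (ξ:ℂ) + b u).re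
            * (deriv a u * (ξ:ℂ)^2 + deriv b u * (ξ:ℂ) + deriv c u).im) :
    ∀ n : ℕ, 0 < n →
    ∃ c₀ > (0:ℝ), ∃ C > (0:ℝ), ∃ f : ℝ → ℝ → ℂ,
      Filter.Tendsto (fun h => (eLpNorm (f h) 2 volume).toReal) (𝓝[>] 0) (𝓝 c₀) ∧
      ∀ h ∈ Set.Ioc (0:ℝ) 1,
        ContDiff ℝ (⊤ : ℕ∞) (f h) ∧ HasCompactSupport (f h) ∧
        eLpNorm (fun x : ℝ => (x:ℂ) * f h x - (u:ℂ) * f h x) 2 volume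
          ≤ ENNReal.ofReal (C * h ^ ((1:ℝ)/2)) ∧
        eLpNorm (fun x : ℝ => -Complex.I * (h:ℂ) * deriv (f h) x - (ξ:ℂ) * f h x) 2 volume
          ≤ ENNReal.ofReal (C * h ^ ((1:ℝ)/2)) ∧
        eLpNorm (fun x : ℝ =>
            (-(h:ℂ)^2 * a x * deriv (deriv (f h)) x
              - Complex.I * (h:ℂ) * b x * deriv (f h) x + c x * f h x)
            - (a u * (ξ:ℂ)^2 + b u * (ξ:ℂ) + c u) * f h x) 2 volume
          ≤ ENNReal.ofReal (C * h ^ (n + 2 : ℕ)) := by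
  intro n _
  have hderiv : ∀ {g : ℝ → ℂ}, ContDiff ℝ (⊤ : ℕ∞) g → ContDiff ℝ (⊤ : ℕ∞) (deriv g) :=
    fun hg => (contDiff_infty_iff_deriv.mp hg).2
  have hhas : ∀ {g : ℝ → ℂ}, ContDiff ℝ (⊤ : ℕ∞) g → ∀ x, HasDerivAt g (deriv g x) x :=
    fun hg x => (hg.differentiable (by simp) x).hasDerivAt
  have hq : 2 * a u * (ξ : ℂ) + b u ≠ 0 := fun h0 => by simp [h0] at hbracket
  obtain ⟨φ, ρ, hφ, hρ, hφu, hroot, hinv⟩ := exists_smooth_root ha hb hc hell hq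
  set z := a u * (ξ : ℂ) ^ 2 + b u * (ξ : ℂ) + c u
  obtain ⟨Ψ, R, hΨ, hR, hric⟩ := exists_riccati_solution ha hφ hρ hroot hinv (n + 1)
  have hβ : 0 < (deriv φ u).im := im_deriv_root_pos ha hb hc hφ hroot (by rwa [hφu])
  set β := (deriv φ u).im with hβdef
  -- The phase `S` and its correction `T`.
  let S : ℝ → ℂ := fun x => ∫ t in u..x, φ t
  let T : ℝ → ℝ → ℂ := fun h x => ∫ t in u..x, Ψ h t
  have hS : ∀ x, HasDerivAt S (φ x) x := fun x =>
    (hφ.continuous.integral_hasStrictDerivAt u x).hasDerivAt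
  have hT : ∀ h x, HasDerivAt (T h) (Ψ h x) x := fun h x =>
    ((hΨ.contDiff h).continuous.integral_hasStrictDerivAt u x).hasDerivAt
  have hTcont : Continuous (Function.uncurry T) :=
    intervalIntegral.continuous_parametric_primitive_of_continuous hΨ.continuous
  have hSlim : Filter.Tendsto (fun x => (S x).im / (x - u) ^ 2) (𝓝[≠] u) (𝓝 (β / 2)) := by
    refine tendsto_div_sq_of_hasDerivAt (m' := fun x => (φ x).im)
      (fun x => Complex.imCLM.hasFDerivAt.comp_hasDerivAt x (hS x)) (by simp [S])
      (by simp [hφu]) (Complex.imCLM.hasFDerivAt.comp_hasDerivAt u (hhas hφ u))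
  set κ := β / 4 with hκdef
  have hκ : 0 < κ := by positivity
  have hSlow : ∀ᶠ x in 𝓝 u, κ * (x - u) ^ 2 ≤ (S x).im := by
    have h1 := hSlim.eventually (lt_mem_nhds (show κ < β / 2 by rw [hκdef]; linarith))
    rw [eventually_nhdsWithin_iff] at h1
    filter_upwards [h1] with x hx
    rcases eq_or_ne x u with rfl | hne
    · simp [S]
    · have : 0 < (x - u) ^ 2 := by have := sub_ne_zero.mpr hne; positivity
      exact ((lt_div_iff₀ this).mp (hx hne)).le
  obtain ⟨ε, hε, hball⟩ := Metric.eventually_nhds_iff_ball.mp (hSlow.and hric)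
  set δ := ε / 2 with hδdef
  have hδ : 0 < δ := by positivity
  replace hball := fun x (hx : x ∈ Metric.closedBall u δ) =>
    hball x (Metric.closedBall_subset_ball (by rw [hδdef]; linarith) hx)
  -- The cutoff.
  let χ : ContDiffBump u := ⟨δ / 2, δ, by positivity, by linarith⟩
  let X : ℝ → ℂ := fun x => (χ x : ℂ)
  have hX : ContDiff ℝ (⊤ : ℕ∞) X := Complex.ofRealCLM.contDiff.comp χ.contDiff
  have hXle : ∀ x, ‖X x‖ ≤ 1 := fun x => by
    simpa [X, abs_of_nonneg χ.nonneg] using χ.le_one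
  have hXout : ∀ x ∉ Metric.closedBall u δ, X =ᶠ[𝓝 x] fun _ => 0 := fun x hx => by
    have hx' : x ∉ tsupport χ := by rwa [χ.tsupport_eq]
    filter_upwards [notMem_tsupport_iff_eventuallyEq.mp hx'] with y hy
    simp [X, hy]
  have hXin : ∀ x ∈ Metric.ball u (δ / 2), X =ᶠ[𝓝 x] fun _ => 1 := fun x hx => by
    filter_upwards [χ.eventuallyEq_one_of_mem_ball hx] with y hy
    simp [X, hy]
  -- The approximate eigenfunctions.
  let θ : ℝ → ℝ → ℂ := fun h x => Complex.I * (S x / h + T h x)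
  let θ' : ℝ → ℝ → ℂ := fun h x => Complex.I * (φ x / h + Ψ h x)
  let θ'' : ℝ → ℝ → ℂ := fun h x => Complex.I * (deriv φ x / h + deriv (Ψ h) x)
  have hθ : ∀ h x, HasDerivAt (θ h) (θ' h x) x := fun h x =>
    (((hS x).div_const _).add (hT h x)).const_mul _
  have hθ' : ∀ h x, HasDerivAt (θ' h) (θ'' h x) x := fun h x =>
    (((hhas hφ x).div_const _).add (hhas (hΨ.contDiff h) x)).const_mul _
  let g : ℝ → ℂ := fun h => ((h ^ (-(1 / 4) : ℝ) : ℝ) : ℂ)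
  let f : ℝ → ℝ → ℂ := fun h x => g h * (X x * Complex.exp (θ h x))
  have hf1 : ∀ h, deriv (f h) = fun x =>
      g h * ((deriv X x + X x * θ' h x) * Complex.exp (θ h x)) := fun h =>
    deriv_const_mul_mul_cexp (hhas hX) (hθ h) (g h)
  have hf2 : ∀ h, deriv (deriv (f h)) = fun x =>
      g h * ((deriv (deriv X) x + (deriv X x * θ' h x + X x * θ'' h x)
        + (deriv X x + X x * θ' h x) * θ' h x) * Complex.exp (θ h x)) := fun h => by
    rw [hf1]
    exact deriv_const_mul_mul_cexp
      (fun x => (hhas (hderiv hX) x).add ((hhas hX x).mul (hθ' h x))) (hθ h) (g h)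
  have hfsmooth : ∀ h, ContDiff ℝ (⊤ : ℕ∞) (f h) := fun h =>
    contDiff_const.mul (hX.mul (contDiff_const.mul (((contDiff_primitive hφ u).div_const _).add
      (contDiff_primitive (hΨ.contDiff h) u))).cexp)
  have hfsupp : ∀ h, HasCompactSupport (f h) := fun h => by
    refine HasCompactSupport.intro (isCompact_closedBall u δ) fun x hx => ?_
    simp [f, (hXout x hx).eq_of_nhds]
  -- Pointwise Gaussian bounds.
  obtain ⟨BT, hBT0, hBT⟩ := exists_norm_le_of_continuous_uncurry hTcont u δ
  have hnormE : ∀ h x, ‖Complex.exp (θ h x)‖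
      = Real.exp (-((S x).im / h)) * Real.exp (-(T h x).im) := fun h x => by
    rw [Complex.norm_exp, ← Real.exp_add]
    simp [θ, Complex.div_ofReal_im]
    ring
  have hgauss : ∀ h ∈ Set.Ioc (0 : ℝ) 1, ∀ (x : ℝ) (w : ℂ) (ω : ℝ), 0 ≤ ω →
      (x ∈ Metric.closedBall u δ → ‖w‖ ≤ ω) → (x ∉ Metric.closedBall u δ → w = 0) →
      ‖g h * (w * Complex.exp (θ h x))‖ ≤ (ω * Real.exp BT) *
        (h ^ (-(1 / 4) : ℝ) * Real.exp (-κ * (x - u) ^ 2 / h)) := fun h hh x w ω hω hin hout => by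
    have hg0 : 0 < h ^ (-(1 / 4) : ℝ) := Real.rpow_pos_of_pos hh.1 _
    by_cases hx : x ∈ Metric.closedBall u δ
    · have hgn : ‖g h‖ = h ^ (-(1 / 4) : ℝ) := by
        simp only [g, Complex.norm_real, Real.norm_eq_abs, abs_of_pos hg0]
      have h1 : Real.exp (-((S x).im / h)) ≤ Real.exp (-κ * (x - u) ^ 2 / h) := by
        apply Real.exp_le_exp.mpr
        rw [neg_mul, neg_div, neg_le_neg_iff]
        exact div_le_div_of_nonneg_right (hball x hx).1 hh.1.le
      have h2 : Real.exp (-(T h x).im) ≤ Real.exp BT :=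
        Real.exp_le_exp.mpr ((neg_le_abs _).trans
          ((Complex.abs_im_le_norm _).trans (hBT h hh x hx)))
      rw [norm_mul, norm_mul, hgn, hnormE]
      calc _ ≤ h ^ (-(1 / 4) : ℝ) *
            (ω * (Real.exp (-κ * (x - u) ^ 2 / h) * Real.exp BT)) := by
              gcongr; exact hin hx
        _ = _ := by ring
    · rw [hout hx]
      simp only [zero_mul, mul_zero, norm_zero]
      positivity
  have hfle : ∀ h ∈ Set.Ioc (0 : ℝ) 1, ∀ x,
      ‖f h x‖ ≤ Real.exp BT * h ^ (-(1 / 4) : ℝ) * Real.exp (-κ * (x - u) ^ 2 / h) :=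
    fun h hh x => (hgauss h hh x (X x) 1 zero_le_one (fun _ => hXle x)
      (fun hx => (hXout x hx).eq_of_nhds)).trans_eq (by ring)
  -- Bounds for the symbols multiplying the exponential.
  obtain ⟨Bφ, hBφ0, hBφ⟩ := exists_norm_sub_le_mul_abs hφ u δ
  obtain ⟨BX, hBX0, hBX⟩ := exists_norm_le_of_continuous_uncurry
    (W := fun _ x => deriv X x) ((hderiv hX).continuous.comp continuous_snd) u δ
  obtain ⟨BΨ, hBΨ0, hBΨ⟩ := exists_norm_le_of_continuous_uncurry hΨ.continuous u δ
  obtain ⟨BR, hBR0, hBR⟩ := exists_norm_le_of_continuous_uncurry hR.continuous u δ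
  let K : ℝ → ℝ → ℂ := fun h x => -(h : ℂ) ^ 2 * a x * deriv (deriv X) x
    - 2 * Complex.I * h * a x * (φ x + h * Ψ h x) * deriv X x
    - Complex.I * h * b x * deriv X x
  have hKcont : Continuous (Function.uncurry K) := by
    have h1 := ha.continuous
    have h2 := hb.continuous
    have h3 := hφ.continuous
    have h4 : Continuous fun p : ℝ × ℝ => Ψ p.1 p.2 := hΨ.continuous
    have h5 := (hderiv hX).continuous
    have h6 := (hderiv (hderiv hX)).continuous
    simp only [Function.uncurry_def, K]
    fun_prop
  obtain ⟨BK, hBK0, hBK⟩ := exists_norm_le_of_continuous_uncurry hKcont u δ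
  have hKle : ∀ h ∈ Set.Ioc (0 : ℝ) 1, ∀ x ∈ Metric.closedBall u δ,
      ‖K h x‖ ≤ BK * (2 / δ) ^ (2 * (n + 2)) * |x - u| ^ (2 * (n + 2)) := fun h hh x hx => by
    by_cases hx2 : x ∈ Metric.ball u (δ / 2)
    · have h1 : deriv X =ᶠ[𝓝 x] fun _ => 0 := by simpa using (hXin x hx2).deriv
      have h2 : deriv (deriv X) x = 0 := by simpa using h1.deriv_eq
      simp only [K, h1.eq_of_nhds, h2, mul_zero, sub_zero, norm_zero]
      positivity
    · rw [mul_assoc, ← mul_pow]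
      refine (hBK h hh x hx).trans (le_mul_of_one_le_right hBK0.le (one_le_pow₀ ?_))
      rw [Metric.mem_ball, not_lt, Real.dist_eq] at hx2
      rw [div_mul_eq_mul_div, one_le_div hδ]
      linarith
  obtain ⟨C₁, hC₁, hpos⟩ := exists_eLpNorm_le_of_norm_le_weighted_gaussian hκ u 1
    (α := Real.exp BT) (γ := 0) (by positivity) le_rfl
  obtain ⟨C₂, hC₂, hmom⟩ := exists_eLpNorm_le_of_norm_le_weighted_gaussian hκ u 1
    (α := Bφ * Real.exp BT) (γ := (BX + BΨ) * Real.exp BT) (by positivity) (by positivity)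
  obtain ⟨C₃, hC₃, heig⟩ := exists_eLpNorm_le_of_norm_le_weighted_gaussian hκ u (2 * (n + 2))
    (α := BK * (2 / δ) ^ (2 * (n + 2)) * Real.exp BT) (γ := BR * Real.exp BT)
    (by positivity) (by positivity)
  refine ⟨√√(Real.pi / β), by positivity, C₁ + C₂ + C₃, by positivity, f,
    tendsto_eLpNorm_of_rescaled hκ (fun h _ => (hfsmooth h).continuous) hfle fun y => ?_,
    fun h hh => ⟨hfsmooth h, hfsupp h, ?_, ?_, ?_⟩⟩
  · have hsqrt : Filter.Tendsto (fun h : ℝ => u + √h * y) (𝓝[>] 0) (𝓝 u) := by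
      have : Continuous fun h : ℝ => u + √h * y := by fun_prop
      simpa using (this.tendsto 0).mono_left nhdsWithin_le_nhds
    have h1 : Filter.Tendsto (fun h : ℝ => ‖X (u + √h * y)‖) (𝓝[>] 0) (𝓝 1) := by
      have hXu : X u = 1 := (hXin u (Metric.mem_ball_self (by positivity))).eq_of_nhds
      simpa [hXu] using ((hX.continuous.tendsto u).comp hsqrt).norm
    have h2 : Filter.Tendsto (fun h : ℝ => (S (u + √h * y)).im / h) (𝓝[>] 0)
        (𝓝 (β / 2 * y ^ 2)) := by
      rcases eq_or_ne y 0 with rfl | hy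
      · simp [S]
      · have hne : Filter.Tendsto (fun h : ℝ => u + √h * y) (𝓝[>] 0) (𝓝[≠] u) := by
          refine tendsto_nhdsWithin_iff.mpr ⟨hsqrt, ?_⟩
          filter_upwards [self_mem_nhdsWithin] with h hh
          simpa [hy] using (Real.sqrt_pos.mpr hh).ne'
        refine Filter.Tendsto.congr' ?_ ((hSlim.comp hne).mul_const (y ^ 2))
        filter_upwards [self_mem_nhdsWithin] with h hh
        have hh' : h ≠ 0 := (Set.mem_Ioi.mp hh).ne'
        simp only [Function.comp_apply, add_sub_cancel_left, mul_pow,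
          Real.sq_sqrt (Set.mem_Ioi.mp hh).le]
        field_simp
    have h3 : Filter.Tendsto (fun h : ℝ => (T h (u + √h * y)).im) (𝓝[>] 0) (𝓝 0) := by
      have hid : Filter.Tendsto (fun h : ℝ => h) (𝓝[>] 0) (𝓝 0) := nhdsWithin_le_nhds
      have := (hTcont.tendsto (0, u)).comp (hid.prodMk_nhds hsqrt)
      have h0 : Function.uncurry T (0, u) = 0 := by simp [T]
      rw [h0] at this
      simpa [Function.comp_def] using (Complex.continuous_im.tendsto 0).comp this
    have h4 := h1.mul (((Real.continuous_exp.tendsto _).comp h2.neg).mul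
      ((Real.continuous_exp.tendsto _).comp h3.neg))
    simp only [neg_zero, Real.exp_zero, mul_one, one_mul, ← neg_mul] at h4
    refine Filter.Tendsto.congr' ?_ h4
    filter_upwards [self_mem_nhdsWithin] with h hh
    have hg0 : 0 < h ^ (-(1 / 4) : ℝ) := Real.rpow_pos_of_pos hh _
    have hgn : h ^ (1 / 4 : ℝ) * ‖g h‖ = 1 := by
      simp only [g, Complex.norm_real, Real.norm_eq_abs, abs_of_pos hg0]
      rw [← Real.rpow_add hh]; norm_num
    simp only [f, norm_mul, hnormE, Function.comp_apply]
    rw [← mul_assoc (h ^ (1 / 4 : ℝ)), hgn, one_mul]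
  all_goals
    have hh0 : (h : ℂ) ≠ 0 := by exact_mod_cast hh.1.ne'
    have hθh : ∀ x, h * θ' h x = Complex.I * (φ x + h * Ψ h x) := fun x => by
      simp only [θ']; field_simp
    have hhs : h ≤ √h := by
      rw [Real.le_sqrt hh.1.le hh.1.le]
      nlinarith [hh.1, hh.2]
  · refine (hpos h hh.1 _ fun x => ?_).trans (ENNReal.ofReal_le_ofReal ?_)
    · rw [← sub_mul, norm_mul, ← Complex.ofReal_sub, Complex.norm_real, Real.norm_eq_abs]
      refine (mul_le_mul_of_nonneg_left (hfle h hh x) (abs_nonneg _)).trans_eq ?_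
      ring
    · rw [pow_one, Real.sqrt_eq_rpow]
      have := hh.1
      gcongr
      linarith
  · refine (hmom h hh.1 _ fun x => ?_).trans (ENNReal.ofReal_le_ofReal ?_)
    · have hrw : -Complex.I * (h : ℂ) * deriv (f h) x - (ξ : ℂ) * f h x
          = g h * ((X x * (φ x - φ u) + h * (X x * Ψ h x - Complex.I * deriv X x))
            * Complex.exp (θ h x)) := by
        rw [hf1, hφu]
        simp only [f]
        linear_combination (-Complex.I * g h * X x * Complex.exp (θ h x)) * hθh x
          - (g h * X x * Complex.exp (θ h x) * (φ x + h * Ψ h x)) * Complex.I_sq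
      rw [hrw]
      refine (hgauss h hh x _ (Bφ * |x - u| + √h * (BΨ + BX)) (by positivity) (fun hx => ?_)
        (fun hx => ?_)).trans_eq (by ring)
      · refine (norm_add_le _ _).trans (add_le_add ?_ ?_)
        · rw [norm_mul]
          exact (mul_le_of_le_one_left (norm_nonneg _) (hXle x)).trans (hBφ x hx)
        · rw [norm_mul, Complex.norm_real, Real.norm_of_nonneg hh.1.le]
          refine mul_le_mul hhs ((norm_sub_le _ _).trans (add_le_add ?_ ?_)) (norm_nonneg _)
            (Real.sqrt_nonneg _)
          · rw [norm_mul]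
            exact (mul_le_of_le_one_left (norm_nonneg _) (hXle x)).trans (hBΨ h hh x hx)
          · rw [norm_mul, Complex.norm_I, one_mul]
            exact hBX h hh x hx
      · have h1 : deriv X x = 0 := by simpa using (hXout x hx).deriv_eq
        simp [h1, (hXout x hx).eq_of_nhds]
    · rw [pow_one, Real.sqrt_eq_rpow]
      have := hh.1
      gcongr
      linarith
  · have hpow : √h ^ (2 * (n + 2)) = h ^ (n + 2) := by rw [pow_mul, Real.sq_sqrt hh.1.le]
    refine (heig h hh.1 _ fun x => ?_).trans (ENNReal.ofReal_le_ofReal ?_)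
    · have hrw : (-(h : ℂ) ^ 2 * a x * deriv (deriv (f h)) x
            - Complex.I * (h : ℂ) * b x * deriv (f h) x + c x * f h x) - z * f h x
          = g h * ((X x * (a x * (φ x + h * Ψ h x) ^ 2
            - Complex.I * h * a x * (deriv φ x + h * deriv (Ψ h) x)
            + b x * (φ x + h * Ψ h x) + c x - z) + K h x) * Complex.exp (θ h x)) := by
        have hθh' : h * θ'' h x = Complex.I * (deriv φ x + h * deriv (Ψ h) x) := by
          simp only [θ'']; field_simp
        rw [hf2, hf1]
        simp only [f, K]
        set Φ := φ x + h * Ψ h x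
        set Φ' := deriv φ x + h * deriv (Ψ h) x
        set e := Complex.exp (θ h x)
        linear_combination (g h * e * (-h * a x * 2 * deriv X x
            - a x * X x * (h * θ' h x + Complex.I * Φ) - Complex.I * b x * X x)) * hθh x
          + (g h * e * (-h * a x * X x)) * hθh'
          + (g h * e * (-a x * X x * Φ ^ 2 - b x * X x * Φ)) * Complex.I_sq
      rw [hrw]
      refine (hgauss h hh x _ (BK * (2 / δ) ^ (2 * (n + 2)) * |x - u| ^ (2 * (n + 2))
        + BR * √h ^ (2 * (n + 2))) (by positivity) (fun hx => ?_)
        (fun hx => ?_)).trans_eq (by ring)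
      · rw [(hball x hx).2 h, add_comm]
        refine (norm_add_le _ _).trans (add_le_add (hKle h hh x hx) ?_)
        rw [norm_mul, norm_mul, norm_pow, Complex.norm_real h, Real.norm_of_nonneg hh.1.le, hpow,
          mul_comm BR]
        refine (mul_le_of_le_one_left (mul_nonneg (pow_nonneg hh.1.le _) (norm_nonneg _))
          (hXle x)).trans ?_
        exact mul_le_mul_of_nonneg_left (hBR h hh x hx) (pow_nonneg hh.1.le _)
      · have h1 : deriv X =ᶠ[𝓝 x] fun _ => 0 := by simpa using (hXout x hx).deriv
        have h2 : deriv (deriv X) x = 0 := by simpa using h1.deriv_eq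
        simp [K, h1.eq_of_nhds, h2, (hXout x hx).eq_of_nhds]
    · rw [hpow]
      have := hh.1
      gcongr
      linarith
end

section
/- Let a, b, c : ℝ → ℂ be C^∞ with a(x) ≠ 0 for all x, let (L_h f)(x) = −h² a(x) f″(x) − i h b(x) f′(x) + c(x) f(x), and σ(u,ξ) = a(u)ξ² + b(u)ξ + c(u). Suppose (u,ξ) ∈ ℝ² satisfies {Re σ, Im σ}(u,ξ) > 0, and set k = −i (∂σ/∂u)(u,ξ) / (∂σ/∂ξ)(u,ξ), which then satisfies Re(k) < 0. Then for every positive integer n there exist constants c > 0, C > 0 and, for each h ∈ (0,1], a function f_h ∈ C_c^∞(ℝ) such that: lim_{h→0+} ‖f_h‖ = c; ‖x f_h − u f_h‖ ≤ C h^{1/2}; ‖−ih f_h′ − ξ f_h‖ ≤ C h^{1/2}; ‖L_h f_h − σ(u,ξ) f_h‖ ≤ C h^{n+2}; and moreover ‖f_h − g_h‖ ≤ C h^{1/2}, where g_h(u+s) = h^{−1/4} exp{h^{−1}(iξ s + k s²/2)}. -/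
open MeasureTheory
open scoped Topology ENNReal

theorem contDiff_complex_div {n : WithTop ℕ∞} {f g : ℝ → ℂ} (hf : ContDiff ℝ n f)
    (hg : ContDiff ℝ n g) (h0 : ∀ x, g x ≠ 0) : ContDiff ℝ n (fun x => f x / g x) := by
  simp only [div_eq_mul_inv]
  exact hf.mul (hg.inv h0)

theorem exists_smooth_primitive {F : ℝ → ℂ} (hF : ContDiff ℝ (⊤ : ℕ∞) F) (u : ℝ) :
    ∃ G : ℝ → ℂ, ContDiff ℝ (⊤ : ℕ∞) G ∧ G u = 0 ∧ ∀ x, HasDerivAt G (F x) x := by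
  have hd : ∀ x, HasDerivAt (fun y => ∫ t in u..y, F t) (F x) x := fun x =>
    intervalIntegral.integral_hasDerivAt_right (hF.continuous.intervalIntegrable _ _)
      (hF.continuous.stronglyMeasurableAtFilter _ _) hF.continuous.continuousAt
  refine ⟨fun x => ∫ t in u..x, F t, ?_, by simp, hd⟩
  rw [contDiff_infty_iff_deriv]
  refine ⟨fun x => (hd x).differentiableAt, ?_⟩
  rwa [show deriv (fun y => ∫ t in u..y, F t) = F from funext fun x => (hd x).deriv]

theorem exists_smooth_solution_linear_ode {r e g : ℝ → ℂ} (hr : ContDiff ℝ (⊤ : ℕ∞) r)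
    (he : ContDiff ℝ (⊤ : ℕ∞) e) (hg : ContDiff ℝ (⊤ : ℕ∞) g) (hr0 : ∀ x, r x ≠ 0)
    (u : ℝ) (α : ℂ) :
    ∃ A : ℝ → ℂ, ContDiff ℝ (⊤ : ℕ∞) A ∧ A u = α ∧
      ∀ x, r x * deriv A x + e x * A x = g x := by
  obtain ⟨G, hG, hGu, hGd⟩ := exists_smooth_primitive (contDiff_complex_div he hr hr0) u
  obtain ⟨J, hJ, hJu, hJd⟩ := exists_smooth_primitive
    ((contDiff_complex_div hg hr hr0).mul hG.cexp) u
  refine ⟨fun x => Complex.exp (-G x) * (α + J x), hG.neg.cexp.mul (contDiff_const.add hJ),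
    by simp [hGu, hJu], fun x => ?_⟩
  have h := ((hGd x).neg.cexp.mul ((hJd x).const_add α)).deriv
  simp only [Pi.mul_def, Pi.neg_apply] at h
  rw [h]
  have h1 : Complex.exp (-G x) * Complex.exp (G x) = 1 := by
    rw [← Complex.exp_add]; simp
  have := hr0 x
  field_simp
  linear_combination g x * h1

theorem exists_transport_sequence {a r e : ℝ → ℂ} (ha : ContDiff ℝ (⊤ : ℕ∞) a)
    (hr : ContDiff ℝ (⊤ : ℕ∞) r) (he : ContDiff ℝ (⊤ : ℕ∞) e) (hr0 : ∀ x, r x ≠ 0) (u : ℝ) :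
    ∃ A : ℕ → ℝ → ℂ, (∀ m, ContDiff ℝ (⊤ : ℕ∞) (A m)) ∧ A 0 u = 1 ∧
      (∀ x, r x * deriv (A 0) x + e x * A 0 x = 0) ∧
      ∀ m x, r x * deriv (A (m + 1)) x + e x * A (m + 1) x
        = Complex.I * a x * deriv (deriv (A m)) x := by
  have step : ∀ B : {B : ℝ → ℂ // ContDiff ℝ (⊤ : ℕ∞) B}, ∃ B' : {B : ℝ → ℂ //
      ContDiff ℝ (⊤ : ℕ∞) B}, ∀ x, r x * deriv B'.1 x + e x * B'.1 x
        = Complex.I * a x * deriv (deriv B.1) x := by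
    rintro ⟨B, hB⟩
    have hB2 : ContDiff ℝ (⊤ : ℕ∞) (deriv (deriv B)) :=
      (contDiff_infty_iff_deriv.1 (contDiff_infty_iff_deriv.1 hB).2).2
    obtain ⟨A, hA, -, h⟩ := exists_smooth_solution_linear_ode hr he
      ((contDiff_const (c := Complex.I)).mul ha |>.mul hB2) hr0 u 0
    exact ⟨⟨A, hA⟩, h⟩
  choose next hnext using step
  obtain ⟨A, hA, hAu, hA0⟩ := exists_smooth_solution_linear_ode hr he
    (contDiff_const (c := (0 : ℂ))) hr0 u 1
  exact ⟨fun m => ((next^[m] ⟨A, hA⟩).1), fun m => (next^[m] ⟨A, hA⟩).2, hAu, hA0,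
    fun m x => by
      simp only [Function.iterate_succ_apply']
      exact hnext _ x⟩

theorem transport_sum_telescope {a r e : ℝ → ℂ} {A : ℕ → ℝ → ℂ}
    (h0 : ∀ x, r x * deriv (A 0) x + e x * A 0 x = 0)
    (hs : ∀ m x, r x * deriv (A (m + 1)) x + e x * A (m + 1) x
        = Complex.I * a x * deriv (deriv (A m)) x) (n : ℕ) (h : ℂ) (x : ℝ) :
    ∑ m ∈ Finset.range (n + 1), h ^ m * (-Complex.I * h * (r x * deriv (A m) x + e x * A m x)
        - h ^ 2 * a x * deriv (deriv (A m)) x)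
      = -(h ^ (n + 2) * a x * deriv (deriv (A n)) x) := by
  induction n with
  | zero => simp [h0]
  | succ n ih =>
    rw [Finset.sum_range_succ, ih, hs]
    ring_nf
    simp only [Complex.I_sq]
    ring

theorem exists_eikonal_solution {a b c : ℝ → ℂ} (ha : ContDiff ℝ (⊤ : ℕ∞) a)
    (hb : ContDiff ℝ (⊤ : ℕ∞) b) (hc : ContDiff ℝ (⊤ : ℕ∞) c) (hell : ∀ x, a x ≠ 0)
    (u : ℝ) (ξ : ℂ) (hQ : 2 * a u * ξ + b u ≠ 0) :
    ∃ η : ℝ → ℂ, ContDiff ℝ (⊤ : ℕ∞) η ∧ (∀ x, 2 * a x * η x + b x ≠ 0) ∧ η u = ξ ∧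
      ∀ᶠ x in 𝓝 u, a x * η x ^ 2 + b x * η x + c x = a u * ξ ^ 2 + b u * ξ + c u := by
  set z := a u * ξ ^ 2 + b u * ξ + c u with hz
  set Q := 2 * a u * ξ + b u with hQdef
  let w : ℝ → ℂ := fun x => (b x ^ 2 - 4 * a x * (c x - z)) / Q ^ 2
  have hw : ContDiff ℝ (⊤ : ℕ∞) w :=
    ((hb.pow 2).sub ((contDiff_const.mul ha).mul (hc.sub contDiff_const))).div_const _
  have hwu : w u = 1 := by
    simp only [w]
    rw [div_eq_one_iff_eq (pow_ne_zero 2 hQ), hQdef, hz]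
    ring
  obtain ⟨ρ, hρ, hwρ⟩ := Metric.continuousAt_iff.1 hw.continuous.continuousAt (1 / 2) (by norm_num)
  let χ : ContDiffBump u := ⟨ρ / 2, ρ, by positivity, by linarith⟩
  let v : ℝ → ℂ := fun x => 1 + (χ x : ℂ) * (w x - 1)
  have hχ : ContDiff ℝ (⊤ : ℕ∞) (fun x => (χ x : ℂ)) :=
    Complex.ofRealCLM.contDiff.comp χ.contDiff
  have hv : ContDiff ℝ (⊤ : ℕ∞) v := contDiff_const.add (hχ.mul (hw.sub contDiff_const))
  have hvs : ∀ x, v x ∈ Complex.slitPlane := by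
    intro x
    have hlt : ‖(χ x : ℂ) * (w x - 1)‖ < 1 := by
      rw [norm_mul, Complex.norm_real, Real.norm_of_nonneg χ.nonneg]
      by_cases hx : x ∈ Metric.ball u ρ
      · have := hwρ (Metric.mem_ball.1 hx)
        rw [hwu, dist_eq_norm] at this
        nlinarith [χ.le_one (x := x), χ.nonneg (x := x), norm_nonneg (w x - 1)]
      · rw [χ.zero_of_le_dist (by simpa using hx)]
        simp
    exact Complex.mem_slitPlane_of_norm_lt_one hlt
  have hv0 : ∀ x, v x ≠ 0 := fun x => Complex.slitPlane_ne_zero (hvs x)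
  let r : ℝ → ℂ := fun x => Q * Complex.exp (Complex.log (v x) / 2)
  have hlog : ContDiff ℝ (⊤ : ℕ∞) (fun x => Complex.log (v x)) := by
    rw [contDiff_iff_contDiffAt]
    exact fun x => ((Complex.contDiffAt_log (hvs x)).restrict_scalars ℝ).comp x hv.contDiffAt
  have hr : ContDiff ℝ (⊤ : ℕ∞) r := contDiff_const.mul (hlog.div_const 2).cexp
  have hr2 : ∀ x, r x ^ 2 = Q ^ 2 * v x := by
    intro x
    simp only [r]
    rw [mul_pow, ← Complex.exp_nat_mul, show ((2 : ℕ) : ℂ) * (Complex.log (v x) / 2)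
      = Complex.log (v x) by push_cast; ring, Complex.exp_log (hv0 x)]
  have h2a : ∀ x, 2 * a x ≠ 0 := fun x => mul_ne_zero two_ne_zero (hell x)
  have hkey : ∀ x, 2 * a x * ((r x - b x) / (2 * a x)) + b x = r x := by
    intro x
    rw [mul_div_cancel₀ _ (h2a x)]
    ring
  refine ⟨fun x => (r x - b x) / (2 * a x), contDiff_complex_div (hr.sub hb) (contDiff_const.mul ha) h2a,
    fun x => ?_, ?_, ?_⟩
  · rw [hkey]
    exact mul_ne_zero hQ (Complex.exp_ne_zero _)
  · have hvu : v u = 1 := by simp [v, hwu]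
    simp only [r, hvu, Complex.log_one, zero_div, Complex.exp_zero, mul_one]
    rw [div_eq_iff (h2a u), hQdef]
    ring
  · filter_upwards [χ.eventuallyEq_one] with x hx
    have h1 : r x ^ 2 = b x ^ 2 - 4 * a x * (c x - z) := by
      rw [hr2]
      simp only [v, hx, w, Pi.one_apply]
      field_simp
      push_cast
      ring
    have := hell x
    field_simp
    linear_combination h1

theorem norm_le_pow_succ_of_norm_deriv_le_pow {g g' : ℝ → ℂ} {u M : ℝ} {j : ℕ}
    (hM : 0 ≤ M) (hg : ∀ x, HasDerivAt g (g' x) x) (hgu : g u = 0)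
    (hb : ∀ x, |x - u| ≤ 1 → ‖g' x‖ ≤ M * |x - u| ^ j) (x : ℝ) (hx : |x - u| ≤ 1) :
    ‖g x‖ ≤ M * |x - u| ^ (j + 1) := by
  have h := (convex_closedBall u |x - u|).norm_image_sub_le_of_norm_hasDerivWithin_le
    (f := g) (f' := g') (C := M * |x - u| ^ j) (x := u) (y := x)
    (fun y _ => (hg y).hasDerivWithinAt) (fun y hy => ?_) (by simp)
    (by simp [Real.dist_eq])
  · rw [hgu, sub_zero, Real.norm_eq_abs] at h
    rwa [pow_succ, ← mul_assoc]
  · rw [Metric.mem_closedBall, Real.dist_eq] at hy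
    exact (hb y (hy.trans hx)).trans (by gcongr)

theorem exists_cubic_taylor_bound {φ : ℝ → ℂ} (hφ : ContDiff ℝ (⊤ : ℕ∞) φ) (u : ℝ)
    (hφu : φ u = 0) :
    ∃ M : ℝ, 0 ≤ M ∧ ∀ x, |x - u| ≤ 1 →
      ‖φ x - (deriv φ u * (x - u) + deriv (deriv φ) u * (x - u) ^ 2 / 2)‖
        ≤ M * |x - u| ^ 3 := by
  have h1 := contDiff_infty_iff_deriv.1 hφ
  have h2 := contDiff_infty_iff_deriv.1 h1.2
  have h3 := contDiff_infty_iff_deriv.1 h2.2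
  obtain ⟨M, hM⟩ := (isCompact_closedBall u 1).exists_bound_of_continuousOn
    h3.2.continuous.continuousOn
  have hM' : ∀ x, |x - u| ≤ 1 → ‖deriv (deriv (deriv φ)) x‖ ≤ M * |x - u| ^ 0 := fun x hx => by
    simpa using hM x (by simpa [Real.dist_eq] using hx)
  have hM0 : 0 ≤ M := by
    have := (norm_nonneg _).trans (hM' u (by simp))
    simpa using this
  have hid : ∀ x : ℝ, HasDerivAt (fun y : ℝ => (y : ℂ) - (u : ℂ)) 1 x := fun x =>
    (Complex.ofRealCLM.hasDerivAt (x := x)).sub_const _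
  refine ⟨M, hM0, norm_le_pow_succ_of_norm_deriv_le_pow (j := 2)
    (g' := fun x => deriv φ x - (deriv φ u + deriv (deriv φ) u * (x - u))) hM0 (fun x => ?_)
    (by simp [hφu]) ?_⟩
  · refine ((h1.1 x).hasDerivAt.sub (((hid x).const_mul (deriv φ u)).add
      ((((hid x).pow 2).const_mul (deriv (deriv φ) u)).div_const 2))).congr_deriv ?_
    push_cast
    ring
  refine norm_le_pow_succ_of_norm_deriv_le_pow (j := 1)
    (g' := fun x => deriv (deriv φ) x - deriv (deriv φ) u) hM0 (fun x => ?_) (by simp) ?_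
  · refine ((h2.1 x).hasDerivAt.sub (((hid x).const_mul (deriv (deriv φ) u)).const_add
      (deriv φ u))).congr_deriv ?_
    ring
  exact norm_le_pow_succ_of_norm_deriv_le_pow (j := 0) hM0
    (fun x => (h3.1 x).hasDerivAt.sub_const _) (by simp) hM'

/-- The `L²`-normalised Gaussian profile of width `√h` centred at `u`. -/
noncomputable def gaussianWeight (κ u h x : ℝ) : ℝ :=
  h ^ (-(1 : ℝ) / 4) * Real.exp (-(κ * (x - u) ^ 2 / h))

theorem gaussianWeight_nonneg (κ u : ℝ) {h : ℝ} (hh : 0 < h) (x : ℝ) :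
    0 ≤ gaussianWeight κ u h x := by
  unfold gaussianWeight
  positivity

theorem eLpNorm_gaussianWeight {κ h : ℝ} (hκ : 0 < κ) (u : ℝ) (hh : 0 < h) :
    eLpNorm (gaussianWeight κ u h) 2 volume
      = ENNReal.ofReal ((Real.pi / (2 * κ)) ^ ((1 : ℝ) / 4)) := by
  have hsq : ∀ x, gaussianWeight κ u h x ^ 2
      = h ^ (-(1 : ℝ) / 2) * Real.exp (-(2 * κ / h) * (x - u) ^ 2) := fun x => by
    unfold gaussianWeight
    rw [mul_pow, ← Real.exp_nat_mul, ← Real.rpow_natCast, ← Real.rpow_mul hh.le]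
    congr 2
    · norm_num
    · push_cast
      ring
  have hint : Integrable (fun x => gaussianWeight κ u h x ^ 2) := by
    simp only [hsq]
    exact ((integrable_exp_neg_mul_sq (b := 2 * κ / h) (by positivity)).comp_sub_right u).const_mul _
  have hval : ∫ x, gaussianWeight κ u h x ^ 2 = (Real.pi / (2 * κ)) ^ ((1 : ℝ) / 2) := by
    simp only [hsq]
    rw [integral_const_mul,
      integral_sub_right_eq_self (fun x => Real.exp (-(2 * κ / h) * x ^ 2)) u,
      integral_gaussian, Real.sqrt_eq_rpow,
      show Real.pi / (2 * κ / h) = h * (Real.pi / (2 * κ)) by field_simp,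
      Real.mul_rpow hh.le (by positivity), ← mul_assoc, ← Real.rpow_add hh]
    norm_num
  have hlint : ∫⁻ x, ‖gaussianWeight κ u h x‖ₑ ^ (2 : ℝ)
      = ENNReal.ofReal ((Real.pi / (2 * κ)) ^ ((1 : ℝ) / 2)) := by
    rw [← hval, ofReal_integral_eq_lintegral_ofReal hint (.of_forall fun x => by positivity)]
    refine lintegral_congr fun x => ?_
    rw [Real.enorm_of_nonneg (gaussianWeight_nonneg κ u hh x),
      ENNReal.ofReal_pow (gaussianWeight_nonneg κ u hh x)]
    norm_cast
  rw [eLpNorm_eq_lintegral_rpow_enorm_toReal (by norm_num) (by norm_num)]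
  simp only [ENNReal.toReal_ofNat]
  rw [hlint, ENNReal.ofReal_rpow_of_nonneg (by positivity) (by norm_num),
    ← Real.rpow_mul (by positivity)]
  norm_num

theorem eLpNorm_le_of_norm_le_gaussianWeight {κ h K : ℝ} (hκ : 0 < κ) {u : ℝ} (hh : 0 < h)
    (hK : 0 ≤ K) {F : ℝ → ℂ} (hF : ∀ x, ‖F x‖ ≤ K * gaussianWeight κ u h x) :
    eLpNorm F 2 volume ≤ ENNReal.ofReal (K * (Real.pi / (2 * κ)) ^ ((1 : ℝ) / 4)) := by
  have h1 : eLpNorm F 2 volume ≤ eLpNorm (K • gaussianWeight κ u h) 2 volume :=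
    eLpNorm_mono_real hF
  rwa [eLpNorm_const_smul, eLpNorm_gaussianWeight hκ u hh, Real.enorm_of_nonneg hK,
    ← ENNReal.ofReal_mul hK] at h1

theorem exists_pow_mul_gaussianWeight_le {κ : ℝ} (hκ : 0 < κ) (u : ℝ) (j : ℕ) :
    ∃ K : ℝ, 0 ≤ K ∧ ∀ h > 0, ∀ x, |x - u| ^ j * gaussianWeight (2 * κ) u h x
      ≤ K * √h ^ j * gaussianWeight κ u h x := by
  refine ⟨1 + j.factorial / κ ^ j, by positivity, fun h hh x => ?_⟩
  set y := κ * (x - u) ^ 2 / h with hy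
  have hy0 : 0 ≤ y := by positivity
  have hsplit : gaussianWeight (2 * κ) u h x = Real.exp (-y) * gaussianWeight κ u h x := by
    unfold gaussianWeight
    rw [show -(2 * κ * (x - u) ^ 2 / h) = -y + -y by rw [hy]; ring, Real.exp_add]
    ring
  rw [hsplit, ← mul_assoc]
  refine mul_le_mul_of_nonneg_right ?_ (gaussianWeight_nonneg _ _ hh _)
  set t := |x - u| / √h with ht
  have hs : 0 < √h := Real.sqrt_pos.2 hh
  have ht0 : 0 ≤ t := by positivity
  have hxt : |x - u| = t * √h := by rw [ht]; field_simp
  have hyt : y = κ * t ^ 2 := by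
    rw [hy, ht, div_pow, sq_abs, Real.sq_sqrt hh.le]
    ring
  have h1 : t ^ j ≤ 1 + (t ^ 2) ^ j := by
    rw [← pow_mul, mul_comm, pow_mul]
    nlinarith [sq_nonneg (t ^ j - 1)]
  have h2 : (t ^ 2) ^ j ≤ j.factorial / κ ^ j * Real.exp y := by
    have := Real.pow_div_factorial_le_exp _ hy0 j
    rw [div_le_iff₀ (by positivity), hyt, mul_pow] at this
    rw [div_mul_eq_mul_div, le_div_iff₀ (by positivity), hyt]
    linarith
  have h3 : t ^ j * Real.exp (-y) ≤ 1 + j.factorial / κ ^ j := by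
    rw [Real.exp_neg, ← div_eq_mul_inv, div_le_iff₀ (Real.exp_pos y)]
    have := Real.one_le_exp hy0
    linarith
  rw [hxt, mul_pow]
  calc t ^ j * √h ^ j * Real.exp (-y) = t ^ j * Real.exp (-y) * √h ^ j := by ring
    _ ≤ _ := by gcongr

theorem norm_exp_sub_exp_le {z w : ℂ} {m : ℝ} (hz : z.re ≤ m) (hw : w.re ≤ m) :
    ‖Complex.exp z - Complex.exp w‖ ≤ Real.exp m * ‖z - w‖ :=
  (convex_halfSpace_re_le m).norm_image_sub_le_of_norm_hasDerivWithin_le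
    (fun y _ => (Complex.hasDerivAt_exp y).hasDerivWithinAt)
    (fun y hy => by rw [Complex.norm_exp]; exact Real.exp_le_exp.2 hy) hw hz

/-- The WKB ansatz with phase `φ` and amplitude `B`. -/
noncomputable def wkb (φ B : ℝ → ℂ) (h x : ℝ) : ℂ :=
  ((h ^ (-(1 : ℝ) / 4) : ℝ) : ℂ) * (Complex.exp ((h : ℂ)⁻¹ * φ x) * B x)

theorem contDiff_wkb {φ B : ℝ → ℂ} (hφ : ContDiff ℝ (⊤ : ℕ∞) φ) (hB : ContDiff ℝ (⊤ : ℕ∞) B)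
    (h : ℝ) : ContDiff ℝ (⊤ : ℕ∞) (wkb φ B h) :=
  contDiff_const.mul ((contDiff_const.mul hφ).cexp.mul hB)

theorem hasCompactSupport_wkb (φ : ℝ → ℂ) {B : ℝ → ℂ} (hB : HasCompactSupport B) (h : ℝ) :
    HasCompactSupport (wkb φ B h) :=
  (hB.mul_left (f := fun x => Complex.exp ((h : ℂ)⁻¹ * φ x))).mul_left
    (f := fun _ => ((h ^ (-(1 : ℝ) / 4) : ℝ) : ℂ))

theorem deriv_wkb {φ B φ' : ℝ → ℂ} (hφ : ∀ x, HasDerivAt φ (φ' x) x) (hB : Differentiable ℝ B)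
    (h : ℝ) : deriv (wkb φ B h) = wkb φ (fun x => (h : ℂ)⁻¹ * φ' x * B x + deriv B x) h := by
  ext x
  refine ((((hφ x).const_mul (h : ℂ)⁻¹).cexp.mul (hB x).hasDerivAt).const_mul
    ((h ^ (-(1 : ℝ) / 4) : ℝ) : ℂ)).deriv.trans ?_
  simp only [wkb]
  ring

theorem norm_wkb_le {φ B : ℝ → ℂ} {κ u h x : ℝ} (hh : 0 < h)
    (hdom : (φ x).re ≤ -(κ * (x - u) ^ 2) ∨ B x = 0) :
    ‖wkb φ B h x‖ ≤ ‖B x‖ * gaussianWeight κ u h x := by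
  rcases hdom with hφ | hB
  · rw [wkb, gaussianWeight, norm_mul, norm_mul, Complex.norm_exp, Complex.norm_real,
      Real.norm_of_nonneg (by positivity), ← Complex.ofReal_inv, Complex.re_ofReal_mul]
    have : h⁻¹ * (φ x).re ≤ -(κ * (x - u) ^ 2 / h) := by
      calc h⁻¹ * (φ x).re ≤ h⁻¹ * -(κ * (x - u) ^ 2) := by gcongr
        _ = _ := by ring
    calc _ ≤ h ^ (-(1 : ℝ) / 4) * (Real.exp (-(κ * (x - u) ^ 2 / h)) * ‖B x‖) := by gcongr
      _ = _ := by ring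
  · simp [wkb, hB]

theorem exists_norm_wkb_le {κ u K : ℝ} (hκ : 0 < κ) (hK : 0 ≤ K) {j : ℕ} {ω : ℝ → ℝ}
    (hω : ∀ h ∈ Set.Ioc (0 : ℝ) 1, √h ^ j ≤ ω h) {φ : ℝ → ℂ} {B : ℝ → ℝ → ℂ}
    (hdom : ∀ h x, (φ x).re ≤ -(2 * κ * (x - u) ^ 2) ∨ B h x = 0)
    (hB : ∀ h ∈ Set.Ioc (0 : ℝ) 1, ∀ x, ‖B h x‖ ≤ K * (ω h + |x - u| ^ j)) :
    ∃ K' : ℝ, 0 ≤ K' ∧ ∀ h ∈ Set.Ioc (0 : ℝ) 1, ∀ x,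
      ‖wkb φ (B h) h x‖ ≤ K' * (ω h * gaussianWeight κ u h x) := by
  obtain ⟨G₀, hG₀, h₀⟩ := exists_pow_mul_gaussianWeight_le hκ u 0
  obtain ⟨G, hG, hj⟩ := exists_pow_mul_gaussianWeight_le hκ u j
  refine ⟨K * (G₀ + G), by positivity, fun h hh x => ?_⟩
  have hw := gaussianWeight_nonneg κ u hh.1 x
  have hw2 := gaussianWeight_nonneg (2 * κ) u hh.1 x
  have hωh : 0 ≤ ω h := le_trans (by positivity) (hω h hh)
  have e0 := h₀ h hh.1 x
  simp only [pow_zero, one_mul, mul_one] at e0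
  have ej : |x - u| ^ j * gaussianWeight (2 * κ) u h x ≤ G * ω h * gaussianWeight κ u h x :=
    (hj h hh.1 x).trans (by gcongr; exact hω h hh)
  calc ‖wkb φ (B h) h x‖ ≤ ‖B h x‖ * gaussianWeight (2 * κ) u h x := norm_wkb_le hh.1 (hdom h x)
    _ ≤ K * (ω h + |x - u| ^ j) * gaussianWeight (2 * κ) u h x := by
      gcongr
      exact hB h hh x
    _ = K * (ω h * gaussianWeight (2 * κ) u h x
          + |x - u| ^ j * gaussianWeight (2 * κ) u h x) := by ring
    _ ≤ K * (ω h * (G₀ * gaussianWeight κ u h x) + G * ω h * gaussianWeight κ u h x) := by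
      gcongr K * (ω h * ?_ + ?_)
    _ = _ := by ring

theorem exists_norm_wkb_sub_wkb_le {κ u K M : ℝ} (hκ : 0 < κ) (hK : 0 ≤ K) (hM : 0 ≤ M)
    {φ q : ℝ → ℂ} {B : ℝ → ℝ → ℂ}
    (hdom : ∀ h x, ((φ x).re ≤ -(2 * κ * (x - u) ^ 2) ∧ (q x).re ≤ -(2 * κ * (x - u) ^ 2)
      ∧ ‖φ x - q x‖ ≤ M * |x - u| ^ 3) ∨ B h x = 0)
    (hB : ∀ h ∈ Set.Ioc (0 : ℝ) 1, ∀ x, ‖B h x‖ ≤ K) :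
    ∃ K' : ℝ, 0 ≤ K' ∧ ∀ h ∈ Set.Ioc (0 : ℝ) 1, ∀ x,
      ‖wkb φ (B h) h x - wkb q (B h) h x‖ ≤ K' * (√h * gaussianWeight κ u h x) := by
  obtain ⟨G, hG, hj⟩ := exists_pow_mul_gaussianWeight_le hκ u 3
  refine ⟨M * K * G, by positivity, fun h hh x => ?_⟩
  have hw := gaussianWeight_nonneg κ u hh.1 x
  rcases hdom h x with ⟨hφ, hq, hφq⟩ | h0
  swap
  · simp only [wkb, h0, mul_zero, sub_zero, norm_zero]
    positivity
  have hh0 := hh.1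
  have hre : ∀ w : ℂ, w.re ≤ -(2 * κ * (x - u) ^ 2) →
      ((h : ℂ)⁻¹ * w).re ≤ -(2 * κ * (x - u) ^ 2 / h) := by
    intro w hw
    rw [← Complex.ofReal_inv, Complex.re_ofReal_mul]
    calc h⁻¹ * w.re ≤ h⁻¹ * -(2 * κ * (x - u) ^ 2) := by gcongr
      _ = _ := by ring
  have hexp := norm_exp_sub_exp_le (hre _ hφ) (hre _ hq)
  rw [← mul_sub, norm_mul, norm_inv, Complex.norm_real, Real.norm_of_nonneg hh0.le] at hexp
  have hs : h⁻¹ * √h ^ 3 = √h := by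
    rw [pow_succ, Real.sq_sqrt hh0.le, inv_mul_cancel_left₀ hh0.ne']
  have hw4 : (0 : ℝ) < h ^ (-(1 : ℝ) / 4) := Real.rpow_pos_of_pos hh0 _
  calc ‖wkb φ (B h) h x - wkb q (B h) h x‖
      = h ^ (-(1 : ℝ) / 4) * (‖Complex.exp ((h : ℂ)⁻¹ * φ x) - Complex.exp ((h : ℂ)⁻¹ * q x)‖
          * ‖B h x‖) := by
        rw [wkb, wkb, ← mul_sub, ← sub_mul, norm_mul, norm_mul, Complex.norm_real,
          Real.norm_of_nonneg hw4.le]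
    _ ≤ h ^ (-(1 : ℝ) / 4) * ((Real.exp (-(2 * κ * (x - u) ^ 2 / h))
          * (h⁻¹ * (M * |x - u| ^ 3))) * K) := by
        gcongr
        · exact hexp.trans (by gcongr)
        · exact hB h hh x
    _ = M * K * h⁻¹ * (|x - u| ^ 3 * gaussianWeight (2 * κ) u h x) := by
        rw [gaussianWeight]
        ring
    _ ≤ M * K * h⁻¹ * (G * √h ^ 3 * gaussianWeight κ u h x) := by
        gcongr M * K * h⁻¹ * ?_
        exact hj h hh0 x
    _ = M * K * G * (h⁻¹ * √h ^ 3 * gaussianWeight κ u h x) := by ring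
    _ = _ := by rw [hs]

theorem wkb_momentum {φ B η : ℝ → ℂ} (hφ : ∀ x, HasDerivAt φ (Complex.I * η x) x)
    (hB : Differentiable ℝ B) {h : ℝ} (hh : h ≠ 0) (ξ : ℂ) (x : ℝ) :
    -Complex.I * (h : ℂ) * deriv (wkb φ B h) x - ξ * wkb φ B h x
      = wkb φ (fun x => (η x - ξ) * B x - Complex.I * h * deriv B x) h x := by
  rw [deriv_wkb hφ hB]
  have : (h : ℂ) ≠ 0 := by exact_mod_cast hh
  simp only [wkb]
  field_simp
  ring_nf
  simp only [Complex.I_sq]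
  ring

theorem wkb_operator {a b c φ B η : ℝ → ℂ} (hφ : ∀ x, HasDerivAt φ (Complex.I * η x) x)
    (hη : Differentiable ℝ η) (hB : ContDiff ℝ (⊤ : ℕ∞) B) {h : ℝ} (hh : h ≠ 0) (z : ℂ) (x : ℝ) :
    (-(h : ℂ) ^ 2 * a x * deriv (deriv (wkb φ B h)) x
        - Complex.I * (h : ℂ) * b x * deriv (wkb φ B h) x + c x * wkb φ B h x) - z * wkb φ B h x
      = wkb φ (fun x => (a x * η x ^ 2 + b x * η x + c x - z) * B x
          + (-Complex.I * h * ((2 * a x * η x + b x) * deriv B x + a x * deriv η x * B x)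
            - h ^ 2 * a x * deriv (deriv B) x)) h x := by
  have hB1 := contDiff_infty_iff_deriv.1 hB
  have hB2 := (contDiff_infty_iff_deriv.1 hB1.2).1
  have hd : ∀ x, HasDerivAt (fun x => (h : ℂ)⁻¹ * (Complex.I * η x) * B x + deriv B x)
      ((h : ℂ)⁻¹ * (Complex.I * deriv η x) * B x + (h : ℂ)⁻¹ * (Complex.I * η x) * deriv B x
        + deriv (deriv B) x) x := fun x =>
    (((((hη x).hasDerivAt.const_mul Complex.I).const_mul (h : ℂ)⁻¹).mul
      (hB1.1 x).hasDerivAt).add (hB2 x).hasDerivAt)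
  rw [deriv_wkb hφ hB1.1, deriv_wkb hφ fun x => (hd x).differentiableAt]
  have : (h : ℂ) ≠ 0 := by exact_mod_cast hh
  simp only [wkb, (hd x).deriv]
  field_simp
  ring_nf
  simp only [Complex.I_sq]
  ring

theorem exists_bound_power_sum {B : ℕ → ℝ → ℂ} (hc : ∀ m, Continuous (B m))
    (hs : ∀ m, HasCompactSupport (B m)) (N : ℕ) :
    ∃ K : ℝ, 0 ≤ K ∧ ∀ h ∈ Set.Ioc (0 : ℝ) 1, ∀ x,
      ‖∑ m ∈ Finset.range N, (h : ℂ) ^ m * B m x‖ ≤ K := by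
  choose K hK using fun m => (hs m).exists_bound_of_continuous (hc m)
  have hK0 : ∀ m, 0 ≤ K m := fun m => (norm_nonneg _).trans (hK m 0)
  refine ⟨∑ m ∈ Finset.range N, K m, Finset.sum_nonneg fun m _ => hK0 m, fun h hh x => ?_⟩
  refine norm_sum_le_of_le _ fun m _ => ?_
  rw [norm_mul, norm_pow, Complex.norm_real, Real.norm_of_nonneg hh.1.le]
  have := pow_le_one₀ (n := m) hh.1.le hh.2
  nlinarith [hK m x, norm_nonneg (B m x), pow_nonneg hh.1.le m]

theorem eventually_zero_of_lt_dist {u δ : ℝ} (χ : ContDiffBump u) (hχ : χ.rOut = δ) {x : ℝ}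
    (hx : δ < |x - u|) : ∀ᶠ y in 𝓝 x, χ y = 0 := by
  have : ∀ᶠ y in 𝓝 x, δ < |y - u| :=
    (continuous_abs.comp (continuous_id.sub continuous_const)).continuousAt.eventually_const_lt hx
  filter_upwards [this] with y hy
  exact χ.zero_of_le_dist (by rw [hχ, Real.dist_eq]; exact hy.le)

theorem deriv_power_sum {B : ℕ → ℝ → ℂ} (hB : ∀ m, Differentiable ℝ (B m)) (N : ℕ) (h : ℂ) :
    deriv (fun x => ∑ m ∈ Finset.range N, h ^ m * B m x)
      = fun x => ∑ m ∈ Finset.range N, h ^ m * deriv (B m) x := by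
  ext x
  rw [deriv_fun_sum fun m _ => ((hB m x).const_mul _)]
  exact Finset.sum_congr rfl fun m _ => deriv_const_mul _ (hB m x)

theorem exists_power_sum_sub_one_le {B : ℕ → ℝ → ℂ} (hB : ∀ m, ContDiff ℝ (⊤ : ℕ∞) (B m))
    (hs : ∀ m, HasCompactSupport (B m)) {u : ℝ} (h1 : B 0 u = 1) (n : ℕ) :
    ∃ K : ℝ, 0 ≤ K ∧ ∀ h ∈ Set.Ioc (0 : ℝ) 1, ∀ x,
      ‖∑ m ∈ Finset.range (n + 1), (h : ℂ) ^ m * B m x - 1‖ ≤ K * (√h + |x - u| ^ 1) := by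
  have hd := contDiff_infty_iff_deriv.1 (hB 0)
  obtain ⟨L, hL⟩ := (hs 0).deriv.exists_bound_of_continuous hd.2.continuous
  obtain ⟨K, hK0, hK⟩ := exists_bound_power_sum (fun m => (hB (m + 1)).continuous)
    (fun m => hs (m + 1)) n
  have hL0 : 0 ≤ L := (norm_nonneg _).trans (hL 0)
  refine ⟨K + L, by positivity, fun h hh x => ?_⟩
  have hlip : ‖B 0 x - 1‖ ≤ L * |x - u| := by
    have := convex_univ.norm_image_sub_le_of_norm_deriv_le (f := B 0) (x := u) (y := x)
      (fun y _ => hd.1 y) (fun y _ => hL y) trivial trivial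
    rwa [h1, Real.norm_eq_abs] at this
  have hh1 : h ≤ √h := Real.le_sqrt_of_sq_le (by nlinarith [hh.1, hh.2])
  have hsplit : ∑ m ∈ Finset.range (n + 1), (h : ℂ) ^ m * B m x - 1
      = (h : ℂ) * ∑ m ∈ Finset.range n, (h : ℂ) ^ m * B (m + 1) x + (B 0 x - 1) := by
    rw [Finset.sum_range_succ', Finset.mul_sum]
    simp only [pow_succ, pow_zero, one_mul]
    rw [add_sub_assoc]
    congr 1
    exact Finset.sum_congr rfl fun m _ => by ring
  rw [hsplit, pow_one]
  refine (norm_add_le _ _).trans ?_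
  rw [norm_mul, Complex.norm_real, Real.norm_of_nonneg hh.1.le]
  have hKh := hK h hh x
  have : h * ‖∑ m ∈ Finset.range n, (h : ℂ) ^ m * B (m + 1) x‖ ≤ √h * K := by gcongr
  nlinarith [mul_nonneg hK0 (abs_nonneg (x - u)), mul_nonneg hL0 (Real.sqrt_nonneg h)]

/-- The phase: a smooth local solution of the eikonal equation, tangent to second order to the
quadratic phase `iξ(x-u) + k(x-u)²/2`. -/
theorem exists_phase {a b c : ℝ → ℂ} (ha : ContDiff ℝ (⊤ : ℕ∞) a)
    (hb : ContDiff ℝ (⊤ : ℕ∞) b) (hc : ContDiff ℝ (⊤ : ℕ∞) c) (hell : ∀ x, a x ≠ 0)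
    (u : ℝ) (ξ : ℂ) (hQ : 2 * a u * ξ + b u ≠ 0) {k : ℂ}
    (hk : k = -Complex.I * (deriv a u * ξ ^ 2 + deriv b u * ξ + deriv c u)
      / (2 * a u * ξ + b u)) :
    ∃ φ η : ℝ → ℂ, ContDiff ℝ (⊤ : ℕ∞) φ ∧ ContDiff ℝ (⊤ : ℕ∞) η ∧
      (∀ x, HasDerivAt φ (Complex.I * η x) x) ∧ (∀ x, 2 * a x * η x + b x ≠ 0) ∧ η u = ξ ∧
      (∀ᶠ x in 𝓝 u, a x * η x ^ 2 + b x * η x + c x = a u * ξ ^ 2 + b u * ξ + c u) ∧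
      ∃ M : ℝ, 0 ≤ M ∧ ∀ x, |x - u| ≤ 1 →
        ‖φ x - (Complex.I * ξ * (x - u) + k * (x - u) ^ 2 / 2)‖ ≤ M * |x - u| ^ 3 := by
  obtain ⟨η, hη, hr, hηu, heik⟩ := exists_eikonal_solution ha hb hc hell u ξ hQ
  obtain ⟨φ, hφ, hφu, hφd⟩ := exists_smooth_primitive
    ((contDiff_const (c := Complex.I)).mul hη) u
  have hηd := (contDiff_infty_iff_deriv.1 hη).1
  have hd1 : deriv φ = fun x => Complex.I * η x := funext fun x => (hφd x).deriv
  have hη' : deriv a u * ξ ^ 2 + deriv b u * ξ + deriv c u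
      + (2 * a u * ξ + b u) * deriv η u = 0 := by
    have had := ((contDiff_infty_iff_deriv.1 ha).1 u).hasDerivAt
    have hbd := ((contDiff_infty_iff_deriv.1 hb).1 u).hasDerivAt
    have hcd := ((contDiff_infty_iff_deriv.1 hc).1 u).hasDerivAt
    have hd := ((had.mul ((hηd u).hasDerivAt.pow 2)).add (hbd.mul (hηd u).hasDerivAt)).add hcd
    have h0 := hd.unique ((hasDerivAt_const u (a u * ξ ^ 2 + b u * ξ + c u)).congr_of_eventuallyEq
      heik)
    simp only [Pi.pow_apply, hηu] at h0
    push_cast at h0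
    linear_combination h0
  have hd2 : deriv (deriv φ) u = k := by
    rw [hd1, deriv_const_mul _ (hηd u), hk, eq_div_iff hQ]
    linear_combination Complex.I * hη'
  obtain ⟨M, hM, hMb⟩ := exists_cubic_taylor_bound hφ u hφu
  rw [hd2, (hφd u).deriv, hηu] at hMb
  exact ⟨φ, η, hφ, hη, hφd, hr, hηu, heik, M, hM, hMb⟩

theorem exists_pseudoeigenfunction_pointwise {a b c : ℝ → ℂ} (ha : ContDiff ℝ (⊤ : ℕ∞) a)
    (hb : ContDiff ℝ (⊤ : ℕ∞) b) (hc : ContDiff ℝ (⊤ : ℕ∞) c) (hell : ∀ x, a x ≠ 0)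
    (u : ℝ) (ξ : ℝ) (hQ : 2 * a u * (ξ : ℂ) + b u ≠ 0) {k : ℂ}
    (hk : k = -Complex.I * (deriv a u * (ξ : ℂ) ^ 2 + deriv b u * (ξ : ℂ) + deriv c u)
      / (2 * a u * (ξ : ℂ) + b u)) (hkre : k.re < 0) (n : ℕ) :
    ∃ κ > (0 : ℝ), ∃ K : ℝ, 0 ≤ K ∧ ∃ f : ℝ → ℝ → ℂ, ∀ h ∈ Set.Ioc (0 : ℝ) 1,
      ContDiff ℝ (⊤ : ℕ∞) (f h) ∧ HasCompactSupport (f h) ∧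
      (∀ x : ℝ, ‖(x : ℂ) * f h x - (u : ℂ) * f h x‖ ≤ K * (√h * gaussianWeight κ u h x)) ∧
      (∀ x : ℝ, ‖-Complex.I * (h : ℂ) * deriv (f h) x - (ξ : ℂ) * f h x‖
        ≤ K * (√h * gaussianWeight κ u h x)) ∧
      (∀ x : ℝ, ‖(-(h : ℂ) ^ 2 * a x * deriv (deriv (f h)) x
          - Complex.I * (h : ℂ) * b x * deriv (f h) x + c x * f h x)
          - (a u * (ξ : ℂ) ^ 2 + b u * (ξ : ℂ) + c u) * f h x‖
        ≤ K * (h ^ (n + 2) * gaussianWeight κ u h x)) ∧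
      ∀ x : ℝ, ‖f h x - ((h ^ (-(1 : ℝ) / 4) : ℝ) : ℂ) * Complex.exp ((h : ℂ)⁻¹ *
          (Complex.I * (ξ : ℂ) * ((x : ℂ) - (u : ℂ)) + k * ((x : ℂ) - (u : ℂ)) ^ 2 / 2))‖
        ≤ K * (√h * gaussianWeight κ u h x) := by
  obtain ⟨φ, η, hφ, hη, hφd, hr0, hηu, heik, M, hM, hMb⟩ :=
    exists_phase ha hb hc hell u ξ hQ hk
  have hη1 := contDiff_infty_iff_deriv.1 hη
  set z := a u * (ξ : ℂ) ^ 2 + b u * (ξ : ℂ) + c u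
  let q : ℝ → ℂ := fun x => Complex.I * ξ * (x - u) + k * (x - u) ^ 2 / 2
  have hqre : ∀ x, (q x).re = k.re * (x - u) ^ 2 / 2 := fun x => by
    have : q x = ((ξ * (x - u) : ℝ) : ℂ) * Complex.I + (((x - u) ^ 2 / 2 : ℝ) : ℂ) * k := by
      simp only [q]
      push_cast
      ring
    rw [this, Complex.add_re, Complex.re_ofReal_mul, Complex.re_ofReal_mul, Complex.I_re]
    ring
  set κ := -k.re / 8 with hκdef
  have hκ : 0 < κ := by rw [hκdef]; linarith
  have hq : ∀ x, (q x).re ≤ -(2 * κ * (x - u) ^ 2) := fun x => by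
    rw [hqre, hκdef]
    nlinarith [sq_nonneg (x - u)]
  obtain ⟨ρ, hρ, hρeik⟩ := Metric.eventually_nhds_iff.1 heik
  obtain ⟨δ, hδ, hδρ, hδ1, hδM⟩ : ∃ δ > 0, δ < ρ ∧ δ ≤ 1 ∧ M * δ ≤ 2 * κ := by
    refine ⟨min (ρ / 2) (min 1 (2 * κ / (M + 1))), by positivity, ?_, ?_, ?_⟩
    · exact (min_le_left _ _).trans_lt (by linarith)
    · exact (min_le_right _ _).trans (min_le_left _ _)
    · have h1 : min (ρ / 2) (min 1 (2 * κ / (M + 1))) ≤ 2 * κ / (M + 1) :=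
        (min_le_right _ _).trans (min_le_right _ _)
      calc _ ≤ (M + 1) * (2 * κ / (M + 1)) := by gcongr; linarith
        _ = 2 * κ := by field_simp
  have hφre : ∀ x, |x - u| ≤ δ → (φ x).re ≤ -(2 * κ * (x - u) ^ 2) := fun x hx => by
    have h1 := (Complex.re_le_norm _).trans (hMb x (hx.trans hδ1))
    have h2 : M * |x - u| ^ 3 ≤ 2 * κ * (x - u) ^ 2 := by
      calc M * |x - u| ^ 3 = M * |x - u| * (x - u) ^ 2 := by rw [← sq_abs (x - u)]; ring
        _ ≤ M * δ * (x - u) ^ 2 := by gcongr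
        _ ≤ _ := by gcongr
    have h3 : (φ x - q x).re ≤ M * |x - u| ^ 3 := h1
    rw [Complex.sub_re, hqre] at h3
    rw [hκdef] at h2 ⊢
    linarith
  let r : ℝ → ℂ := fun x => 2 * a x * η x + b x
  let e : ℝ → ℂ := fun x => a x * deriv η x
  have hr : ContDiff ℝ (⊤ : ℕ∞) r := ((contDiff_const.mul ha).mul hη).add hb
  have he : ContDiff ℝ (⊤ : ℕ∞) e := ha.mul hη1.2
  obtain ⟨A, hA, hAu, hA0, hAs⟩ := exists_transport_sequence ha hr he hr0 u
  let χ : ContDiffBump u := ⟨δ / 2, δ, by positivity, by linarith⟩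
  let B : ℕ → ℝ → ℂ := fun m x => (χ x : ℂ) * A m x
  have hχs : ContDiff ℝ (⊤ : ℕ∞) (fun x => (χ x : ℂ)) :=
    Complex.ofRealCLM.contDiff.comp χ.contDiff
  have hχc : HasCompactSupport (fun x => (χ x : ℂ)) :=
    χ.hasCompactSupport.comp_left (g := fun y : ℝ => (y : ℂ)) Complex.ofReal_zero
  have hB : ∀ m, ContDiff ℝ (⊤ : ℕ∞) (B m) := fun m => hχs.mul (hA m)
  have hBc : ∀ m, HasCompactSupport (B m) := fun m => hχc.mul_right
  have hB1 := fun m => contDiff_infty_iff_deriv.1 (hB m)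
  have hB2 := fun m => contDiff_infty_iff_deriv.1 (hB1 m).2
  have hBc1 : ∀ m, HasCompactSupport (deriv (B m)) := fun m => (hBc m).deriv
  have hBc2 : ∀ m, HasCompactSupport (deriv (deriv (B m))) := fun m => (hBc1 m).deriv
  have hBnhds : ∀ m x, δ < |x - u| → B m =ᶠ[𝓝 x] fun _ => 0 := fun m x hx => by
    filter_upwards [eventually_zero_of_lt_dist χ rfl hx] with y hy
    simp [B, hy]
  let Bh : ℝ → ℝ → ℂ := fun h x => ∑ m ∈ Finset.range (n + 1), (h : ℂ) ^ m * B m x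
  have hBhs : ∀ h, ContDiff ℝ (⊤ : ℕ∞) (Bh h) := fun h =>
    ContDiff.sum fun m _ => contDiff_const.mul (hB m)
  have hBh0 : ∀ h x, δ < |x - u| → Bh h x = 0 := fun h x hx =>
    Finset.sum_eq_zero fun m _ => by rw [(hBnhds m x hx).eq_of_nhds, mul_zero]
  have hBhc : ∀ h, HasCompactSupport (Bh h) := fun h =>
    HasCompactSupport.intro (isCompact_closedBall u δ) fun x hx => hBh0 h x (by
      simpa [Real.dist_eq] using hx)
  have hBh1 : ∀ h, deriv (Bh h)
      = fun x => ∑ m ∈ Finset.range (n + 1), (h : ℂ) ^ m * deriv (B m) x := fun h =>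
    deriv_power_sum (fun m => (hB1 m).1) _ _
  have hBh2 : ∀ h, deriv (deriv (Bh h))
      = fun x => ∑ m ∈ Finset.range (n + 1), (h : ℂ) ^ m * deriv (deriv (B m)) x := fun h => by
    rw [hBh1, deriv_power_sum (fun m => (hB2 m).1)]
  have hBh1z : ∀ h x, δ < |x - u| → deriv (Bh h) x = 0 := fun h x hx => by
    rw [hBh1]
    exact Finset.sum_eq_zero fun m _ => by rw [(hBnhds m x hx).deriv_eq]; simp
  have hBh2z : ∀ h x, δ < |x - u| → deriv (deriv (Bh h)) x = 0 := fun h x hx => by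
    rw [hBh2]
    exact Finset.sum_eq_zero fun m _ => by rw [(hBnhds m x hx).deriv.deriv_eq]; simp
  obtain ⟨K₀, hK₀, hBhK⟩ := exists_bound_power_sum (fun m => (hB m).continuous) hBc (n + 1)
  obtain ⟨K₁, hK₁, hBhK1⟩ := exists_bound_power_sum (fun m => (hB1 m).2.continuous) hBc1 (n + 1)
  have hsqrt : ∀ h ∈ Set.Ioc (0 : ℝ) 1, h ≤ √h := fun h hh =>
    Real.le_sqrt_of_sq_le (by nlinarith [hh.1, hh.2])
  have hsqrt1 : ∀ h ∈ Set.Ioc (0 : ℝ) 1, √h ^ 1 ≤ √h := fun h _ => (pow_one _).le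
  have hposition : ∃ K : ℝ, 0 ≤ K ∧ ∀ h ∈ Set.Ioc (0 : ℝ) 1, ∀ x,
      ‖wkb φ (fun x => ((x : ℂ) - u) * Bh h x) h x‖ ≤ K * (√h * gaussianWeight κ u h x) := by
    refine exists_norm_wkb_le hκ hK₀ (j := 1) hsqrt1 (fun h x => ?_) (fun h hh x => ?_)
    · rcases le_or_gt |x - u| δ with hx | hx
      · exact .inl (hφre x hx)
      · exact .inr (by simp [hBh0 h x hx])
    · rw [norm_mul, ← Complex.ofReal_sub, Complex.norm_real, Real.norm_eq_abs, pow_one]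
      have := hBhK h hh x
      calc |x - u| * ‖Bh h x‖ ≤ |x - u| * K₀ := by gcongr
        _ ≤ _ := by nlinarith [mul_nonneg hK₀ (Real.sqrt_nonneg h)]
  have hmomentum : ∃ K : ℝ, 0 ≤ K ∧ ∀ h ∈ Set.Ioc (0 : ℝ) 1, ∀ x,
      ‖wkb φ (fun x => (η x - ξ) * Bh h x - Complex.I * h * deriv (Bh h) x) h x‖
        ≤ K * (√h * gaussianWeight κ u h x) := by
    obtain ⟨L, hL⟩ := (isCompact_closedBall u 1).exists_bound_of_continuousOn
      hη1.2.continuous.continuousOn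
    have hL0 : 0 ≤ L := (norm_nonneg _).trans (hL u (by simp))
    have hlip : ∀ x, |x - u| ≤ 1 → ‖η x - ξ‖ ≤ L * |x - u| ^ 1 :=
      norm_le_pow_succ_of_norm_deriv_le_pow (g := fun x => η x - ξ) (j := 0) hL0
        (fun x => (hη1.1 x).hasDerivAt.sub_const _) (by simp [hηu])
        fun x hx => by simpa using hL x (by simpa [Real.dist_eq] using hx)
    refine exists_norm_wkb_le hκ (K := L * K₀ + K₁) (by positivity) (j := 1) hsqrt1
      (fun h x => ?_) (fun h hh x => ?_)
    · rcases le_or_gt |x - u| δ with hx | hx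
      · exact .inl (hφre x hx)
      · exact .inr (by simp [hBh0 h x hx, hBh1z h x hx])
    · rcases le_or_gt |x - u| δ with hx | hx
      swap
      · simp only [hBh0 h x hx, hBh1z h x hx, mul_zero, sub_zero, norm_zero]
        positivity
      have h1 := hlip x (hx.trans hδ1)
      have h2 := hBhK h hh x
      have h3 := hBhK1 h hh x
      have h4 := hsqrt h hh
      have hh0 := hh.1.le
      calc _ ≤ ‖η x - ξ‖ * ‖Bh h x‖ + h * ‖deriv (Bh h) x‖ := by
            refine (norm_sub_le _ _).trans_eq ?_
            simp [Real.norm_of_nonneg hh0]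
        _ ≤ L * |x - u| ^ 1 * K₀ + √h * K₁ := by
            rw [hBh1]
            gcongr
        _ ≤ _ := by
            have := mul_nonneg (mul_nonneg hL0 hK₀) (Real.sqrt_nonneg h)
            have := mul_nonneg hK₁ (pow_nonneg (abs_nonneg (x - u)) 1)
            linarith
  have hoperator : ∃ K : ℝ, 0 ≤ K ∧ ∀ h ∈ Set.Ioc (0 : ℝ) 1, ∀ x,
      ‖wkb φ (fun x => (a x * η x ^ 2 + b x * η x + c x - z) * Bh h x
          + (-Complex.I * h * ((2 * a x * η x + b x) * deriv (Bh h) x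
            + a x * deriv η x * Bh h x) - h ^ 2 * a x * deriv (deriv (Bh h)) x)) h x‖
        ≤ K * (h ^ (n + 2) * gaussianWeight κ u h x) := by
    obtain ⟨K₂, hK₂, hb₂⟩ := exists_bound_power_sum
      (B := fun m x => r x * deriv (B m) x + e x * B m x)
      (fun m => (hr.continuous.mul (hB1 m).2.continuous).add
        (he.continuous.mul (hB m).continuous))
      (fun m => (hBc1 m).mul_left.add (hBc m).mul_left) (n + 1)
    obtain ⟨K₃, hK₃, hb₃⟩ := exists_bound_power_sum
      (B := fun m x => a x * deriv (deriv (B m)) x)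
      (fun m => ha.continuous.mul (hB2 m).2.continuous)
      (fun m => (hBc2 m).mul_left) (n + 1)
    obtain ⟨K₄, hK₄⟩ := ((hBc2 n).mul_left (f := a)).exists_bound_of_continuous
      (ha.continuous.mul (hB2 n).2.continuous)
    have hK₄0 : 0 ≤ K₄ := (norm_nonneg _).trans (hK₄ u)
    refine exists_norm_wkb_le hκ
      (K := K₄ + (K₂ + K₃) / (δ / 2) ^ (2 * (n + 2))) (by positivity) (j := 2 * (n + 2))
      (ω := fun h => h ^ (n + 2))
      (fun h hh => by rw [pow_mul, Real.sq_sqrt hh.1.le]) (fun h x => ?_) (fun h hh x => ?_)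
    · rcases le_or_gt |x - u| δ with hx | hx
      · exact .inl (hφre x hx)
      · exact .inr (by simp [hBh0 h x hx, hBh1z h x hx, hBh2z h x hx])
    have hh0 := hh.1.le
    have hfirst : (a x * η x ^ 2 + b x * η x + c x - z) * Bh h x = 0 := by
      rcases le_or_gt |x - u| δ with hx | hx
      · rw [hρeik (by rw [Real.dist_eq]; exact hx.trans_lt hδρ), sub_self, zero_mul]
      · rw [hBh0 h x hx, mul_zero]
    have hsum : -Complex.I * h * ((2 * a x * η x + b x) * deriv (Bh h) x
        + a x * deriv η x * Bh h x) - h ^ 2 * a x * deriv (deriv (Bh h)) x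
        = -Complex.I * h * ∑ m ∈ Finset.range (n + 1),
            (h : ℂ) ^ m * (r x * deriv (B m) x + e x * B m x)
          - h ^ 2 * ∑ m ∈ Finset.range (n + 1), (h : ℂ) ^ m * (a x * deriv (deriv (B m)) x) := by
      rw [hBh2, hBh1, mul_assoc ((h : ℂ) ^ 2)]
      simp only [Bh, Finset.mul_sum, mul_add, Finset.sum_add_distrib, r, e]
      congr 1
      · congr 1 <;> exact Finset.sum_congr rfl fun m _ => by ring
      · exact Finset.sum_congr rfl fun m _ => by ring
    rw [hfirst, zero_add, hsum]
    rcases lt_or_ge |x - u| (δ / 2) with hx | hx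
    · have hBA : ∀ m, B m =ᶠ[𝓝 x] A m := fun m => by
        filter_upwards [χ.eventuallyEq_one_of_mem_ball
          (by rw [Metric.mem_ball, Real.dist_eq]; exact hx)] with y hy
        simp [B, hy]
      have htel := transport_sum_telescope (a := a) hA0 hAs n h x
      have hrem : -Complex.I * h * ∑ m ∈ Finset.range (n + 1),
            (h : ℂ) ^ m * (r x * deriv (B m) x + e x * B m x)
          - h ^ 2 * ∑ m ∈ Finset.range (n + 1), (h : ℂ) ^ m * (a x * deriv (deriv (B m)) x)
          = -((h : ℂ) ^ (n + 2) * (a x * deriv (deriv (B n)) x)) := by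
        simp only [(hBA _).eq_of_nhds, (hBA _).deriv_eq, (hBA _).deriv.deriv_eq]
        rw [← mul_assoc, ← htel, Finset.mul_sum, Finset.mul_sum, ← Finset.sum_sub_distrib]
        exact Finset.sum_congr rfl fun m _ => by ring
      rw [hrem, norm_neg, norm_mul, norm_pow, Complex.norm_real, Real.norm_of_nonneg hh0]
      have h4 : ‖a x * deriv (deriv (B n)) x‖ ≤ K₄ := hK₄ x
      calc h ^ (n + 2) * ‖a x * deriv (deriv (B n)) x‖ ≤ h ^ (n + 2) * K₄ := by gcongr
        _ = K₄ * (h ^ (n + 2) + 0) := by ring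
        _ ≤ _ := by
            gcongr
            · exact le_add_of_nonneg_right (by positivity)
            · positivity
    · have h2 := hb₂ h hh x
      have h3 := hb₃ h hh x
      have hpow : (K₂ + K₃) ≤ (K₂ + K₃) / (δ / 2) ^ (2 * (n + 2)) * |x - u| ^ (2 * (n + 2)) := by
        rw [div_mul_eq_mul_div, le_div_iff₀ (by positivity)]
        gcongr
      calc _ ≤ h * ‖∑ m ∈ Finset.range (n + 1),
              (h : ℂ) ^ m * (r x * deriv (B m) x + e x * B m x)‖
            + h ^ 2 * ‖∑ m ∈ Finset.range (n + 1),
              (h : ℂ) ^ m * (a x * deriv (deriv (B m)) x)‖ := by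
            refine (norm_sub_le _ _).trans_eq ?_
            rw [norm_mul, norm_mul, norm_mul, norm_neg, Complex.norm_I, one_mul, norm_pow,
              Complex.norm_real, Real.norm_of_nonneg hh0]
        _ ≤ 1 * K₂ + 1 * K₃ := by
            gcongr
            · exact hh.2
            · exact pow_le_one₀ hh0 hh.2
        _ ≤ (K₂ + K₃) / (δ / 2) ^ (2 * (n + 2)) * |x - u| ^ (2 * (n + 2)) := by linarith
        _ ≤ _ := by
            gcongr
            · exact le_add_of_nonneg_left hK₄0
            · exact le_add_of_nonneg_left (by positivity)
  have hdiff : ∃ K : ℝ, 0 ≤ K ∧ ∀ h ∈ Set.Ioc (0 : ℝ) 1, ∀ x,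
      ‖wkb φ (Bh h) h x - wkb q (Bh h) h x‖ ≤ K * (√h * gaussianWeight κ u h x) := by
    refine exists_norm_wkb_sub_wkb_le hκ hK₀ hM (fun h x => ?_) hBhK
    rcases le_or_gt |x - u| δ with hx | hx
    · exact .inl ⟨hφre x hx, hq x, hMb x (hx.trans hδ1)⟩
    · exact .inr (hBh0 h x hx)
  have hamp : ∃ K : ℝ, 0 ≤ K ∧ ∀ h ∈ Set.Ioc (0 : ℝ) 1, ∀ x,
      ‖wkb q (fun x => Bh h x - 1) h x‖ ≤ K * (√h * gaussianWeight κ u h x) := by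
    have hBu : B 0 u = 1 := by simp [B, hAu, χ.eventuallyEq_one.eq_of_nhds]
    obtain ⟨K, hK, hKb⟩ := exists_power_sum_sub_one_le hB hBc hBu n
    exact exists_norm_wkb_le hκ hK (j := 1) hsqrt1 (fun h x => .inl (hq x)) hKb
  obtain ⟨C₁, hC₁, hpos⟩ := hposition
  obtain ⟨C₂, hC₂, hmom⟩ := hmomentum
  obtain ⟨C₃, hC₃, hop⟩ := hoperator
  obtain ⟨C₄, hC₄, hdif⟩ := hdiff
  obtain ⟨C₅, hC₅, ham⟩ := hamp
  refine ⟨κ, hκ, C₁ + C₂ + C₃ + (C₄ + C₅), by positivity, fun h => wkb φ (Bh h) h,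
    fun h hh => ⟨contDiff_wkb hφ (hBhs h) h, hasCompactSupport_wkb φ (hBhc h) h,
      fun x => ?_, fun x => ?_, fun x => ?_, fun x => ?_⟩⟩
  all_goals have hw := gaussianWeight_nonneg κ u hh.1 x
  all_goals have hh0 := hh.1
  · have : (x : ℂ) * wkb φ (Bh h) h x - u * wkb φ (Bh h) h x
        = wkb φ (fun x => ((x : ℂ) - u) * Bh h x) h x := by
      simp only [wkb]
      ring
    rw [this]
    exact (hpos h hh x).trans (by gcongr; linarith)
  · rw [wkb_momentum hφd (contDiff_infty_iff_deriv.1 (hBhs h)).1 hh0.ne']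
    exact (hmom h hh x).trans (by gcongr; linarith)
  · rw [wkb_operator hφd hη1.1 (hBhs h) hh0.ne']
    exact (hop h hh x).trans (by gcongr; linarith)
  · have : wkb φ (Bh h) h x - ((h ^ (-(1 : ℝ) / 4) : ℝ) : ℂ) * Complex.exp ((h : ℂ)⁻¹ * q x)
        = (wkb φ (Bh h) h x - wkb q (Bh h) h x) + wkb q (fun x => Bh h x - 1) h x := by
      simp only [wkb]
      ring
    refine (congrArg norm this).trans_le ((norm_add_le _ _).trans ?_)
    calc _ ≤ C₄ * (√h * gaussianWeight κ u h x) + C₅ * (√h * gaussianWeight κ u h x) :=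
          add_le_add (hdif h hh x) (ham h hh x)
      _ = (C₄ + C₅) * (√h * gaussianWeight κ u h x) := by ring
      _ ≤ _ := by
          gcongr ?_ * (√h * gaussianWeight κ u h x)
          exact le_add_of_nonneg_left (by positivity)

theorem tendsto_eLpNorm_of_eLpNorm_sub_le {f g : ℝ → ℝ → ℂ} {C G : ℝ} (hG : 0 ≤ G)
    (hf : ∀ h ∈ Set.Ioc (0 : ℝ) 1, AEStronglyMeasurable (f h) volume)
    (hg : ∀ h ∈ Set.Ioc (0 : ℝ) 1, AEStronglyMeasurable (g h) volume)
    (hgn : ∀ h ∈ Set.Ioc (0 : ℝ) 1, eLpNorm (g h) 2 volume = ENNReal.ofReal G)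
    (hC : 0 ≤ C)
    (hfg : ∀ h ∈ Set.Ioc (0 : ℝ) 1, eLpNorm (f h - g h) 2 volume ≤ ENNReal.ofReal (C * √h)) :
    Filter.Tendsto (fun h => (eLpNorm (f h) 2 volume).toReal) (𝓝[>] 0) (𝓝 G) := by
  have hsmall : Filter.Tendsto (fun h : ℝ => C * √h) (𝓝[>] 0) (𝓝 0) := by
    have : Filter.Tendsto (fun h : ℝ => C * √h) (𝓝 0) (𝓝 (C * √0)) :=
      (continuous_const.mul Real.continuous_sqrt).tendsto 0
    simp only [Real.sqrt_zero, mul_zero] at this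
    exact this.mono_left nhdsWithin_le_nhds
  have hev : ∀ᶠ h in 𝓝[>] (0 : ℝ), h ∈ Set.Ioc (0 : ℝ) 1 := Ioc_mem_nhdsGT one_pos
  have hlow : Filter.Tendsto (fun h : ℝ => G - C * √h) (𝓝[>] 0) (𝓝 G) := by
    simpa using hsmall.const_sub G
  have hupp : Filter.Tendsto (fun h : ℝ => G + C * √h) (𝓝[>] 0) (𝓝 G) := by
    simpa using hsmall.const_add G
  have hle : ∀ h ∈ Set.Ioc (0 : ℝ) 1, eLpNorm (f h) 2 volume ≤ ENNReal.ofReal (G + C * √h) := by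
    intro h hh
    have h1 := eLpNorm_add_le ((hf h hh).sub (hg h hh)) (hg h hh) (p := 2) (by norm_num)
    rw [sub_add_cancel, hgn h hh] at h1
    rw [ENNReal.ofReal_add hG (by positivity), add_comm]
    exact h1.trans (by gcongr; exact hfg h hh)
  refine tendsto_of_tendsto_of_tendsto_of_le_of_le' hlow hupp ?_ ?_
  · filter_upwards [hev] with h hh
    have hfin : eLpNorm (f h) 2 volume ≠ ∞ := ne_top_of_le_ne_top ENNReal.ofReal_ne_top (hle h hh)
    have h1 := eLpNorm_sub_le (hf h hh) ((hf h hh).sub (hg h hh)) (p := 2) (by norm_num)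
    rw [sub_sub_cancel, hgn h hh] at h1
    have h2 : ENNReal.ofReal G
        ≤ ENNReal.ofReal ((eLpNorm (f h) 2 volume).toReal + C * √h) := by
      rw [ENNReal.ofReal_add ENNReal.toReal_nonneg (by positivity), ENNReal.ofReal_toReal hfin]
      exact h1.trans (by gcongr; exact hfg h hh)
    have := (ENNReal.ofReal_le_ofReal_iff (by positivity)).1 h2
    linarith
  · filter_upwards [hev] with h hh
    exact ENNReal.toReal_le_of_le_ofReal (by positivity) (hle h hh)

/-- Lemma 8 combined with Theorem 7: the interior pseudo-eigenfunctions `f_h` can in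
addition be approximated, with error `O(h^{1/2})` in `L²`, by the Gaussian
`g_h(u+s) = h^{-1/4} exp{h^{-1}(iξs + ks²/2)}` where
`k = -i (∂σ/∂u)/(∂σ/∂ξ)` has negative real part. -/
theorem interior_pseudoeigenfunctions_gaussian_approx
    (a b c : ℝ → ℂ) (ha : ContDiff ℝ (⊤ : ℕ∞) a) (hb : ContDiff ℝ (⊤ : ℕ∞) b) (hc : ContDiff ℝ (⊤ : ℕ∞) c)
    (hell : ∀ x : ℝ, a x ≠ 0)
    (u ξ : ℝ)
    (hbracket :
      0 < (deriv a u * (ξ:ℂ)^2 + deriv b u * (ξ:ℂ) + deriv c u).re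
            * (2 * a u * (ξ:ℂ) + b u).im
          - (2 * a u * (ξ:ℂ) + b u).re
            * (deriv a u * (ξ:ℂ)^2 + deriv b u * (ξ:ℂ) + deriv c u).im)
    (k : ℂ)
    (hk : k = -Complex.I * (deriv a u * (ξ:ℂ)^2 + deriv b u * (ξ:ℂ) + deriv c u)
            / (2 * a u * (ξ:ℂ) + b u)) :
    k.re < 0 ∧
    ∀ n : ℕ, 0 < n →
    ∃ c₀ > (0:ℝ), ∃ C > (0:ℝ), ∃ f : ℝ → ℝ → ℂ,
      Filter.Tendsto (fun h => (eLpNorm (f h) 2 volume).toReal) (𝓝[>] 0) (𝓝 c₀) ∧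
      ∀ h ∈ Set.Ioc (0:ℝ) 1,
        ContDiff ℝ (⊤ : ℕ∞) (f h) ∧ HasCompactSupport (f h) ∧
        eLpNorm (fun x : ℝ => (x:ℂ) * f h x - (u:ℂ) * f h x) 2 volume
          ≤ ENNReal.ofReal (C * h ^ ((1:ℝ)/2)) ∧
        eLpNorm (fun x : ℝ => -Complex.I * (h:ℂ) * deriv (f h) x - (ξ:ℂ) * f h x) 2 volume
          ≤ ENNReal.ofReal (C * h ^ ((1:ℝ)/2)) ∧
        eLpNorm (fun x : ℝ =>
            (-(h:ℂ)^2 * a x * deriv (deriv (f h)) x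
              - Complex.I * (h:ℂ) * b x * deriv (f h) x + c x * f h x)
            - (a u * (ξ:ℂ)^2 + b u * (ξ:ℂ) + c u) * f h x) 2 volume
          ≤ ENNReal.ofReal (C * h ^ (n + 2 : ℕ)) ∧
        eLpNorm (fun x : ℝ =>
            f h x - ((h ^ (-(1:ℝ)/4) : ℝ) : ℂ) *
              Complex.exp ((h:ℂ)⁻¹ *
                (Complex.I * (ξ:ℂ) * ((x:ℂ) - (u:ℂ)) + k * ((x:ℂ) - (u:ℂ))^2 / 2))) 2 volume
          ≤ ENNReal.ofReal (C * h ^ ((1:ℝ)/2)) := by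
  set P := deriv a u * (ξ : ℂ) ^ 2 + deriv b u * (ξ : ℂ) + deriv c u with hP
  set Q := 2 * a u * (ξ : ℂ) + b u with hQdef
  have hQ : Q ≠ 0 := by
    intro h0
    simp [h0] at hbracket
  have hkre : k.re < 0 := by
    have hN : 0 < Complex.normSq Q := Complex.normSq_pos.2 hQ
    have : k.re = -(P.re * Q.im - Q.re * P.im) / Complex.normSq Q := by
      rw [hk, Complex.div_re]
      simp only [Complex.neg_re, Complex.neg_im, Complex.mul_re, Complex.mul_im, Complex.I_re,
        Complex.I_im]
      ring
    rw [this]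
    exact div_neg_of_neg_of_pos (by linarith) hN
  refine ⟨hkre, fun n _ => ?_⟩
  obtain ⟨κ, hκ, K, hK, f, hf⟩ :=
    exists_pseudoeigenfunction_pointwise ha hb hc hell u ξ hQ hk hkre n
  set G := (Real.pi / (2 * κ)) ^ ((1 : ℝ) / 4) with hG
  have hG0 : 0 < G := by positivity
  have hL2 : ∀ (F : ℝ → ℂ) (w h : ℝ), 0 < h → 0 ≤ w →
      (∀ x, ‖F x‖ ≤ K * (w * gaussianWeight κ u h x)) →
      eLpNorm F 2 volume ≤ ENNReal.ofReal ((K + 1) * G * w) := by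
    intro F w h hh hw hF
    refine (eLpNorm_le_of_norm_le_gaussianWeight hκ (u := u) hh (mul_nonneg hK hw)
      fun x => (hF x).trans_eq (mul_assoc _ _ _).symm).trans (ENNReal.ofReal_le_ofReal ?_)
    rw [← hG]
    nlinarith [mul_nonneg hG0.le hw]
  let g : ℝ → ℝ → ℂ := fun h x => ((h ^ (-(1 : ℝ) / 4) : ℝ) : ℂ) *
    Complex.exp ((h : ℂ)⁻¹ *
      (Complex.I * (ξ : ℂ) * ((x : ℂ) - (u : ℂ)) + k * ((x : ℂ) - (u : ℂ)) ^ 2 / 2))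
  have hgnorm : ∀ h ∈ Set.Ioc (0 : ℝ) 1, eLpNorm (g h) 2 volume
      = ENNReal.ofReal ((Real.pi / (2 * (-k.re / 2))) ^ ((1 : ℝ) / 4)) := by
    intro h hh
    rw [← eLpNorm_gaussianWeight (by linarith) u hh.1]
    refine eLpNorm_congr_norm_ae (.of_forall fun x => ?_)
    have hw : (0 : ℝ) < h ^ (-(1 : ℝ) / 4) := Real.rpow_pos_of_pos hh.1 _
    have hphase : (h : ℂ)⁻¹ * (Complex.I * (ξ : ℂ) * ((x : ℂ) - (u : ℂ))
          + k * ((x : ℂ) - (u : ℂ)) ^ 2 / 2)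
        = ((h⁻¹ * ξ * (x - u) : ℝ) : ℂ) * Complex.I
          + ((h⁻¹ * (x - u) ^ 2 / 2 : ℝ) : ℂ) * k := by
      push_cast
      ring
    simp only [g]
    rw [Real.norm_of_nonneg (gaussianWeight_nonneg _ _ hh.1 _), gaussianWeight, norm_mul,
      Complex.norm_real, Real.norm_of_nonneg hw.le, Complex.norm_exp, hphase, Complex.add_re,
      Complex.re_ofReal_mul, Complex.re_ofReal_mul, Complex.I_re]
    congr 2
    ring
  have hgauss : ∀ h ∈ Set.Ioc (0 : ℝ) 1,
      eLpNorm (f h - g h) 2 volume ≤ ENNReal.ofReal ((K + 1) * G * √h) := fun h hh =>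
    hL2 _ _ h hh.1 (Real.sqrt_nonneg h) (hf h hh).2.2.2.2.2
  have hπ : 0 < Real.pi / (2 * (-k.re / 2)) := div_pos Real.pi_pos (by linarith)
  refine ⟨_, Real.rpow_pos_of_pos hπ ((1 : ℝ) / 4), (K + 1) * G, by positivity, f,
    tendsto_eLpNorm_of_eLpNorm_sub_le (by positivity)
      (fun h hh => (hf h hh).1.continuous.aestronglyMeasurable)
      (fun h _ => Continuous.aestronglyMeasurable (by fun_prop)) hgnorm (by positivity) hgauss,
    fun h hh => ?_⟩
  rw [← Real.sqrt_eq_rpow]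
  obtain ⟨hsmooth, hcomp, hpos, hmom, hop, -⟩ := hf h hh
  have hs := Real.sqrt_nonneg h
  exact ⟨hsmooth, hcomp, hL2 _ _ h hh.1 hs hpos, hL2 _ _ h hh.1 hs hmom,
    hL2 _ _ h hh.1 (pow_nonneg hh.1.le _) hop, hgauss h hh⟩
end

section
/- Let κ ∈ ℂ with Re(κ) > 0. For h > 0, u ∈ ℝ and ξ > 0 define g̃_{h,u,ξ}(x) = exp{iξ(x−u)/h − (x−u)²/(2hκξ)} (which lies in L²(ℝ)), and let ẽ_{h,u,ξ} = g̃_{h,u,ξ}/‖g̃_{h,u,ξ}‖₂. Define, for φ continuous with compact support in ℝ²₊ = ℝ × (0,∞), (Ẽ_h φ)(x) = h^{−1/2} ∫_{ℝ²₊} φ(u,ξ) ẽ_{h,u,ξ}(x) du dξ. Then there exists a constant C, depending only on κ, such that ‖Ẽ_h φ‖_{L²(ℝ)} ≤ C ‖φ‖_{L²(ℝ²₊)} for all such φ and all h > 0; consequently Ẽ_h extends to a bounded operator from L²(ℝ²₊) to L²(ℝ) whose norm is bounded uniformly as h → 0. -/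
open MeasureTheory
open scoped ENNReal

/-- The twisted FBI Gaussian `g̃_{h,u,ξ}(x) = exp{iξ(x-u)/h - (x-u)²/(2hκξ)}`. -/
noncomputable def twistedGaussian (κ : ℂ) (h u ξ : ℝ) (x : ℝ) : ℂ :=
  Complex.exp (Complex.I * (ξ:ℂ) * ((x:ℂ) - (u:ℂ)) / (h:ℂ)
    - ((x:ℂ) - (u:ℂ))^2 / (2 * (h:ℂ) * κ * (ξ:ℂ)))

/-- Its `L²`-normalization `ẽ_{h,u,ξ}`. -/
noncomputable def twistedCoherentState (κ : ℂ) (h u ξ : ℝ) (x : ℝ) : ℂ :=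
  twistedGaussian κ h u ξ x
    / ((eLpNorm (twistedGaussian κ h u ξ) 2 volume).toReal : ℂ)

open scoped FourierTransform SchwartzMap ContDiff

/-- Two locally integrable functions with the same pairings against Schwartz functions agree a.e. -/
theorem ae_eq_of_integral_schwartzMap_mul_eq {f g : ℝ → ℂ} (hf : LocallyIntegrable f)
    (hg : LocallyIntegrable g) (h : ∀ ψ : 𝓢(ℝ, ℂ), ∫ x, ψ x * f x = ∫ x, ψ x * g x) :
    f =ᵐ[volume] g := by
  refine ae_eq_of_integral_contDiff_smul_eq hf hg fun ψ hψ hψc => ?_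
  have hc : HasCompactSupport (Complex.ofRealCLM ∘ ψ) := hψc.comp_left rfl
  have hd : ContDiff ℝ ∞ (Complex.ofRealCLM ∘ ψ) := by fun_prop
  simpa using h (hc.toSchwartzMap hd)

/-- Multiplication formula for the Fourier transform of an integrable function against a Schwartz
function. -/
theorem integral_fourier_schwartzMap_mul {f : ℝ → ℂ} (hf : Integrable f) (ψ : 𝓢(ℝ, ℂ)) :
    ∫ x, (𝓕 ψ) x * f x = ∫ x, ψ x * 𝓕 f x := by
  have := VectorFourier.integral_fourierIntegral_smul_eq_flip (L := innerₗ ℝ) (μ := volume)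
    (ν := volume) Real.continuous_fourierChar continuous_inner ψ.integrable hf
  rw [flip_innerₗ] at this
  simpa [SchwartzMap.fourier_coe] using! this

theorem continuous_fourier_of_integrable {f : ℝ → ℂ} (hf : Integrable f) :
    Continuous (𝓕 f) :=
  VectorFourier.fourierIntegral_continuous Real.continuous_fourierChar
    (L := innerₗ ℝ) continuous_inner hf

/-- **Plancherel's theorem** for integrable functions; both sides may be infinite. -/
theorem eLpNorm_fourier_eq_of_integrable {f : ℝ → ℂ} (hf : Integrable f) :
    eLpNorm (𝓕 f) 2 volume = eLpNorm f 2 volume := by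
  have hcont := continuous_fourier_of_integrable hf
  by_cases h2 : MemLp f 2
  · have hae : (𝓕 (h2.toLp f) : Lp ℂ 2 (volume : Measure ℝ)) =ᵐ[volume] 𝓕 f := by
      refine ae_eq_of_integral_schwartzMap_mul_eq
        ((Lp.memLp _).locallyIntegrable (by norm_num)) hcont.locallyIntegrable fun ψ => ?_
      rw [← integral_fourier_schwartzMap_mul hf]
      have := congrArg (fun T => T ψ) (Lp.fourier_toTemperedDistribution_eq (h2.toLp f))
      simp only [TemperedDistribution.fourier_apply, Lp.toTemperedDistribution_apply,
        smul_eq_mul] at this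
      rw [← this]
      refine integral_congr_ae ?_
      filter_upwards [h2.coeFn_toLp] with x hx
      rw [hx]
    rw [← eLpNorm_congr_ae hae, ← eLpNorm_congr_ae h2.coeFn_toLp, ← Lp.enorm_def, ← Lp.enorm_def,
      ← ofReal_norm, Lp.norm_fourier_eq, ofReal_norm]
  · by_cases h2' : MemLp (𝓕 f) 2
    · refine absurd ?_ h2
      have hae : (𝓕⁻ (h2'.toLp (𝓕 f)) : Lp ℂ 2 (volume : Measure ℝ)) =ᵐ[volume] f := by
        refine ae_eq_of_integral_schwartzMap_mul_eq
          ((Lp.memLp _).locallyIntegrable (by norm_num)) hf.locallyIntegrable fun ψ => ?_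
        have := congrArg (fun T => T ψ) (Lp.fourierInv_toTemperedDistribution_eq (h2'.toLp (𝓕 f)))
        simp only [TemperedDistribution.fourierInv_apply, Lp.toTemperedDistribution_apply,
          smul_eq_mul] at this
        rw [← this]
        calc _ = ∫ x, (𝓕⁻ ψ) x * 𝓕 f x := by
              refine integral_congr_ae ?_
              filter_upwards [h2'.coeFn_toLp] with x hx
              rw [hx]
          _ = _ := by
              rw [← integral_fourier_schwartzMap_mul hf, FourierTransform.fourier_fourierInv_eq]
      exact (memLp_congr_ae hae).1 (Lp.memLp _)
    · rw [MemLp, not_and, not_lt, top_le_iff] at h2 h2'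
      rw [h2 hf.1, h2' hcont.aestronglyMeasurable]

/-- A Gaussian-type integral, bounded uniformly in the centre `η`. -/
theorem lintegral_sqrt_mul_exp_le {ρ : ℝ} (hρ : 0 < ρ) (η : ℝ) :
    ∫⁻ ξ in Set.Ioi 0, ENNReal.ofReal (√ξ * Real.exp (-(ρ * ξ * (ξ - η) ^ 2)))
      ≤ ENNReal.ofReal (8 / 3 * √Real.pi / √ρ) := by
  have hcube : ∫⁻ ξ in Set.Ioi 0, ENNReal.ofReal (ξ ^ (1 / 2 : ℝ) *
      Real.exp (-(ρ / 4) * ξ ^ (3 : ℝ))) = ENNReal.ofReal (2 / 3 * √Real.pi / √ρ) := by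
    rw [← ofReal_integral_eq_lintegral_ofReal
      (integrableOn_rpow_mul_exp_neg_mul_rpow (by norm_num) (by norm_num) (by positivity)),
      integral_rpow_mul_exp_neg_mul_rpow (by norm_num) (by norm_num) (by positivity)]
    · congr 1
      have h4 : √(ρ / 4) = √ρ / 2 := by
        rw [Real.sqrt_div hρ.le, show (4 : ℝ) = 2 ^ 2 by norm_num, Real.sqrt_sq (by norm_num)]
      rw [show -((1 / 2 : ℝ) + 1) / 3 = -(1 / 2) by norm_num,
        show ((1 / 2 : ℝ) + 1) / 3 = 1 / 2 by norm_num, Real.Gamma_one_half_eq,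
        Real.rpow_neg (by positivity), ← Real.sqrt_eq_rpow, h4]
      field_simp
    · filter_upwards [ae_restrict_mem measurableSet_Ioi] with ξ hξ
      have : (0 : ℝ) < ξ := hξ
      positivity
  have hgauss : ∫⁻ ξ, ENNReal.ofReal (√(2 * η) * Real.exp (-(ρ * η / 2) * (ξ - η) ^ 2))
      ≤ ENNReal.ofReal (2 * √Real.pi / √ρ) := by
    rcases le_or_gt η 0 with hη | hη
    · simp [Real.sqrt_eq_zero_of_nonpos (show 2 * η ≤ 0 by linarith)]
    · have hb : 0 < ρ * η / 2 := by positivity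
      rw [← ofReal_integral_eq_lintegral_ofReal
        (((integrable_exp_neg_mul_sq hb).comp_sub_right η).const_mul _)
        (.of_forall fun ξ => by positivity), integral_const_mul,
        integral_sub_right_eq_self (fun ξ => Real.exp (-(ρ * η / 2) * ξ ^ 2)), integral_gaussian]
      refine ENNReal.ofReal_le_ofReal (le_of_eq ?_)
      rw [← Real.sqrt_mul (by positivity), show 2 * η * (Real.pi / (ρ * η / 2)) =
        2 ^ 2 * Real.pi / ρ by field_simp, Real.sqrt_div (by positivity),
        Real.sqrt_mul (by positivity), Real.sqrt_sq (by norm_num)]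
  calc _ ≤ ∫⁻ ξ in Set.Ioi 0, (ENNReal.ofReal (ξ ^ (1 / 2 : ℝ) *
          Real.exp (-(ρ / 4) * ξ ^ (3 : ℝ))) +
          ENNReal.ofReal (√(2 * η) * Real.exp (-(ρ * η / 2) * (ξ - η) ^ 2))) := by
        refine setLIntegral_mono (by fun_prop) fun ξ hξ => ?_
        have hξ : (0 : ℝ) < ξ := hξ
        by_cases h : ξ ^ 2 / 4 ≤ (ξ - η) ^ 2
        · refine le_add_right (ENNReal.ofReal_le_ofReal ?_)
          rw [← Real.sqrt_eq_rpow, show ξ ^ (3 : ℝ) = ξ ^ 3 by norm_cast]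
          gcongr
          nlinarith [mul_le_mul_of_nonneg_left h (mul_pos hρ hξ).le]
        · refine le_add_left (ENNReal.ofReal_le_ofReal ?_)
          have h1 : η ≤ 2 * ξ := by by_contra! H; nlinarith
          have h2 : ξ ≤ 2 * η := by by_contra! H; nlinarith
          gcongr
          nlinarith [mul_nonneg hρ.le (mul_nonneg (sub_nonneg.2 h1) (sq_nonneg (ξ - η)))]
    _ = (∫⁻ ξ in Set.Ioi 0, ENNReal.ofReal (ξ ^ (1 / 2 : ℝ) *
          Real.exp (-(ρ / 4) * ξ ^ (3 : ℝ)))) + ∫⁻ ξ in Set.Ioi 0,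
          ENNReal.ofReal (√(2 * η) * Real.exp (-(ρ * η / 2) * (ξ - η) ^ 2)) :=
        lintegral_add_left (by fun_prop) _
    _ ≤ ENNReal.ofReal (2 / 3 * √Real.pi / √ρ) + ENNReal.ofReal (2 * √Real.pi / √ρ) := by
        rw [hcube]
        gcongr
        exact (setLIntegral_le_lintegral _ _).trans hgauss
    _ = _ := by
        rw [← ENNReal.ofReal_add (by positivity) (by positivity)]
        congr 1
        ring

theorem lintegral_enorm_sq_fourier_of_integrable {f : ℝ → ℂ} (hf : Integrable f) :
    ∫⁻ x, ‖𝓕 f x‖ₑ ^ 2 = ∫⁻ x, ‖f x‖ₑ ^ 2 := by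
  have h := eLpNorm_fourier_eq_of_integrable hf
  rw [eLpNorm_eq_lintegral_rpow_enorm_toReal (by norm_num) (by norm_num),
    eLpNorm_eq_lintegral_rpow_enorm_toReal (by norm_num) (by norm_num)] at h
  simpa using ENNReal.rpow_left_injective (by norm_num) h

theorem lintegral_mul_sq_le {α : Type*} [MeasurableSpace α] {μ : Measure α} {f g : α → ℝ≥0∞}
    (hf : AEMeasurable f μ) (hg : AEMeasurable g μ) :
    (∫⁻ a, f a * g a ∂μ) ^ 2 ≤ (∫⁻ a, f a ^ 2 ∂μ) * ∫⁻ a, g a ^ 2 ∂μ := by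
  have h := ENNReal.lintegral_mul_le_Lp_mul_Lq μ Real.HolderConjugate.two_two hf hg
  simp only [Pi.mul_apply, ENNReal.rpow_two] at h
  calc _ ≤ ((∫⁻ a, f a ^ 2 ∂μ) ^ (1 / 2 : ℝ) * (∫⁻ a, g a ^ 2 ∂μ) ^ (1 / 2 : ℝ)) ^ 2 := by gcongr
    _ = _ := by
      rw [mul_pow, ← ENNReal.rpow_natCast, ← ENNReal.rpow_natCast, ← ENNReal.rpow_mul,
        ← ENNReal.rpow_mul]
      norm_num

/-- The Fourier transform of a measurable family of functions is jointly measurable. -/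
theorem stronglyMeasurable_fourier_family {k : ℝ → ℝ → ℂ}
    (hk : StronglyMeasurable (Function.uncurry k)) :
    StronglyMeasurable fun q : ℝ × ℝ => 𝓕 (k q.2) q.1 := by
  simp_rw [Real.fourier_real_eq]
  refine StronglyMeasurable.integral_prod_right (f := fun (q : ℝ × ℝ) (v : ℝ) =>
    Real.fourierChar (-(v * q.1)) • k q.2 v) ?_
  have h1 : StronglyMeasurable fun q : (ℝ × ℝ) × ℝ => (Real.fourierChar (-(q.2 * q.1.1)) : ℂ) :=
    Continuous.stronglyMeasurable (by fun_prop)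
  have h2 : StronglyMeasurable fun q : (ℝ × ℝ) × ℝ => k q.1.2 q.2 :=
    hk.comp_measurable (g := fun q : (ℝ × ℝ) × ℝ => (q.1.2, q.2)) (by fun_prop)
  exact h1.mul h2

/-- The Fourier transform of a superposition of translates `φ (u, ξ) k ξ (x - u)`. -/
theorem fourier_integral_translates {k : ℝ → ℝ → ℂ} {φ : ℝ × ℝ → ℂ} {ν : Measure ℝ} [SFinite ν]
    (hint : Integrable (fun q : (ℝ × ℝ) × ℝ => φ q.1 * k q.1.2 (q.2 - q.1.1))
      (((volume : Measure ℝ).prod ν).prod volume)) (η : ℝ) :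
    𝓕 (fun x => ∫ p, φ p * k p.2 (x - p.1) ∂((volume : Measure ℝ).prod ν)) η =
      ∫ ξ, 𝓕 (k ξ) η * 𝓕 (fun u => φ (u, ξ)) η ∂ν := by
  have hE : Integrable (fun q : (ℝ × ℝ) × ℝ =>
      (Real.fourierChar (-(q.2 * η)) : ℂ) * (φ q.1 * k q.1.2 (q.2 - q.1.1)))
      (((volume : Measure ℝ).prod ν).prod volume) := by
    refine hint.bdd_mul (c := 1) (Continuous.aestronglyMeasurable (by fun_prop)) ?_
    exact .of_forall fun q => (Circle.norm_coe _).le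
  have hinner : ∀ p : ℝ × ℝ, ∫ x, (Real.fourierChar (-(x * η)) : ℂ) * (φ p * k p.2 (x - p.1)) =
      𝓕 (k p.2) η * ((Real.fourierChar (-(p.1 * η)) : ℂ) * φ p) := by
    intro p
    rw [← integral_add_right_eq_self _ p.1, Real.fourier_real_eq, ← integral_mul_const]
    refine integral_congr_ae (.of_forall fun x => ?_)
    simp only [add_sub_cancel_right, Circle.smul_def, smul_eq_mul]
    rw [show -((x + p.1) * η) = -(x * η) + -(p.1 * η) by ring, AddChar.map_add_eq_mul,
      Circle.coe_mul]
    ring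
  have hI : Integrable (fun p : ℝ × ℝ =>
      𝓕 (k p.2) η * ((Real.fourierChar (-(p.1 * η)) : ℂ) * φ p))
      ((volume : Measure ℝ).prod ν) := by
    simpa only [hinner] using hE.integral_prod_left
  calc _ = ∫ x, ∫ p, (Real.fourierChar (-(x * η)) : ℂ) * (φ p * k p.2 (x - p.1))
          ∂((volume : Measure ℝ).prod ν) := by
        rw [Real.fourier_real_eq]
        simp only [Circle.smul_def, smul_eq_mul, integral_const_mul]
    _ = ∫ p, 𝓕 (k p.2) η * ((Real.fourierChar (-(p.1 * η)) : ℂ) * φ p)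
          ∂((volume : Measure ℝ).prod ν) := by
        rw [← integral_integral_swap (f := fun p x =>
          (Real.fourierChar (-(x * η)) : ℂ) * (φ p * k p.2 (x - p.1))) hE]
        simp only [hinner]
    _ = _ := by
        rw [integral_prod_symm _ hI]
        simp only [integral_const_mul, Real.fourier_real_eq (fun u => φ (u, _)), Circle.smul_def,
          smul_eq_mul]

/-- `L²` boundedness of the superposition of translates of a family `k ξ`, from a uniform bound on
the square function of the Fourier transforms. -/
theorem lintegral_enorm_sq_integral_translates_le {k : ℝ → ℝ → ℂ}
    (hk : StronglyMeasurable (Function.uncurry k)) {φ : ℝ × ℝ → ℂ} (hφ : Continuous φ)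
    (hφc : HasCompactSupport φ) {ν : Measure ℝ} [SFinite ν]
    (hint : Integrable (fun q : (ℝ × ℝ) × ℝ => φ q.1 * k q.1.2 (q.2 - q.1.1))
      (((volume : Measure ℝ).prod ν).prod volume))
    {M : ℝ≥0∞} (hM : ∀ η, ∫⁻ ξ, ‖𝓕 (k ξ) η‖ₑ ^ 2 ∂ν ≤ M) :
    ∫⁻ x, ‖∫ p, φ p * k p.2 (x - p.1) ∂((volume : Measure ℝ).prod ν)‖ₑ ^ 2 ≤
      M * ∫⁻ p, ‖φ p‖ₑ ^ 2 ∂((volume : Measure ℝ).prod ν) := by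
  have hk' := stronglyMeasurable_fourier_family hk
  have hφ' : StronglyMeasurable fun q : ℝ × ℝ => 𝓕 (fun u => φ (u, q.2)) q.1 :=
    stronglyMeasurable_fourier_family (k := fun ξ u => φ (u, ξ))
      (hφ.comp continuous_swap).stronglyMeasurable
  have hslice (ξ : ℝ) : Integrable fun u => φ (u, ξ) := by
    refine Continuous.integrable_of_hasCompactSupport (by fun_prop) ?_
    refine HasCompactSupport.intro (hφc.isCompact.image continuous_fst) fun u hu => ?_
    exact image_eq_zero_of_notMem_tsupport fun h => hu ⟨_, h, rfl⟩
  rw [← lintegral_enorm_sq_fourier_of_integrable hint.integral_prod_right]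
  simp only [fourier_integral_translates hint]
  calc _ ≤ ∫⁻ η, M * ∫⁻ ξ, ‖𝓕 (fun u => φ (u, ξ)) η‖ₑ ^ 2 ∂ν := by
        refine lintegral_mono fun η => ?_
        calc _ ≤ (∫⁻ ξ, ‖𝓕 (k ξ) η‖ₑ * ‖𝓕 (fun u => φ (u, ξ)) η‖ₑ ∂ν) ^ 2 := by
              gcongr
              refine (enorm_integral_le_lintegral_enorm _).trans_eq ?_
              simp only [enorm_mul]
          _ ≤ (∫⁻ ξ, ‖𝓕 (k ξ) η‖ₑ ^ 2 ∂ν) * ∫⁻ ξ, ‖𝓕 (fun u => φ (u, ξ)) η‖ₑ ^ 2 ∂ν :=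
              lintegral_mul_sq_le
                (hk'.comp_measurable measurable_prodMk_left).enorm.aemeasurable
                (hφ'.comp_measurable measurable_prodMk_left).enorm.aemeasurable
          _ ≤ _ := by gcongr; exact hM η
    _ = M * ∫⁻ ξ, (∫⁻ u, ‖φ (u, ξ)‖ₑ ^ 2) ∂ν := by
        rw [lintegral_const_mul _ (hφ'.enorm.pow_const 2).lintegral_prod_right',
          lintegral_lintegral_swap (hφ'.enorm.pow_const 2).aemeasurable]
        simp only [lintegral_enorm_sq_fourier_of_integrable (hslice _)]
    _ = _ := by
        rw [lintegral_prod_symm' _ (by fun_prop)]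

theorem norm_twistedGaussian (κ : ℂ) (h u ξ x : ℝ) :
    ‖twistedGaussian κ h u ξ x‖ = Real.exp (-(κ⁻¹.re / (2 * h * ξ)) * (x - u) ^ 2) := by
  have hsplit : Complex.I * (ξ : ℂ) * ((x : ℂ) - (u : ℂ)) / (h : ℂ)
      - ((x : ℂ) - (u : ℂ)) ^ 2 / (2 * (h : ℂ) * κ * (ξ : ℂ)) =
      ((ξ * (x - u) / h : ℝ) : ℂ) * Complex.I - ((x - u) ^ 2 / (2 * h * ξ) : ℝ) * κ⁻¹ := by
    push_cast
    simp only [div_eq_mul_inv, mul_inv]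
    ring
  rw [twistedGaussian, Complex.norm_exp, hsplit, Complex.sub_re, Complex.re_ofReal_mul,
    Complex.re_ofReal_mul, Complex.I_re]
  congr 1
  ring

theorem inv_re_pos {κ : ℂ} (hκ : 0 < κ.re) : 0 < κ⁻¹.re := by
  rw [Complex.inv_re]
  exact div_pos hκ (Complex.normSq_pos.2 fun h => by simp [h] at hκ)

theorem toReal_eLpNorm_twistedGaussian {κ : ℂ} (hκ : 0 < κ.re) {h ξ : ℝ} (hh : 0 < h)
    (hξ : 0 < ξ) (u : ℝ) :
    (eLpNorm (twistedGaussian κ h u ξ) 2 volume).toReal = √√(Real.pi * h * ξ / κ⁻¹.re) := by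
  have ha := inv_re_pos hκ
  have hsq : ∫⁻ x, ‖twistedGaussian κ h u ξ x‖ₑ ^ (2 : ℝ) =
      ENNReal.ofReal √(Real.pi * h * ξ / κ⁻¹.re) := by
    have hb : 0 < κ⁻¹.re / (h * ξ) := by positivity
    have hpt (x : ℝ) : ‖twistedGaussian κ h u ξ x‖ₑ ^ (2 : ℝ) =
        ENNReal.ofReal (Real.exp (-(κ⁻¹.re / (h * ξ)) * (x - u) ^ 2)) := by
      rw [← ofReal_norm, norm_twistedGaussian, ENNReal.rpow_two,
        ← ENNReal.ofReal_pow (by positivity), ← Real.exp_nat_mul]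
      congr 2
      push_cast
      field_simp
    simp only [hpt]
    rw [← ofReal_integral_eq_lintegral_ofReal ((integrable_exp_neg_mul_sq hb).comp_sub_right u)
      (.of_forall fun x => by positivity),
      integral_sub_right_eq_self (fun x => Real.exp (-(κ⁻¹.re / (h * ξ)) * x ^ 2)),
      integral_gaussian]
    congr 2
    field_simp
  rw [eLpNorm_eq_lintegral_rpow_enorm_toReal (by norm_num) (by norm_num), ENNReal.toReal_ofNat,
    hsq, ENNReal.ofReal_rpow_of_nonneg (by positivity) (by norm_num),
    ENNReal.toReal_ofReal (by positivity), ← Real.sqrt_eq_rpow]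

/-- The rescaled coherent state `h^{-1/2} ẽ_{h,0,ξ}`, with its normalization made explicit. -/
noncomputable def twistedKernel (κ : ℂ) (h ξ y : ℝ) : ℂ :=
  ((√h)⁻¹ * (√√(Real.pi * h * ξ / κ⁻¹.re))⁻¹ : ℝ) * twistedGaussian κ h 0 ξ y

theorem rpow_mul_twistedCoherentState {κ : ℂ} (hκ : 0 < κ.re) {h ξ : ℝ} (hh : 0 < h)
    (hξ : 0 < ξ) (u x : ℝ) :
    ((h ^ (-(1 : ℝ) / 2) : ℝ) : ℂ) * twistedCoherentState κ h u ξ x =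
      twistedKernel κ h ξ (x - u) := by
  have hg : twistedGaussian κ h 0 ξ (x - u) = twistedGaussian κ h u ξ x := by
    simp [twistedGaussian]
  rw [twistedCoherentState, twistedKernel, toReal_eLpNorm_twistedGaussian hκ hh hξ, hg, neg_div,
    Real.rpow_neg hh.le, ← Real.sqrt_eq_rpow]
  push_cast
  ring

theorem stronglyMeasurable_twistedKernel (κ : ℂ) (h : ℝ) :
    StronglyMeasurable (Function.uncurry (twistedKernel κ h)) := by
  refine Measurable.stronglyMeasurable ?_
  unfold Function.uncurry twistedKernel twistedGaussian
  fun_prop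

theorem norm_twistedKernel (κ : ℂ) (h ξ y : ℝ) :
    ‖twistedKernel κ h ξ y‖ = (√h)⁻¹ * (√√(Real.pi * h * ξ / κ⁻¹.re))⁻¹ *
      Real.exp (-(κ⁻¹.re / (2 * h * ξ)) * y ^ 2) := by
  rw [twistedKernel, norm_mul, norm_twistedGaussian, Complex.norm_real, Real.norm_of_nonneg
    (by positivity), sub_zero]

theorem norm_sq_fourier_twistedKernel {κ : ℂ} (hκ : 0 < κ.re) {h ξ : ℝ} (hh : 0 < h)
    (hξ : 0 < ξ) (η : ℝ) :
    ‖𝓕 (twistedKernel κ h ξ) η‖ ^ 2 = 2 * √Real.pi * ‖κ‖ * √κ⁻¹.re / √h *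
      (√ξ * Real.exp (-(κ.re / h * ξ * (ξ - 2 * Real.pi * h * η) ^ 2))) := by
  have ha := inv_re_pos hκ
  have hκ0 : κ ≠ 0 := fun h => by simp [h] at hκ
  have hhC : (h : ℂ) ≠ 0 := by exact_mod_cast hh.ne'
  have hξC : (ξ : ℂ) ≠ 0 := by exact_mod_cast hξ.ne'
  set c : ℝ := (√h)⁻¹ * (√√(Real.pi * h * ξ / κ⁻¹.re))⁻¹ with hc
  set b : ℂ := ((2 * h * ξ : ℝ) : ℂ)⁻¹ * κ⁻¹ with hb
  set t : ℝ := ξ / h - 2 * Real.pi * η with ht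
  have hbre : 0 < b.re := by
    rw [hb, ← Complex.ofReal_inv, Complex.re_ofReal_mul]
    positivity
  have hF : 𝓕 (twistedKernel κ h ξ) η =
      c * ((Real.pi / b) ^ (1 / 2 : ℂ) * Complex.exp (-(t : ℂ) ^ 2 / (4 * b))) := by
    rw [← fourierIntegral_gaussian hbre, ← integral_const_mul,
      Real.fourier_real_eq_integral_exp_smul]
    refine integral_congr_ae (.of_forall fun x => ?_)
    simp only [twistedKernel, twistedGaussian, smul_eq_mul, ← hc]
    rw [mul_left_comm, ← Complex.exp_add, ← Complex.exp_add]
    congr 2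
    rw [hb, ht]
    push_cast
    field_simp
    ring
  have hpow : ‖((Real.pi : ℂ) / b) ^ (1 / 2 : ℂ)‖ ^ 2 = 2 * Real.pi * h * ξ * ‖κ‖ := by
    rw [← norm_pow, ← Complex.cpow_nat_mul]
    norm_num
    rw [hb]
    simp [abs_of_pos Real.pi_pos, abs_of_pos hh, abs_of_pos hξ]
    field_simp
  have hexp : ‖Complex.exp (-(t : ℂ) ^ 2 / (4 * b))‖ ^ 2 =
      Real.exp (-(κ.re / h * ξ * (ξ - 2 * Real.pi * h * η) ^ 2)) := by
    have : -(t : ℂ) ^ 2 / (4 * b) = ((-(t ^ 2 * h * ξ / 2) : ℝ) : ℂ) * κ := by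
      rw [hb]
      push_cast
      field_simp
      ring
    rw [this, Complex.norm_exp, Complex.re_ofReal_mul, ← Real.exp_nat_mul, ht]
    congr 1
    push_cast
    field_simp
  have hcsq : c ^ 2 = √κ⁻¹.re / (h * (√Real.pi * √h * √ξ)) := by
    rw [hc, mul_pow, inv_pow, inv_pow, Real.sq_sqrt hh.le, Real.sq_sqrt (by positivity),
      Real.sqrt_div (by positivity), Real.sqrt_mul (by positivity), Real.sqrt_mul (by positivity)]
    field_simp
  rw [hF, norm_mul, norm_mul, mul_pow, mul_pow, hpow, hexp, Complex.norm_real, Real.norm_eq_abs,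
    sq_abs, hcsq]
  have hπ := Real.sq_sqrt Real.pi_pos.le
  have hξs := Real.sq_sqrt hξ.le
  have hπ0 : 0 < √Real.pi := by positivity
  have hξ0 : 0 < √ξ := by positivity
  have hh0 : 0 < √h := by positivity
  generalize Real.exp _ = E
  field_simp
  rw [hπ, hξs]

theorem lintegral_fourier_twistedKernel_le {κ : ℂ} (hκ : 0 < κ.re) {h : ℝ} (hh : 0 < h) (η : ℝ) :
    ∫⁻ ξ in Set.Ioi 0, ‖𝓕 (twistedKernel κ h ξ) η‖ₑ ^ 2 ≤
      ENNReal.ofReal (16 / 3 * Real.pi * ‖κ‖ * √κ⁻¹.re / √κ.re) := by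
  calc _ = ∫⁻ ξ in Set.Ioi 0, ENNReal.ofReal (2 * √Real.pi * ‖κ‖ * √κ⁻¹.re / √h) *
          ENNReal.ofReal (√ξ * Real.exp (-(κ.re / h * ξ * (ξ - 2 * Real.pi * h * η) ^ 2))) := by
        refine setLIntegral_congr_fun measurableSet_Ioi fun ξ hξ => ?_
        rw [← ENNReal.ofReal_mul (by positivity), ← norm_sq_fourier_twistedKernel hκ hh hξ,
          ENNReal.ofReal_pow (norm_nonneg _), ofReal_norm]
    _ ≤ ENNReal.ofReal (2 * √Real.pi * ‖κ‖ * √κ⁻¹.re / √h) *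
          ENNReal.ofReal (8 / 3 * √Real.pi / √(κ.re / h)) := by
        rw [lintegral_const_mul _ (by fun_prop)]
        gcongr
        exact lintegral_sqrt_mul_exp_le (by positivity) _
    _ = _ := by
        rw [← ENNReal.ofReal_mul (by positivity), Real.sqrt_div hκ.le]
        congr 1
        have hh0 : 0 < √h := by positivity
        have hr0 : 0 < √κ.re := by positivity
        field_simp
        rw [Real.sq_sqrt Real.pi_pos.le]
        ring

theorem integrable_mul_twistedKernel {κ : ℂ} (hκ : 0 < κ.re) {h : ℝ} (hh : 0 < h)
    {φ : ℝ × ℝ → ℂ} (hφ : Continuous φ) (hφc : HasCompactSupport φ) :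
    Integrable (fun q : (ℝ × ℝ) × ℝ => φ q.1 * twistedKernel κ h q.1.2 (q.2 - q.1.1))
      (((volume : Measure ℝ).prod (volume.restrict (Set.Ioi 0))).prod volume) := by
  have ha := inv_re_pos hκ
  have hmem : ∀ᵐ p ∂(volume : Measure ℝ).prod (volume.restrict (Set.Ioi (0 : ℝ))), 0 < p.2 :=
    Measure.quasiMeasurePreserving_snd.ae (ae_restrict_mem measurableSet_Ioi)
  have hmeas : StronglyMeasurable fun q : (ℝ × ℝ) × ℝ =>
      φ q.1 * twistedKernel κ h q.1.2 (q.2 - q.1.1) :=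
    (hφ.comp continuous_fst).stronglyMeasurable.mul
      ((stronglyMeasurable_twistedKernel κ h).comp_measurable
        (g := fun q : (ℝ × ℝ) × ℝ => (q.1.2, q.2 - q.1.1)) (by fun_prop))
  have hgauss {ξ : ℝ} (hξ : 0 < ξ) (u : ℝ) :
      Integrable fun x => Real.exp (-(κ⁻¹.re / (2 * h * ξ)) * (x - u) ^ 2) :=
    (integrable_exp_neg_mul_sq (by positivity)).comp_sub_right u
  rw [integrable_prod_iff hmeas.aestronglyMeasurable]
  constructor
  · filter_upwards [hmem] with p hp
    refine ((hgauss hp p.1).const_mul (‖φ p‖ * ((√h)⁻¹ *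
      (√√(Real.pi * h * p.2 / κ⁻¹.re))⁻¹))).mono'
      (hmeas.comp_measurable measurable_prodMk_left).aestronglyMeasurable (.of_forall fun x => ?_)
    rw [norm_mul, norm_twistedKernel]
    exact le_of_eq (by ring)
  · have hcont : Integrable (fun p : ℝ × ℝ =>
        ‖φ p‖ * ((√h)⁻¹ * √2 * √√(Real.pi * h * p.2 / κ⁻¹.re))) (volume : Measure (ℝ × ℝ)) := by
      refine Continuous.integrable_of_hasCompactSupport (by fun_prop) ?_
      exact hφc.norm.mul_right
    have hle : (volume : Measure ℝ).prod (volume.restrict (Set.Ioi (0 : ℝ))) ≤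
        (volume : Measure (ℝ × ℝ)) := by
      rw [Measure.volume_eq_prod]
      exact Measure.prod_mono le_rfl Measure.restrict_le_self
    refine (hcont.mono_measure hle).congr ?_
    filter_upwards [hmem] with p hp
    simp only [norm_mul, norm_twistedKernel, integral_const_mul]
    rw [integral_sub_right_eq_self
      (fun x => Real.exp (-(κ⁻¹.re / (2 * h * p.2)) * x ^ 2)), integral_gaussian,
      show Real.pi / (κ⁻¹.re / (2 * h * p.2)) = 2 * (Real.pi * h * p.2 / κ⁻¹.re) by field_simp,
      Real.sqrt_mul (by norm_num)]
    have hpos : 0 < √√(Real.pi * h * p.2 / κ⁻¹.re) := by positivity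
    have hs := Real.sq_sqrt (Real.sqrt_nonneg (Real.pi * h * p.2 / κ⁻¹.re))
    set N := √√(Real.pi * h * p.2 / κ⁻¹.re)
    rw [← hs]
    field_simp

/-- Theorem 9 (uniform `L²` boundedness of the twisted FBI transform): for `Re κ > 0`
the operator `Ẽ_h φ = h^{-1/2} ∫_{ℝ²₊} φ(u,ξ) ẽ_{h,u,ξ} du dξ` is bounded from
`L²(ℝ²₊)` to `L²(ℝ)`, uniformly in `h > 0`. -/
theorem twistedFBI_bounded (κ : ℂ) (hκ : 0 < κ.re) :
    ∃ C : ℝ, 0 < C ∧ ∀ h : ℝ, 0 < h →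
      ∀ φ : ℝ × ℝ → ℂ, Continuous φ → HasCompactSupport φ →
        tsupport φ ⊆ {p : ℝ × ℝ | 0 < p.2} →
        eLpNorm (fun x : ℝ => ((h ^ (-(1:ℝ)/2) : ℝ) : ℂ) *
            ∫ p in {p : ℝ × ℝ | 0 < p.2}, φ p * twistedCoherentState κ h p.1 p.2 x) 2 volume
          ≤ ENNReal.ofReal C * eLpNorm φ 2 volume := by
  have ha := inv_re_pos hκ
  have hκ0 : 0 < ‖κ‖ := norm_pos_iff.2 fun h => by simp [h] at hκ
  refine ⟨√(16 / 3 * Real.pi * ‖κ‖ * √κ⁻¹.re / √κ.re), by positivity, fun h hh φ hφ hφc _ => ?_⟩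
  have hset : {p : ℝ × ℝ | 0 < p.2} = Set.univ ×ˢ Set.Ioi 0 := by ext; simp
  have hmeas : (volume : Measure (ℝ × ℝ)).restrict {p : ℝ × ℝ | 0 < p.2} =
      (volume : Measure ℝ).prod (volume.restrict (Set.Ioi 0)) := by
    rw [hset, Measure.volume_eq_prod, ← Measure.prod_restrict, Measure.restrict_univ]
  have hfun (x : ℝ) : ((h ^ (-(1:ℝ)/2) : ℝ) : ℂ) *
      ∫ p in {p : ℝ × ℝ | 0 < p.2}, φ p * twistedCoherentState κ h p.1 p.2 x =
      ∫ p, φ p * twistedKernel κ h p.2 (x - p.1)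
        ∂((volume : Measure ℝ).prod (volume.restrict (Set.Ioi 0))) := by
    rw [← hmeas, ← integral_const_mul]
    refine setIntegral_congr_fun (measurableSet_lt measurable_const measurable_snd) fun p hp => ?_
    simp only [← rpow_mul_twistedCoherentState hκ hh hp]
    ring
  simp only [hfun]
  rw [eLpNorm_eq_lintegral_rpow_enorm_toReal (by norm_num) (by norm_num),
    eLpNorm_eq_lintegral_rpow_enorm_toReal (by norm_num) (by norm_num)]
  simp only [ENNReal.toReal_ofNat, ENNReal.rpow_two]
  rw [Real.sqrt_eq_rpow, ← ENNReal.ofReal_rpow_of_nonneg (by positivity) (by norm_num),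
    ← ENNReal.mul_rpow_of_nonneg _ _ (by norm_num)]
  gcongr
  refine (lintegral_enorm_sq_integral_translates_le (stronglyMeasurable_twistedKernel κ h) hφ hφc
    (integrable_mul_twistedKernel hκ hh hφ hφc)
    fun η => lintegral_fourier_twistedKernel_le hκ hh η).trans ?_
  gcongr
  rw [← hmeas]
  exact Measure.restrict_le_self
end
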